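/- For every fixed ε > 0 there exists ε₁ > 0 such that for all sufficiently large integers m and positive integers N₁, N₂, N₃ with N₁N₂N₃ > m^(1+ε), the number of units λ ∈ (ℤ/mℤ)* that are NOT representable as λ ≡ x₁x₂x₃ (mod m) with x_j ∈ [1, N_j] is O(m^(1-ε₁)). -/

import Mathlib

section

open Polynomial Finset

/-- A nonzero `d × N` homogeneous system with more unknowns than equations has a nonzero
solution. -/
theorem exists_ne_zero_sum_eq_zero {K ι : Type*} [Field K] [Fintype ι] {d N : ℕ}
    (g : ι → Fin d → K[X]) (hg : ∀ i r, (g i r).natDegree < N) (h : d * N < Fintype.card ι) :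
    ∃ c : ι → K, c ≠ 0 ∧ ∀ r, ∑ i, C (c i) * g i r = 0 := by
  classical
  let L : (ι → K) →ₗ[K] (Fin d × Fin N → K) :=
    { toFun := fun c x => ∑ i, c i * (g i x.1).coeff x.2
      map_add' := by intro a b; ext x; simp [add_mul, sum_add_distrib]
      map_smul' := by intro a b; ext x; simp [mul_sum, mul_assoc] }
  have hker : LinearMap.ker L ≠ ⊥ := LinearMap.ker_ne_bot_of_finrank_lt (by simpa using h)
  obtain ⟨c, hc, hc0⟩ := Submodule.exists_mem_ne_zero_of_ne_bot hker
  refine ⟨c, hc0, fun r => ?_⟩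
  ext k
  by_cases hk : k < N
  · have := congrFun (LinearMap.mem_ker.1 hc) (r, ⟨k, hk⟩)
    simpa [L, finsetSum_coeff] using this
  · simp only [finsetSum_coeff, coeff_C_mul, coeff_zero]
    refine sum_eq_zero fun i _ => ?_
    rw [coeff_eq_zero_of_natDegree_lt ((hg i r).trans_le (not_lt.1 hk)), mul_zero]

theorem exists_isPrimitiveRoot_of_dvd_card_sub_one {K : Type*} [Field K] [Fintype K] {d : ℕ}
    (hd : d ∣ Fintype.card K - 1) : ∃ ζ : K, IsPrimitiveRoot ζ d := by
  classical
  obtain ⟨g, hg⟩ := IsCyclic.exists_generator (α := Kˣ)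
  obtain ⟨e, he⟩ := hd
  have hcard : orderOf g = Fintype.card K - 1 := by
    rw [orderOf_eq_card_of_forall_mem_zpowers hg, Nat.card_eq_fintype_card, Fintype.card_units]
  have hpos : 0 < Fintype.card K - 1 := by
    have := Fintype.one_lt_card (α := K); omega
  refine ⟨((g ^ e : Kˣ) : K), ?_⟩
  rw [IsPrimitiveRoot.coe_units_iff]
  have := IsPrimitiveRoot.orderOf g
  rw [hcard] at this
  exact this.pow hpos (by rw [he, mul_comm])

/-- The Bombieri–Stepanov upper bound for the number of `t` at which `f` takes a nonzero
`d`-th power value. -/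
theorem mul_card_pow_values_le {K : Type*} [Field K] [Fintype K] [DecidableEq K]
    {p k P P' d : ℕ} [Fact p.Prime] [CharP K p] (hP : P = p ^ k) (hQ : Fintype.card K = P ^ 2)
    (hP' : P = 1 + d * P') (hd : 2 ≤ d) (hlarge : d ^ 4 + 3 * d ^ 2 + d < P)
    (f : K[X]) (hf : f.natDegree = d + 1) :
    d * #{t : K | f.eval t ≠ 0 ∧ ∃ y, y ^ d = f.eval t} ≤ P ^ 2 + (2 * d ^ 2 + 1) * P := by
  classical
  have hf0 : f ≠ 0 := by rintro rfl; simp at hf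
  have hd0 : 0 < d := by omega
  obtain ⟨M, hM⟩ : ∃ M, P = d ^ 2 + M := Nat.exists_eq_add_of_le (by linarith [Nat.zero_le (d ^ 4)])
  have hsp : ∀ {κ : Type} [Fintype κ] (G : κ → K), (∑ i, G i) ^ P = ∑ i, G i ^ P := by
    intro κ _ G
    rw [hP, sum_pow_char_pow]
  let ι := Fin M × Fin (P + d ^ 2 + 1)
  let a : ι → ℕ := fun i => (d ^ 2 + i.1) % d
  let j : ι → ℕ := fun i => (d ^ 2 + i.1) / d - a i
  let v : ι → ℕ := fun i => (d ^ 2 + i.2) % d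
  let u : ι → ℕ := fun i => (d ^ 2 + i.2) / d - v i
  let r : ι → ℕ := fun i => (a i + v i) % d
  let κ : ι → ℕ := fun i => (a i + v i) / d
  have split : ∀ n, d * ((d ^ 2 + n) / d - (d ^ 2 + n) % d) + (d + 1) * ((d ^ 2 + n) % d)
      = d ^ 2 + n := by
    intro n
    have h1 := Nat.div_add_mod (d ^ 2 + n) d
    have h2 := Nat.mod_lt (d ^ 2 + n) hd0
    have h3 : d ≤ (d ^ 2 + n) / d := by
      rw [Nat.le_div_iff_mul_le hd0]; nlinarith
    obtain ⟨q, hq⟩ : ∃ q, (d ^ 2 + n) / d = (d ^ 2 + n) % d + q :=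
      ⟨(d ^ 2 + n) / d - (d ^ 2 + n) % d, by omega⟩
    rw [hq, Nat.add_sub_cancel_left]
    rw [hq] at h1
    linarith
  have h1 : ∀ i, d * j i + (d + 1) * a i = d ^ 2 + i.1 := fun i => split _
  have h2 : ∀ i, d * u i + (d + 1) * v i = d ^ 2 + i.2 := fun i => split _
  have h3 : ∀ i, d * κ i + r i = a i + v i := fun i => Nat.div_add_mod _ _
  have hr : ∀ i, r i < d := fun i => Nat.mod_lt _ hd0
  have hi1 : ∀ i : ι, (i.1 : ℕ) + d ^ 2 < P := fun i => by have := i.1.2; omega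
  have hi2 : ∀ i : ι, (i.2 : ℕ) ≤ P + d ^ 2 := fun i => by have := i.2.2; omega
  have degC : ∀ i, d * (j i * P + u i + (d + 1) * (κ i + a i * P')) + (d + 1) * r i
      = P * (d ^ 2 + i.1) + (d ^ 2 + i.2) := by
    intro i
    rw [← h1, ← h2]
    have := h3 i
    have e : d * (j i * P + u i + (d + 1) * (κ i + a i * P')) + (d + 1) * r i
      = d * j i * P + d * u i + (d + 1) * (d * κ i + r i) + (d + 1) * a i * (d * P') := by ring
    rw [e, this]
    have e2 : d * P' = P - 1 := by omega
    obtain ⟨P1, rfl⟩ : ∃ P1, P = P1 + 1 := ⟨P - 1, by omega⟩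
    rw [e2, Nat.add_sub_cancel]; ring
  have degh : ∀ i, d * (j i + u i * P + (d + 1) * (κ i + v i * P')) + (d + 1) * r i
      = (d ^ 2 + i.1) + P * (d ^ 2 + i.2) := by
    intro i
    rw [← h1, ← h2]
    have := h3 i
    have e : d * (j i + u i * P + (d + 1) * (κ i + v i * P')) + (d + 1) * r i
      = d * j i + d * u i * P + (d + 1) * (d * κ i + r i) + (d + 1) * v i * (d * P') := by ring
    rw [e, this]
    have e2 : d * P' = P - 1 := by omega
    obtain ⟨P1, rfl⟩ : ∃ P1, P = P1 + 1 := ⟨P - 1, by omega⟩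
    rw [e2, Nat.add_sub_cancel]; ring
  let gC : ι → K[X] := fun i => X ^ (j i * P + u i) * f ^ (κ i + a i * P')
  let gh : ι → K[X] := fun i => X ^ (j i + u i * P) * f ^ (κ i + v i * P')
  have hgC : ∀ i, (gC i).natDegree = j i * P + u i + (d + 1) * (κ i + a i * P') := by
    intro i
    rw [natDegree_mul (pow_ne_zero _ X_ne_zero) (pow_ne_zero _ hf0), natDegree_X_pow,
      natDegree_pow, hf, mul_comm (d + 1)]
  have hgh : ∀ i, (gh i).natDegree = j i + u i * P + (d + 1) * (κ i + v i * P') := by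
    intro i
    rw [natDegree_mul (pow_ne_zero _ X_ne_zero) (pow_ne_zero _ hf0), natDegree_X_pow,
      natDegree_pow, hf, mul_comm (d + 1)]
  have hgh0 : ∀ i, gh i ≠ 0 := fun i => mul_ne_zero (pow_ne_zero _ X_ne_zero) (pow_ne_zero _ hf0)
  obtain ⟨c, hc0, hc⟩ := exists_ne_zero_sum_eq_zero (d := d)
    (N := (P ^ 2 + 2 * d ^ 2) / d + 1)
    (fun i s => if r i = s then gC i else 0) (by
      intro i s
      split_ifs
      · rw [hgC, Nat.lt_succ_iff, Nat.le_div_iff_mul_le hd0]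
        have := degC i
        have h4 := hi1 i
        have h5 := hi2 i
        have : P * (d ^ 2 + i.1) + P ≤ P * P := by nlinarith
        nlinarith
      · simp) (by
      simp only [ι, Fintype.card_prod, Fintype.card_fin]
      have := Nat.div_mul_le_self (P ^ 2 + 2 * d ^ 2) d
      have e : d * ((P ^ 2 + 2 * d ^ 2) / d + 1) ≤ P ^ 2 + 2 * d ^ 2 + d := by linarith
      refine e.trans_lt ?_
      have h6 : d ^ 4 + 2 * d ^ 2 + d < M := by omega
      rw [hM]
      nlinarith)
  let h : ℕ → K[X] := fun s => ∑ i, C (c i ^ P) * (if r i = s then gh i else 0)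
  obtain ⟨i₀, hi₀⟩ : ∃ i, c i ≠ 0 := Function.ne_iff.1 hc0
  have hne : h (r i₀) ≠ 0 := by
    intro h0
    have hdeg := degree_sum_eq_of_disjoint (fun i => C (c i ^ P) * (if r i = r i₀ then gh i else 0))
      univ (by
        rintro x ⟨-, hx⟩ y ⟨-, hy⟩ hxy
        have hx1 : r x = r i₀ := by by_contra h; simp [h] at hx
        have hy1 : r y = r i₀ := by by_contra h; simp [h] at hy
        have hx2 : c x ^ P ≠ 0 := by intro h; simp [h] at hx
        have hy2 : c y ^ P ≠ 0 := by intro h; simp [h] at hy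
        simp only [Function.onFun, Function.comp, hx1, hy1, if_true, degree_C_mul hx2,
          degree_C_mul hy2]
        rw [degree_eq_natDegree (hgh0 x), degree_eq_natDegree (hgh0 y)]
        intro hxy'
        have e : (gh x).natDegree = (gh y).natDegree := by exact_mod_cast hxy'
        rw [hgh, hgh] at e
        have ex := degh x
        have ey := degh y
        rw [e, hx1, ← hy1] at ex
        rw [ex] at ey
        have bx := hi1 x
        have by' := hi1 y
        have key : (d ^ 2 + (x.1 : ℕ)) % P = (d ^ 2 + (y.1 : ℕ)) % P := by
          rw [← Nat.add_mul_mod_self_left _ P (d ^ 2 + x.2), ey, Nat.add_mul_mod_self_left]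
        rw [Nat.mod_eq_of_lt (by omega), Nat.mod_eq_of_lt (by omega)] at key
        have k1 : (x.1 : ℕ) = y.1 := by omega
        rw [key] at ey
        have k2 := Nat.eq_of_mul_eq_mul_left (by omega) (Nat.add_left_cancel ey)
        have k2' : (x.2 : ℕ) = y.2 := by omega
        exact hxy (Prod.ext (Fin.ext k1) (Fin.ext k2')))
    have hle := Finset.le_sup
      (f := fun i => degree (C (c i ^ P) * (if r i = r i₀ then gh i else 0)))
      (mem_univ i₀)
    rw [← hdeg] at hle
    have h0' : ∑ i, C (c i ^ P) * (if r i = r i₀ then gh i else 0) = 0 := h0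
    simp only [h0', degree_zero, if_true, le_bot_iff, degree_eq_bot, mul_eq_zero, C_eq_zero,
      hgh0, or_false] at hle
    exact pow_ne_zero P hi₀ hle
  have hdegh : ∀ s, d * (h s).natDegree ≤ P ^ 2 + (2 * d ^ 2 + 1) * P := by
    intro s
    rw [mul_comm, ← Nat.le_div_iff_mul_le hd0]
    refine natDegree_sum_le_of_forall_le _ _ fun i _ => ?_
    refine (natDegree_C_mul_le _ _).trans ?_
    split_ifs
    · rw [hgh, Nat.le_div_iff_mul_le hd0]
      have := degh i
      have h4 := hi1 i
      have h5 := hi2 i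
      nlinarith
    · simp
  obtain ⟨ζ, hζ⟩ := exists_isPrimitiveRoot_of_dvd_card_sub_one (K := K) (d := d)
    (by rw [hQ, hP']; exact ⟨P' * (2 + d * P'), by
          rw [show (1 + d * P') ^ 2 = d * (P' * (2 + d * P')) + 1 by ring, Nat.add_sub_cancel]⟩)
  have hfrob : ∀ x : K, (x ^ P) ^ P = x := fun x => by
    rw [← pow_mul, ← sq, ← hQ, FiniteField.pow_card]
  have hroot : ∀ t : K, f.eval t ≠ 0 → (∃ y, y ^ d = f.eval t) → ∀ s < d, (h s).eval t = 0 := by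
    rintro t ht ⟨y₀, hy₀⟩ s hs
    have hy0 : y₀ ≠ 0 := by rintro rfl; rw [zero_pow hd0.ne'] at hy₀; exact ht hy₀.symm
    have hvan : ∀ y : K, y ^ d = f.eval t → ∑ s ∈ range d, (h s).eval t * y ^ s = 0 := by
      intro y hy
      have hsum : ∀ G : ι → K, ∑ s ∈ range d, (∑ i, if r i = s then G i else 0) * y ^ s
          = ∑ i, G i * y ^ r i := by
        intro G
        simp only [sum_mul, ite_mul, zero_mul]
        rw [sum_comm]
        refine sum_congr rfl fun i _ => ?_
        rw [sum_ite_eq, if_pos (mem_range.2 (hr i))]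
      have hC : ∑ i, (c i * (gC i).eval t) * y ^ r i = 0 := by
        rw [← hsum]
        refine sum_eq_zero fun s hs => ?_
        have := congrArg (eval t) (hc ⟨s, mem_range.1 hs⟩)
        simp only [eval_finsetSum, eval_mul, eval_C, eval_zero] at this
        have e : ∑ i, (if r i = s then c i * (gC i).eval t else 0) = 0 := by
          refine Eq.trans (sum_congr rfl fun i _ => ?_) this
          split_ifs <;> simp
        rw [e, zero_mul]
      have hH : ∑ s ∈ range d, (h s).eval t * y ^ s = ∑ i, (c i ^ P * (gh i).eval t) * y ^ r i := by
        rw [← hsum]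
        refine sum_congr rfl fun s _ => ?_
        simp only [h, eval_finsetSum, eval_mul, eval_C]
        congr 1
        refine sum_congr rfl fun i _ => ?_
        split_ifs <;> simp
      have hpow : (∑ i, (c i ^ P * (gh i).eval t) * y ^ r i) ^ P = 0 := by
        rw [hsp, ← hC]
        refine sum_congr rfl fun i _ => ?_
        simp only [gh, gC, eval_mul, eval_pow, eval_X, ← hy]
        have e1 : (t ^ (j i + u i * P)) ^ P = t ^ (j i * P + u i) := by
          rw [← pow_mul, show (j i + u i * P) * P = j i * P + u i * P * P by ring, pow_add,
            pow_mul t (u i * P), pow_mul t (u i), hfrob, pow_add]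
        have e2 : ((y ^ d) ^ (κ i + v i * P') * y ^ r i) ^ P
            = (y ^ d) ^ (κ i + a i * P') * y ^ r i := by
          have e3 : d * (κ i + v i * P') + r i = a i + v i * P := by
            have := h3 i
            rw [hP']; linear_combination this
          have e4 : d * (κ i + a i * P') + r i = a i * P + v i := by
            have := h3 i
            rw [hP']; linear_combination this
          rw [← pow_mul, ← pow_add, e3, ← pow_mul y d, ← pow_add, e4, ← pow_mul,
            show (a i + v i * P) * P = a i * P + v i * P * P by ring, pow_add,
            pow_mul y (v i * P), pow_mul y (v i), hfrob, pow_add]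
        rw [mul_assoc, mul_pow, mul_assoc, mul_pow, e1, e2, hfrob]; ring
      rw [hH]
      exact pow_eq_zero_iff (by omega) |>.1 hpow
    let G : K[X] := ∑ s ∈ range d, C ((h s).eval t) * X ^ s
    have hG : G = 0 := by
      refine eq_zero_of_natDegree_lt_card_of_eval_eq_zero G
        (f := fun i : Fin d => ζ ^ (i : ℕ) * y₀) ?_ ?_ ?_
      · intro x y hxy
        have := mul_right_cancel₀ hy0 hxy
        exact Fin.ext (hζ.pow_inj x.2 y.2 this)
      · intro i
        simp only [G, eval_finsetSum, eval_mul, eval_C, eval_pow, eval_X]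
        refine hvan _ ?_
        rw [mul_pow, ← pow_mul, mul_comm (i : ℕ), pow_mul, hζ.pow_eq_one, one_pow, one_mul, hy₀]
      · rw [Fintype.card_fin]
        refine lt_of_le_of_lt (natDegree_sum_le_of_forall_le (n := d - 1) _ _ fun s hs => ?_)
          (by omega)
        refine (natDegree_C_mul_X_pow_le _ _).trans ?_
        have := mem_range.1 hs
        omega
    have := congrArg (fun q => coeff q s) hG
    simpa [G, finsetSum_coeff, coeff_X_pow, hs] using this
  refine le_trans (Nat.mul_le_mul_left d ?_) (hdegh (r i₀))
  refine (card_le_card (t := (h (r i₀)).roots.toFinset) fun t ht => ?_).trans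
    ((Multiset.toFinset_card_le _).trans (card_roots' _))
  rw [mem_filter] at ht
  rw [Multiset.mem_toFinset, mem_roots hne]
  exact hroot t ht.2.1 ht.2.2 _ (hr i₀)

end

section

open Polynomial Finset

theorem MulChar.exists_pow_eq_of_apply_eq_one {K : Type*} [Field K] [Fintype K]
    (χ : MulChar K ℂ) {x : K} (hx : χ x = 1) : ∃ y, y ^ orderOf χ = x := by
  classical
  obtain ⟨g, hg⟩ := IsCyclic.exists_generator (α := Kˣ)
  have hx0 : x ≠ 0 := by rintro rfl; simp at hx
  obtain ⟨n, hn⟩ := mem_powers_iff_mem_zpowers.2 (hg (Units.mk0 x hx0))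
  have hgn : (g : K) ^ n = x := by simpa using congrArg Units.val hn
  have h1 : χ ^ n = 1 := by
    rw [MulChar.eq_iff hg, MulChar.pow_apply_coe, MulChar.one_apply_coe, ← map_pow, hgn, hx]
  obtain ⟨k, rfl⟩ := orderOf_dvd_of_pow_eq_one h1
  exact ⟨(g : K) ^ k, by rw [← pow_mul, mul_comm, hgn]⟩

/-- A square-root bound for character sums over a field of square cardinality whose character
has order dividing `√|K| - 1`. -/
theorem MulChar.norm_sum_eval_le {K : Type*} [Field K] [Fintype K]
    {p k P P' : ℕ} [Fact p.Prime] [CharP K p] (hP : P = p ^ k) (hQ : Fintype.card K = P ^ 2)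
    (χ : MulChar K ℂ) {d : ℕ} (hχ : orderOf χ = d)
    (hP' : P = 1 + d * P') (hd : 2 ≤ d) (hlarge : d ^ 4 + 3 * d ^ 2 + d < P)
    (f : K[X]) (hf : f.natDegree = d + 1) :
    ‖∑ t, χ (f.eval t)‖ ≤ (2 * d ^ 2 + 1) * P + (d + 1) := by
  classical
  have hf0 : f ≠ 0 := by rintro rfl; simp at hf
  have hd0 : 0 < d := by omega
  have : NeZero d := ⟨hd0.ne'⟩
  obtain ⟨g, hg⟩ := IsCyclic.exists_generator (α := Kˣ)
  set w : ℂ := χ g with hw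
  have hwd : w ^ d = 1 := by
    rw [hw, ← MulChar.pow_apply_coe, ← hχ, pow_orderOf_eq_one, MulChar.one_apply_coe]
  have hw1 : ‖w‖ = 1 := Complex.norm_eq_one_of_pow_eq_one hwd hd0.ne'
  have hw0 : w ≠ 0 := by rintro h; rw [h] at hw1; simp at hw1
  have hprim : IsPrimitiveRoot w d := by
    refine IsPrimitiveRoot.mk_of_lt w hd0 hwd fun l hl0 hl h => ?_
    have : χ ^ l = 1 := by
      rw [MulChar.eq_iff hg, MulChar.pow_apply_coe, MulChar.one_apply_coe, ← hw, h]
    have := Nat.le_of_dvd hl0 (orderOf_dvd_of_pow_eq_one this)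
    omega
  let n : ℕ → ℕ := fun i => #{t : K | χ (f.eval t) = w ^ i}
  let U : ℝ := (P ^ 2 + (2 * d ^ 2 + 1) * P) / d
  have hn : ∀ i, (n i : ℝ) ≤ U := by
    intro i
    rw [le_div_iff₀ (by positivity), mul_comm]
    have key := mul_card_pow_values_le hP hQ hP' hd hlarge (C ((g⁻¹ ^ i : Kˣ) : K) * f) (by
      rw [natDegree_C_mul (Units.ne_zero _), hf])
    have hsub : n i ≤ #{t : K | (C ((g⁻¹ ^ i : Kˣ) : K) * f).eval t ≠ 0 ∧
        ∃ y, y ^ d = (C ((g⁻¹ ^ i : Kˣ) : K) * f).eval t} := by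
      refine card_le_card fun t ht => ?_
      rw [mem_filter] at ht ⊢
      have h1 : χ ((C ((g⁻¹ ^ i : Kˣ) : K) * f).eval t) = 1 := by
        rw [eval_mul, eval_C, map_mul, ht.2, hw, ← map_pow, ← map_mul, ← Units.val_pow_eq_pow_val,
          ← Units.val_mul]
        simp
      refine ⟨mem_univ _, fun h => ?_, hχ ▸ MulChar.exists_pow_eq_of_apply_eq_one χ h1⟩
      rw [h] at h1
      simp at h1
    exact_mod_cast (Nat.mul_le_mul_left d hsub).trans key
  have hval : ∀ t, χ (f.eval t) = ∑ i ∈ range d, if χ (f.eval t) = w ^ i then w ^ i else 0 := by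
    intro t
    by_cases h0 : f.eval t = 0
    · rw [h0, MulChar.map_zero, sum_eq_zero]
      intro i _
      rw [if_neg]
      exact (pow_ne_zero i hw0).symm
    · have : χ (f.eval t) ^ d = 1 := by
        have h := MulChar.pow_apply_coe χ d (Units.mk0 _ h0)
        rw [Units.val_mk0] at h
        rw [← h, ← hχ, pow_orderOf_eq_one, ← Units.val_mk0 h0, MulChar.one_apply_coe]
      obtain ⟨i, hi, hi'⟩ := hprim.eq_pow_of_pow_eq_one this
      rw [sum_eq_single i, if_pos hi'.symm, hi']
      · intro b hb hbi
        rw [if_neg]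
        intro h
        rw [← hi'] at h
        exact hbi (hprim.pow_inj (mem_range.1 hb) hi h.symm)
      · intro h; exact absurd (mem_range.2 hi) h
  have hsum : ∑ t, χ (f.eval t) = ∑ i ∈ range d, w ^ i * (n i : ℂ) := by
    rw [sum_congr rfl fun t _ => hval t, sum_comm]
    refine sum_congr rfl fun i _ => ?_
    rw [← sum_filter, sum_const, nsmul_eq_mul, mul_comm]
  have hsumn : (P : ℝ) ^ 2 - (d + 1) ≤ ∑ i ∈ range d, (n i : ℝ) := by
    have h1 : P ^ 2 ≤ ∑ i ∈ range d, n i + (d + 1) := by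
      have hz : #{t : K | f.eval t = 0} ≤ d + 1 := by
        rw [← hf]
        refine (card_le_card (t := f.roots.toFinset) fun t ht => ?_).trans
          ((Multiset.toFinset_card_le _).trans (card_roots' _))
        rw [mem_filter] at ht
        rw [Multiset.mem_toFinset, mem_roots hf0]
        exact ht.2
      refine le_trans ?_ (Nat.add_le_add_left hz _)
      rw [← hQ, ← card_univ]
      refine (card_le_card (t := (range d).biUnion (fun i => {t : K | χ (f.eval t) = w ^ i}) ∪
        univ.filter fun t => f.eval t = 0) fun t _ => ?_).trans ((card_union_le _ _).trans
          (Nat.add_le_add_right card_biUnion_le _))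
      rw [mem_union, mem_biUnion, mem_filter]
      by_cases h0 : f.eval t = 0
      · exact Or.inr ⟨mem_univ _, h0⟩
      · left
        by_contra! hcon
        have := hval t
        rw [sum_eq_zero fun i hi => if_neg fun h => hcon i hi (by simp [h])] at this
        exact h0 (by simpa using (MulChar.apply_eq_zero_iff (χ := χ)).1 this)
    have : (P : ℝ) ^ 2 ≤ ∑ i ∈ range d, (n i : ℝ) + (d + 1) := by exact_mod_cast h1
    linarith
  have hgeom : ∑ i ∈ range d, w ^ i = 0 := hprim.geom_sum_eq_zero (by omega)
  have hre : ∑ t, χ (f.eval t) = ∑ i ∈ range d, w ^ i * ((n i : ℂ) - U) := by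
    simp_rw [mul_sub, sum_sub_distrib]
    rw [← sum_mul, hgeom, zero_mul, sub_zero, hsum]
  rw [hre]
  calc ‖∑ i ∈ range d, w ^ i * ((n i : ℂ) - U)‖
      ≤ ∑ i ∈ range d, (U - n i) := by
        refine norm_sum_le_of_le _ fun i _ => ?_
        rw [norm_mul, norm_pow, hw1, one_pow, one_mul]
        have : (n i : ℂ) - (U : ℂ) = ((n i - U : ℝ) : ℂ) := by push_cast; ring
        rw [this, Complex.norm_real, Real.norm_eq_abs, abs_sub_comm, abs_of_nonneg]
        linarith [hn i]
    _ = d * U - ∑ i ∈ range d, (n i : ℝ) := by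
        rw [sum_sub_distrib, sum_const, card_range, nsmul_eq_mul]
    _ ≤ _ := by
        have : d * U = P ^ 2 + (2 * d ^ 2 + 1) * P := by
          simp only [U]; field_simp
        rw [this]; linarith

end

section

open Polynomial Finset

/-- The lift of a multiplicative character along the norm of a finite extension. -/
noncomputable def MulChar.normLift {F : Type*} (K : Type*) [Field F] [Field K] [Algebra F K]
    (χ : MulChar F ℂ) : MulChar K ℂ :=
  MulChar.ofUnitHom (χ.toUnitHom.comp (Units.map (Algebra.norm F (S := K))))

theorem MulChar.normLift_apply {F K : Type*} [Field F] [Field K] [Algebra F K]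
    [FiniteDimensional F K] (χ : MulChar F ℂ) (x : K) :
    χ.normLift K x = χ (Algebra.norm F x) := by
  by_cases hx : x = 0
  · subst hx; simp
  · have := MulChar.ofUnitHom_coe (χ.toUnitHom.comp (Units.map (Algebra.norm F (S := K))))
      (Units.mk0 x hx)
    rw [Units.val_mk0] at this
    rw [MulChar.normLift, this]
    simp

theorem MulChar.orderOf_normLift {F K : Type*} [Field F] [Field K] [Algebra F K] [Finite K]
    (χ : MulChar F ℂ) : orderOf (χ.normLift K) = orderOf χ := by
  have : Finite F := Finite.of_injective _ (algebraMap F K).injective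
  have : FiniteDimensional F K := Module.Finite.of_finite
  rw [orderOf_eq_orderOf_iff]
  intro n
  rcases Nat.eq_zero_or_pos n with rfl | hn
  · simp
  constructor
  · intro h
    refine MulChar.ext fun a => ?_
    obtain ⟨x, hx⟩ := FiniteField.unitsMap_norm_surjective F K a
    have := congrArg (fun ψ : MulChar K ℂ => ψ x) h
    simp only [MulChar.pow_apply_coe, MulChar.normLift_apply, MulChar.one_apply_coe] at this
    rw [MulChar.pow_apply_coe, MulChar.one_apply_coe, ← this, ← hx]
    simp
  · intro h
    refine MulChar.ext fun x => ?_
    have := congrArg (fun ψ : MulChar F ℂ => ψ (Units.map (Algebra.norm F (S := K)) x)) h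
    simp only [MulChar.pow_apply_coe, MulChar.one_apply_coe] at this
    rw [MulChar.pow_apply_coe, MulChar.one_apply_coe, ← this, MulChar.normLift_apply]
    simp

theorem MulChar.exists_norm_sum_galoisField_le {p : ℕ} [Fact p.Prime] (χ : MulChar (ZMod p) ℂ)
    (hχ : χ ≠ 1) (a₁ a₂ a₃ : ZMod p) :
    ∃ C : ℝ, ∃ k₀ : ℕ, ∀ k ≥ k₀, ∀ _ : Fintype (GaloisField p (2 * k)),
      ‖∑ x : GaloisField p (2 * k),
        χ (Algebra.norm (ZMod p) (algebraMap _ _ a₁ - x)) *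
          χ (Algebra.norm (ZMod p) (algebraMap _ _ a₂ - x)) *
          χ⁻¹ (Algebra.norm (ZMod p) (algebraMap _ _ a₃ - x))‖ ≤ C * p ^ k := by
  have hp : p.Prime := Fact.out
  obtain ⟨d, hd⟩ : ∃ d, d = orderOf χ := ⟨_, rfl⟩
  have hd0 : 0 < d := hd ▸ χ.orderOf_pos
  have hd2 : 2 ≤ d := by
    have : d ≠ 1 := fun h => hχ (orderOf_eq_one_iff.1 (hd ▸ h))
    omega
  have hdp : d ∣ p - 1 := by
    rw [hd]; simpa [ZMod.card] using MulChar.orderOf_dvd_card_sub_one (F := ZMod p) χ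
  refine ⟨(2 * d ^ 2 + 1) + (d + 1), d ^ 4 + 3 * d ^ 2 + d + 1, fun k hk inst => ?_⟩
  have hk0 : k ≠ 0 := by omega
  have hcard : Fintype.card (GaloisField p (2 * k)) = (p ^ k) ^ 2 := by
    rw [← Nat.card_eq_fintype_card, GaloisField.card p _ (by omega), ← pow_mul, mul_comm]
  obtain ⟨P', hP'⟩ := hdp.trans (by simpa using Nat.sub_dvd_pow_sub_pow p 1 k)
  have hpk : k < p ^ k := Nat.lt_pow_self hp.one_lt
  have key := MulChar.norm_sum_eval_le (K := GaloisField p (2 * k)) (P := p ^ k) rfl hcard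
    (χ.normLift _) ((MulChar.orderOf_normLift χ).trans hd.symm) (P' := P') (by omega) hd2 (by omega)
    ((C (algebraMap _ _ a₁) - X) * (C (algebraMap _ _ a₂) - X) *
      (C (algebraMap _ _ a₃) - X) ^ (d - 1)) (by
      have h : ∀ a : GaloisField p (2 * k), (C a - X).natDegree = 1 ∧ C a - X ≠ 0 := by
        intro a
        rw [← neg_sub, natDegree_neg, neg_ne_zero]
        exact ⟨natDegree_X_sub_C a, X_sub_C_ne_zero a⟩
      rw [natDegree_mul (mul_ne_zero (h _).2 (h _).2) (pow_ne_zero _ (h _).2),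
        natDegree_mul (h _).2 (h _).2, natDegree_pow, (h _).1, (h _).1, (h _).1]
      omega)
  have hpow : χ ^ (d - 1) = χ⁻¹ := by
    rw [eq_inv_iff_mul_eq_one, ← pow_succ, Nat.sub_add_cancel hd0, hd, pow_orderOf_eq_one]
  have e : ∀ x : GaloisField p (2 * k), χ.normLift _ (eval x ((C (algebraMap _ _ a₁) - X) *
      (C (algebraMap _ _ a₂) - X) * (C (algebraMap _ _ a₃) - X) ^ (d - 1))) =
      χ (Algebra.norm (ZMod p) (algebraMap _ _ a₁ - x)) *
          χ (Algebra.norm (ZMod p) (algebraMap _ _ a₂ - x)) *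
          χ⁻¹ (Algebra.norm (ZMod p) (algebraMap _ _ a₃ - x)) := by
    intro x
    simp only [eval_mul, eval_sub, eval_C, eval_X, eval_pow, map_mul, map_pow,
      MulChar.normLift_apply]
    rw [← hpow, MulChar.pow_apply' χ (by omega)]
  simp_rw [e] at key
  refine key.trans ?_
  have h1 : (1 : ℝ) ≤ (p ^ k : ℕ) := by exact_mod_cast Nat.one_le_pow _ _ hp.pos
  push_cast at h1 ⊢
  nlinarith

end

section MonicPolynomials

open Polynomial Finset

variable {F : Type*} [Field F] [Finite F]

theorem finite_monic_natDegree_eq (F : Type*) [Field F] [Finite F] (n : ℕ) :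
    {g : F[X] | g.Monic ∧ g.natDegree = n}.Finite := by
  refine Set.Finite.of_finite_image (f := fun g : F[X] => fun i : Fin n => g.coeff i)
    (Set.toFinite _) ?_
  rintro g ⟨hg, hgn⟩ h ⟨hh, hhn⟩ e
  ext i
  rcases lt_trichotomy i n with hi | rfl | hi
  · exact congrFun e ⟨i, hi⟩
  · rw [← hgn, hg.coeff_natDegree, hgn, ← hhn, hh.coeff_natDegree]
  · rw [coeff_eq_zero_of_natDegree_lt (by omega), coeff_eq_zero_of_natDegree_lt (by omega)]

/-- The monic polynomials of degree `n` over a finite field. -/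
noncomputable def monicsOfDegree (F : Type*) [Field F] [Finite F] (n : ℕ) : Finset F[X] :=
  (finite_monic_natDegree_eq F n).toFinset

@[simp]
theorem mem_monicsOfDegree {n : ℕ} {g : F[X]} :
    g ∈ monicsOfDegree F n ↔ g.Monic ∧ g.natDegree = n := by
  simp [monicsOfDegree]

open Classical in
/-- The monic irreducible polynomials of degree `n` over a finite field. -/
noncomputable def irreduciblesOfDegree (F : Type*) [Field F] [Finite F] (n : ℕ) : Finset F[X] :=
  (monicsOfDegree F n).filter Irreducible

@[simp]
theorem mem_irreduciblesOfDegree {n : ℕ} {g : F[X]} :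
    g ∈ irreduciblesOfDegree F n ↔ (g.Monic ∧ g.natDegree = n) ∧ Irreducible g := by
  simp [irreduciblesOfDegree]

open Classical in
theorem sum_natDegree_irreducible_pow_dvd {n : ℕ} {g : F[X]} (hg : g ∈ monicsOfDegree F n) :
    ∑ e ∈ Icc 1 n, ∑ P ∈ irreduciblesOfDegree F e, ∑ k ∈ Icc 1 n, (if P ^ k ∣ g then e else 0)
      = n := by
  obtain ⟨hm, hn⟩ := mem_monicsOfDegree.1 hg
  have hg0 := hm.ne_zero
  set nf := UniqueFactorizationMonoid.normalizedFactors g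
  have hprod : nf.prod = g := by
    rw [UniqueFactorizationMonoid.prod_normalizedFactors_eq hg0, hm.normalize_eq_self]
  have hnf : ∀ P ∈ nf, P.Monic ∧ Irreducible P ∧ P ∣ g := fun P hP =>
    ⟨by
      have h1 := UniqueFactorizationMonoid.normalize_normalized_factor P hP
      rw [← h1]
      exact monic_normalize
        (UniqueFactorizationMonoid.irreducible_of_normalized_factor P hP).ne_zero,
     UniqueFactorizationMonoid.irreducible_of_normalized_factor P hP,
     UniqueFactorizationMonoid.dvd_of_mem_normalizedFactors hP⟩
  have hdeg : (nf.map natDegree).sum = n := by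
    rw [← hn, ← hprod, natDegree_multiset_prod]
    intro h0; exact (hnf 0 h0).1.ne_zero rfl
  have hcount : ∀ e ∈ Icc 1 n, ∀ P ∈ irreduciblesOfDegree F e,
      ∑ k ∈ Icc 1 n, (if P ^ k ∣ g then e else 0) = nf.count P • natDegree P := by
    intro e he P hP
    obtain ⟨⟨hPm, hPe⟩, hPi⟩ := mem_irreduciblesOfDegree.1 hP
    have hiff : ∀ k, P ^ k ∣ g ↔ k ≤ nf.count P := by
      intro k
      rw [pow_dvd_iff_le_emultiplicity,
        UniqueFactorizationMonoid.emultiplicity_eq_count_normalizedFactors hPi hg0,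
        hPm.normalize_eq_self, Nat.cast_le]
    have hle : nf.count P ≤ n := by
      have h1 := natDegree_le_of_dvd ((hiff _).2 le_rfl) hg0
      rw [natDegree_pow, hPe, hn] at h1
      nlinarith [(mem_Icc.1 he).1]
    rw [← sum_filter, sum_const, hPe]
    congr 1
    have : (Icc 1 n).filter (fun k => P ^ k ∣ g) = Icc 1 (nf.count P) := by
      ext k
      simp only [mem_filter, mem_Icc, hiff]
      omega
    rw [this, Nat.card_Icc, Nat.add_sub_cancel]
  rw [sum_congr rfl fun e he => sum_congr rfl fun P hP => hcount e he P hP, ← sum_biUnion]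
  · rw [← hdeg, sum_multiset_map_count]
    symm
    refine sum_subset (fun P hP => ?_) fun P _ hP => ?_
    · obtain ⟨h1, h2, h3⟩ := hnf P (Multiset.mem_toFinset.1 hP)
      rw [mem_biUnion]
      refine ⟨P.natDegree, mem_Icc.2 ⟨h2.natDegree_pos, ?_⟩, by simp [h1, h2]⟩
      rw [← sum_multiset_map_count, hdeg, ← hn]
      exact natDegree_le_of_dvd h3 hg0
    · rw [Multiset.mem_toFinset] at hP
      rw [Multiset.count_eq_zero_of_notMem hP, zero_smul]
  · intro i _ j _ hij
    rw [Function.onFun, disjoint_left]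
    intro P hP hP'
    simp only [mem_irreduciblesOfDegree] at hP hP'
    exact hij (hP.1.2.symm.trans hP'.1.2)

open Classical in
theorem sum_monicsOfDegree_pow_dvd (l : F[X] →* ℂ) {n e : ℕ} {P : F[X]}
    (hP : P ∈ irreduciblesOfDegree F e) (k : ℕ) :
    ∑ g ∈ monicsOfDegree F n, (if P ^ k ∣ g then l g else 0) =
      if e * k ≤ n then l P ^ k * ∑ g ∈ monicsOfDegree F (n - e * k), l g else 0 := by
  obtain ⟨⟨hPm, hPe⟩, hPi⟩ := mem_irreduciblesOfDegree.1 hP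
  have hPd : (P ^ k).natDegree = e * k := by rw [natDegree_pow, hPe, mul_comm]
  split_ifs with h
  · rw [← sum_filter, mul_sum]
    symm
    refine sum_bij (fun h _ => P ^ k * h) ?_ ?_ ?_ ?_
    · intro g hg
      rw [mem_monicsOfDegree] at hg
      rw [mem_filter, mem_monicsOfDegree, (hPm.pow k).natDegree_mul hg.1, hPd, hg.2]
      exact ⟨⟨(hPm.pow k).mul hg.1, by omega⟩, dvd_mul_right _ _⟩
    · intro a _ b _ hab
      exact mul_left_cancel₀ (hPm.pow k).ne_zero hab
    · intro g hg
      rw [mem_filter, mem_monicsOfDegree] at hg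
      obtain ⟨⟨hgm, hgn⟩, b, rfl⟩ := hg
      have hb : b.Monic := (hPm.pow k).of_mul_monic_left hgm
      refine ⟨b, mem_monicsOfDegree.2 ⟨hb, ?_⟩, rfl⟩
      rw [(hPm.pow k).natDegree_mul hb, hPd] at hgn
      omega
    · intro g _
      rw [map_mul, map_pow]
  · refine sum_eq_zero fun g hg => if_neg fun hd => h ?_
    rw [mem_monicsOfDegree] at hg
    rw [← hPd, ← hg.2]
    exact natDegree_le_of_dvd hd hg.1.ne_zero

/-- The `j`-th coefficient of the logarithmic derivative of the `L`-series of `l`. -/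
noncomputable def irreduciblePowerSum (l : F[X] →* ℂ) (j : ℕ) : ℂ :=
  ∑ x ∈ j.divisorsAntidiagonal, ∑ P ∈ irreduciblesOfDegree F x.1, x.1 * l P ^ x.2

/-- Newton's identities for the Euler product over monic irreducible polynomials. -/
theorem natCast_mul_sum_monicsOfDegree (l : F[X] →* ℂ) (n : ℕ) :
    n * ∑ g ∈ monicsOfDegree F n, l g =
      ∑ j ∈ Icc 1 n, irreduciblePowerSum l j * ∑ g ∈ monicsOfDegree F (n - j), l g := by
  classical
  calc (n : ℂ) * ∑ g ∈ monicsOfDegree F n, l g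
      = ∑ g ∈ monicsOfDegree F n, ∑ e ∈ Icc 1 n, ∑ k ∈ Icc 1 n,
          ∑ P ∈ irreduciblesOfDegree F e, e * (if P ^ k ∣ g then l g else 0) := by
        rw [mul_sum]
        refine sum_congr rfl fun g hg => ?_
        conv_lhs => rw [← sum_natDegree_irreducible_pow_dvd hg]
        push_cast
        rw [sum_mul]
        refine sum_congr rfl fun e _ => ?_
        rw [sum_mul, sum_comm]
        refine sum_congr rfl fun P _ => ?_
        rw [sum_mul]
        refine sum_congr rfl fun k _ => ?_
        split_ifs <;> simp
    _ = ∑ e ∈ Icc 1 n, ∑ k ∈ Icc 1 n, ∑ P ∈ irreduciblesOfDegree F e,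
          (if e * k ≤ n then
            e * (l P ^ k * ∑ g ∈ monicsOfDegree F (n - e * k), l g) else 0) := by
        rw [sum_comm]
        refine sum_congr rfl fun e _ => ?_
        rw [sum_comm]
        refine sum_congr rfl fun k _ => ?_
        rw [sum_comm]
        refine sum_congr rfl fun P hP => ?_
        rw [← mul_sum, sum_monicsOfDegree_pow_dvd l hP, mul_ite, mul_zero]
    _ = ∑ j ∈ Icc 1 n, ∑ x ∈ Icc 1 n ×ˢ Icc 1 n, if x.1 * x.2 = j then
          ∑ P ∈ irreduciblesOfDegree F x.1,
            x.1 * l P ^ x.2 * ∑ g ∈ monicsOfDegree F (n - j), l g else 0 := by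
        symm
        rw [sum_comm, sum_product]
        refine sum_congr rfl fun e he => sum_congr rfl fun k hk => ?_
        symm
        rw [mem_Icc] at he hk
        rw [sum_ite_eq]
        have : e * k ∈ Icc 1 n ↔ e * k ≤ n := by
          rw [mem_Icc]
          exact ⟨fun h => h.2, fun h => ⟨Nat.mul_pos he.1 hk.1, h⟩⟩
        simp only [this]
        split_ifs
        · exact sum_congr rfl fun P _ => by ring
        · simp
    _ = _ := by
        refine sum_congr rfl fun j hj => ?_
        rw [mem_Icc] at hj
        rw [irreduciblePowerSum, sum_mul, ← sum_filter]
        refine sum_congr ?_ fun x _ => by rw [sum_mul]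
        ext x
        simp only [mem_filter, mem_product, mem_Icc, Nat.mem_divisorsAntidiagonal]
        constructor
        · rintro ⟨-, h⟩; exact ⟨h, by omega⟩
        · rintro ⟨h, h0⟩
          have h1 : 0 < x.1 := Nat.pos_of_ne_zero fun h' => by simp [h'] at h; omega
          have h2 : 0 < x.2 := Nat.pos_of_ne_zero fun h' => by simp [h'] at h; omega
          exact ⟨⟨⟨h1, by nlinarith⟩, ⟨h2, by nlinarith⟩⟩, h⟩

theorem sum_monicsOfDegree_zero (l : F[X] →* ℂ) : ∑ g ∈ monicsOfDegree F 0, l g = 1 := by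
  have : monicsOfDegree F 0 = {1} := by
    ext g
    rw [mem_monicsOfDegree, mem_singleton]
    constructor
    · rintro ⟨h, h0⟩; exact eq_one_of_monic_natDegree_zero h h0
    · rintro rfl; simp
  rw [this, sum_singleton, map_one]

/-- If the `L`-series of `l` is a quadratic polynomial then its logarithmic coefficients are the
power sums of its inverse roots. -/
theorem irreduciblePowerSum_eq_neg (l : F[X] →* ℂ)
    (h3 : ∀ n, 3 ≤ n → ∑ g ∈ monicsOfDegree F n, l g = 0) {w₁ w₂ : ℂ}
    (h1 : ∑ g ∈ monicsOfDegree F 1, l g = -(w₁ + w₂))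
    (h2 : ∑ g ∈ monicsOfDegree F 2, l g = w₁ * w₂) (n : ℕ) (hn : 1 ≤ n) :
    irreduciblePowerSum l n = -(w₁ ^ n + w₂ ^ n) := by
  have N := natCast_mul_sum_monicsOfDegree l
  induction n using Nat.strong_induction_on with
  | _ n ih =>
    obtain rfl | rfl | hn3 : n = 1 ∨ n = 2 ∨ 3 ≤ n := by omega
    · have := N 1
      simp [sum_monicsOfDegree_zero, h1] at this
      rw [← this]; ring
    · have := N 2
      rw [show Icc 1 2 = {1, 2} from rfl, sum_insert (by simp), sum_singleton, h2,
        ih 1 (by omega) le_rfl, Nat.sub_self, sum_monicsOfDegree_zero, h1] at this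
      push_cast at this
      linear_combination -this
    · obtain ⟨k, rfl⟩ : ∃ k, n = k + 3 := ⟨n - 3, by omega⟩
      have := N (k + 3)
      rw [h3 _ hn3, mul_zero, sum_Icc_succ_top (by omega), sum_Icc_succ_top (by omega),
        sum_Icc_succ_top (by omega), sum_eq_zero, Nat.sub_self, sum_monicsOfDegree_zero,
        show k + 3 - (k + 1 + 1) = 1 by omega, show k + 3 - (k + 1) = 2 by omega, h1, h2,
        ih (k + 1) (by omega) (by omega), ih (k + 1 + 1) (by omega) (by omega)] at this
      · linear_combination -this
      · intro j hj
        rw [mem_Icc] at hj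
        rw [h3 _ (by omega), mul_zero]

end MonicPolynomials

section

open Polynomial Finset

theorem norm_algebraMap_sub_eq_eval_minpoly_pow {F K : Type*} [Field F] [Field K] [Algebra F K]
    [FiniteDimensional F K] (a : F) (x : K) :
    Algebra.norm F (algebraMap F K a - x) =
      (minpoly F x).eval a ^ (Module.finrank F K / (minpoly F x).natDegree) := by
  open IntermediateField in
  set y := x - algebraMap F K a with hy
  have hyi : IsIntegral F y := Algebra.IsIntegral.isIntegral y
  have hm : minpoly F y = (minpoly F x).comp (X + C a) := minpoly.sub_algebraMap x a
  have hdeg : (minpoly F y).natDegree = (minpoly F x).natDegree := by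
    rw [hm, natDegree_comp, natDegree_X_add_C, mul_one]
  have hc : (minpoly F y).coeff 0 = (minpoly F x).eval a := by
    rw [coeff_zero_eq_eval_zero, hm, eval_comp]; simp
  have hfin : Module.finrank F F⟮y⟯ * Module.finrank F⟮y⟯ K = Module.finrank F K :=
    Module.finrank_mul_finrank F F⟮y⟯ K
  have hadj : Module.finrank F F⟮y⟯ = (minpoly F x).natDegree := by
    rw [adjoin.finrank hyi, hdeg]
  have hpos : 0 < (minpoly F x).natDegree := minpoly.natDegree_pos (Algebra.IsIntegral.isIntegral x)
  have hquot : Module.finrank F K / (minpoly F x).natDegree = Module.finrank F⟮y⟯ K := by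
    rw [← hfin, hadj, Nat.mul_div_cancel_left _ hpos]
  have hgen : Algebra.norm F (AdjoinSimple.gen F y)
      = (-1) ^ (minpoly F x).natDegree * (minpoly F x).eval a := by
    have := Algebra.PowerBasis.norm_gen_eq_coeff_zero_minpoly (adjoin.powerBasis hyi)
    rw [adjoin.powerBasis_gen, adjoin.powerBasis_dim, hdeg] at this
    rw [this, minpoly_gen, hc]
  have hneg : algebraMap F K a - x = algebraMap F K (-1) * y := by simp [hy]
  rw [hneg, map_mul, Algebra.norm_algebraMap, Algebra.norm_eq_norm_adjoin, hgen, hquot, mul_pow,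
    ← pow_mul, ← hadj, hfin, ← mul_assoc, ← mul_pow]
  simp

theorem card_filter_minpoly_eq {F K : Type*} [Field F] [Finite F] [Field K] [Algebra F K]
    [Fintype K] [DecidableEq F[X]] {P : F[X]} (hPm : P.Monic) (hP : Irreducible P)
    (hdvd : P.natDegree ∣ Module.finrank F K) :
    #{x : K | minpoly F x = P} = P.natDegree := by
  classical
  have := Fintype.ofFinite F
  have hsplit : (P.map (algebraMap F K)).Splits := by
    rw [hP.natDegree_dvd_iff_dvd_X_pow_card_pow_sub_X, ← Module.natCard_eq_pow_finrank,
      Nat.card_eq_fintype_card] at hdvd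
    refine Splits.of_dvd (FiniteField.isSplittingField_sub K F).splits ?_
      (map_dvd (mapRingHom (algebraMap F K)) hdvd)
    exact (Polynomial.map_ne_zero_iff (algebraMap F K).injective).2
      (FiniteField.X_pow_card_sub_X_ne_zero F Fintype.one_lt_card)
  rw [← card_rootSet_eq_natDegree (PerfectField.separable_of_irreducible hP) hsplit,
    ← Set.toFinset_card]
  congr 1
  ext x
  rw [mem_filter, Set.mem_toFinset, mem_rootSet]
  constructor
  · rintro ⟨-, rfl⟩
    exact ⟨hPm.ne_zero, minpoly.aeval F x⟩
  · rintro ⟨-, h⟩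
    exact ⟨mem_univ _, (minpoly.eq_of_irreducible_of_monic hP h hPm).symm⟩

theorem irreduciblePowerSum_eq_sum_minpoly {F K : Type*} [Field F] [Finite F] [Field K]
    [Algebra F K] [Fintype K] (l : F[X] →* ℂ) :
    irreduciblePowerSum l (Module.finrank F K) =
      ∑ x : K, l (minpoly F x) ^ (Module.finrank F K / (minpoly F x).natDegree) := by
  classical
  have : FiniteDimensional F K := Module.Finite.of_finite
  set n := Module.finrank F K with hn
  have hn0 : n ≠ 0 := Module.finrank_pos.ne'
  have hxi : ∀ x : K, IsIntegral F x := fun x => Algebra.IsIntegral.isIntegral x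
  have hmaps : ∀ x ∈ (univ : Finset K), minpoly F x ∈
      n.divisorsAntidiagonal.biUnion fun y => irreduciblesOfDegree F y.1 := by
    intro x _
    rw [mem_biUnion]
    refine ⟨((minpoly F x).natDegree, n / (minpoly F x).natDegree), ?_, ?_⟩
    · rw [Nat.mem_divisorsAntidiagonal]
      exact ⟨Nat.mul_div_cancel' (minpoly.degree_dvd (hxi x)), hn0⟩
    · rw [mem_irreduciblesOfDegree]
      exact ⟨⟨minpoly.monic (hxi x), rfl⟩, minpoly.irreducible (hxi x)⟩
  rw [← sum_fiberwise_of_maps_to hmaps, irreduciblePowerSum, sum_biUnion]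
  · refine sum_congr rfl fun y hy => sum_congr rfl fun P hP => ?_
    rw [Nat.mem_divisorsAntidiagonal] at hy
    obtain ⟨⟨hPm, hPe⟩, hPi⟩ := mem_irreduciblesOfDegree.1 hP
    rw [sum_congr rfl (g := fun _ => l P ^ y.2), sum_const, nsmul_eq_mul,
      card_filter_minpoly_eq hPm hPi (by rw [hPe, ← hn, ← hy.1]; exact dvd_mul_right _ _), hPe]
    intro x hx
    rw [(mem_filter.1 hx).2, hPe, ← hy.1, Nat.mul_div_cancel_left]
    exact Nat.pos_of_ne_zero fun h => hn0 (by rw [← hy.1, h, zero_mul])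
  · intro a ha b hb hab
    rw [Function.onFun, disjoint_left]
    intro P hP hP'
    simp only [mem_irreduciblesOfDegree] at hP hP'
    have e : a.1 = b.1 := hP.1.2.symm.trans hP'.1.2
    rw [mem_coe, Nat.mem_divisorsAntidiagonal] at ha hb
    refine hab (Prod.ext e ?_)
    have h1 := ha.1.trans hb.1.symm
    rw [e] at h1
    refine Nat.eq_of_mul_eq_mul_left (Nat.pos_of_ne_zero fun h => hn0 ?_) h1
    rw [← hb.1, h, zero_mul]

/-- The completely multiplicative function `g ↦ χ(g(a₁) g(a₂)) χ⁻¹(g(a₃))`. -/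
noncomputable def evalChar {F : Type*} [Field F] (χ : MulChar F ℂ) (a₁ a₂ a₃ : F) :
    F[X] →* ℂ where
  toFun g := χ (g.eval a₁) * χ (g.eval a₂) * χ⁻¹ (g.eval a₃)
  map_one' := by simp
  map_mul' f g := by simp only [eval_mul, map_mul]; ring

theorem evalChar_apply {F : Type*} [Field F] (χ : MulChar F ℂ) (a₁ a₂ a₃ : F) (g : F[X]) :
    evalChar χ a₁ a₂ a₃ g = χ (g.eval a₁) * χ (g.eval a₂) * χ⁻¹ (g.eval a₃) := rfl

theorem sum_monicsOfDegree_evalChar_eq_zero {F : Type*} [Field F] [Finite F] {χ : MulChar F ℂ}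
    (hχ : χ ≠ 1) {a₁ a₂ a₃ : F} (h₁ : a₃ ≠ a₁) (h₂ : a₃ ≠ a₂) {n : ℕ} (hn : 3 ≤ n) :
    ∑ g ∈ monicsOfDegree F n, evalChar χ a₁ a₂ a₃ g = 0 := by
  classical
  have := Fintype.ofFinite F
  set h : F[X] := (X - C a₁) * (X - C a₂) with hh
  have hhd : h.degree < n := by
    have : h.natDegree = 2 := by
      rw [hh, natDegree_mul (X_sub_C_ne_zero _) (X_sub_C_ne_zero _), natDegree_X_sub_C,
        natDegree_X_sub_C]
    refine degree_le_natDegree.trans_lt ?_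
    rw [this]
    exact_mod_cast hn
  set κ := (a₃ - a₁) * (a₃ - a₂) with hκ
  have hκ0 : κ ≠ 0 := mul_ne_zero (sub_ne_zero.2 h₁) (sub_ne_zero.2 h₂)
  have hmem : ∀ (c : F) (g : F[X]), g ∈ monicsOfDegree F n → g + C c * h ∈ monicsOfDegree F n := by
    intro c g hg
    rw [mem_monicsOfDegree] at hg ⊢
    have hlt : (C c * h).degree < g.degree := by
      rw [degree_eq_natDegree hg.1.ne_zero, hg.2]
      refine lt_of_le_of_lt ?_ hhd
      rw [degree_mul]
      calc (C c).degree + h.degree ≤ 0 + h.degree := by gcongr; exact degree_C_le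
        _ = _ := zero_add _
    refine ⟨hg.1.add_of_left hlt, ?_⟩
    rw [natDegree_add_eq_left_of_degree_lt hlt, hg.2]
  have htrans : ∀ c : F, ∑ g ∈ monicsOfDegree F n, evalChar χ a₁ a₂ a₃ (g + C c * h) =
      ∑ g ∈ monicsOfDegree F n, evalChar χ a₁ a₂ a₃ g := by
    intro c
    refine sum_nbij' (fun g => g + C c * h) (fun g => g + C (-c) * h) (hmem c) (hmem (-c))
      ?_ ?_ fun _ _ => rfl
    · intro g _; simp
    · intro g _; simp
  have hq : (Fintype.card F : ℂ) ≠ 0 := Nat.cast_ne_zero.2 Fintype.card_ne_zero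
  refine (mul_eq_zero_iff_left hq).1 ?_
  rw [← nsmul_eq_mul, ← card_univ, ← sum_const, sum_congr rfl fun c _ => (htrans c).symm,
    sum_comm]
  refine sum_eq_zero fun g _ => ?_
  have hev : ∀ c : F, evalChar χ a₁ a₂ a₃ (g + C c * h) =
      χ (g.eval a₁) * χ (g.eval a₂) * χ⁻¹ (g.eval a₃ + c * κ) := by
    intro c
    simp [evalChar_apply, hh, hκ]
  simp_rw [hev]
  rw [← mul_sum]
  have : ∑ c : F, χ⁻¹ (g.eval a₃ + c * κ) = ∑ c : F, χ⁻¹ c := by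
    refine Fintype.sum_equiv ((Equiv.mulRight₀ κ hκ0).trans (Equiv.addLeft (g.eval a₃))) _ _ ?_
    intro c; simp
  rw [this, MulChar.sum_eq_zero_of_ne_one (inv_ne_one.2 hχ), mul_zero]

theorem norm_le_one_of_norm_pow_add_pow_le {α β : ℂ} {C : ℝ} {k₀ : ℕ}
    (h : ∀ k ≥ k₀, ‖α ^ k + β ^ k‖ ≤ C) : ‖α‖ ≤ 1 := by
  have hC : 0 ≤ C := (norm_nonneg _).trans (h k₀ le_rfl)
  by_contra! hα
  by_cases hβ : 1 < ‖β‖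
  · have hb : ∀ k ≥ k₀, ‖α‖ ^ k ≤ (C ^ 2 + C) / 2 := by
      intro k hk
      have e : 2 * (α * β) ^ k = (α ^ k + β ^ k) ^ 2 - (α ^ (2 * k) + β ^ (2 * k)) := by ring
      have h1 : 2 * ‖(α * β) ^ k‖ ≤ C ^ 2 + C := by
        rw [show 2 * ‖(α * β) ^ k‖ = ‖2 * (α * β) ^ k‖ by simp, e]
        refine (norm_sub_le _ _).trans (add_le_add ?_ (h _ (by omega)))
        rw [norm_pow]
        exact pow_le_pow_left₀ (norm_nonneg _) (h k hk) 2
      rw [norm_pow, norm_mul, mul_pow] at h1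
      have h2 : 1 ≤ ‖β‖ ^ k := one_le_pow₀ hβ.le
      have h3 : 0 ≤ ‖α‖ ^ k := by positivity
      nlinarith
    obtain ⟨k, hk, hk'⟩ := ((tendsto_pow_atTop_atTop_of_one_lt hα).eventually_gt_atTop
      ((C ^ 2 + C) / 2)).and (Filter.eventually_ge_atTop k₀) |>.exists
    exact absurd (hb k hk') (not_le.2 hk)
  · push Not at hβ
    obtain ⟨k, hk, hk'⟩ := ((tendsto_pow_atTop_atTop_of_one_lt hα).eventually_gt_atTop
      (C + 1)).and (Filter.eventually_ge_atTop k₀) |>.exists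
    have h1 := h k hk'
    have h2 : ‖β ^ k‖ ≤ 1 := by rw [norm_pow]; exact pow_le_one₀ (norm_nonneg _) hβ
    have h3 : ‖α ^ k‖ ≤ ‖α ^ k + β ^ k‖ + ‖β ^ k‖ := by
      simpa using norm_sub_le (α ^ k + β ^ k) (β ^ k)
    rw [norm_pow] at h3
    linarith

/-- Weil's bound for `∑ χ((t + e₁)(t + e₂)) χ⁻¹(t + e₃)`. -/
theorem weil_bound {p : ℕ} [Fact p.Prime] {χ : MulChar (ZMod p) ℂ} (hχ : χ ≠ 1)
    {a₁ a₂ a₃ : ZMod p} (h₁ : a₃ ≠ a₁) (h₂ : a₃ ≠ a₂) :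
    ‖∑ t, χ (t + a₁) * χ (t + a₂) * χ⁻¹ (t + a₃)‖ ≤ 2 * Real.sqrt p := by
  have hp : p.Prime := Fact.out
  set l := evalChar χ a₁ a₂ a₃ with hl
  have hc1 : ∑ g ∈ monicsOfDegree (ZMod p) 1, l g =
      ∑ t, χ (t + a₁) * χ (t + a₂) * χ⁻¹ (t + a₃) := by
    symm
    refine sum_bij (fun t _ => X + C t) ?_ ?_ ?_ ?_
    · intro t _; rw [mem_monicsOfDegree]; exact ⟨monic_X_add_C t, natDegree_X_add_C t⟩
    · intro a _ b _ hab; exact C_injective (add_left_cancel hab)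
    · intro g hg
      rw [mem_monicsOfDegree] at hg
      refine ⟨g.coeff 0, mem_univ _, ?_⟩
      have := g.as_sum_range_C_mul_X_pow
      have hlead : g.coeff 1 = 1 := by
        have := hg.1.coeff_natDegree
        rwa [hg.2] at this
      rw [hg.2, sum_range_succ, sum_range_one, hlead] at this
      rw [this]; simp [add_comm]
    · intro t _; simp [hl, evalChar_apply, add_comm]
  rw [← hc1]
  set c₁ := ∑ g ∈ monicsOfDegree (ZMod p) 1, l g
  set c₂ := ∑ g ∈ monicsOfDegree (ZMod p) 2, l g with hc2
  obtain ⟨s, hs⟩ := IsAlgClosed.exists_pow_nat_eq (c₁ ^ 2 - 4 * c₂) (n := 2) (by norm_num)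
  obtain ⟨w₁, w₂, e1, e2⟩ : ∃ w₁ w₂ : ℂ, c₁ = -(w₁ + w₂) ∧ c₂ = w₁ * w₂ :=
    ⟨(-c₁ + s) / 2, (-c₁ - s) / 2, by ring, by linear_combination (1 / 4) * hs⟩
  have key := irreduciblePowerSum_eq_neg l
    (fun n hn => sum_monicsOfDegree_evalChar_eq_zero hχ h₁ h₂ hn) e1 e2
  obtain ⟨C, k₀, hC⟩ := MulChar.exists_norm_sum_galoisField_le χ hχ a₁ a₂ a₃
  have hp0 : (0 : ℝ) < p := by exact_mod_cast hp.pos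
  have hpc : (p : ℂ) ≠ 0 := by exact_mod_cast hp.ne_zero
  have hbound : ∀ k ≥ k₀ + 1, ‖(w₁ ^ 2 / p) ^ k + (w₂ ^ 2 / p) ^ k‖ ≤ C := by
    intro k hk
    have inst : Fintype (GaloisField p (2 * k)) := Fintype.ofFinite _
    have hfr : Module.finrank (ZMod p) (GaloisField p (2 * k)) = 2 * k :=
      GaloisField.finrank p (by omega)
    have h := hC k (by omega) inst
    have e := irreduciblePowerSum_eq_sum_minpoly (K := GaloisField p (2 * k)) l
    rw [hfr, key _ (by omega)] at e
    have e' : -(w₁ ^ (2 * k) + w₂ ^ (2 * k)) = ∑ x : GaloisField p (2 * k),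
        χ (Algebra.norm (ZMod p) (algebraMap _ _ a₁ - x)) *
          χ (Algebra.norm (ZMod p) (algebraMap _ _ a₂ - x)) *
          χ⁻¹ (Algebra.norm (ZMod p) (algebraMap _ _ a₃ - x)) := by
      rw [e]
      refine sum_congr rfl fun x _ => ?_
      simp only [norm_algebraMap_sub_eq_eval_minpoly_pow, hfr, hl, evalChar_apply, map_pow,
        mul_pow]
    rw [← e', norm_neg] at h
    have e3 : (w₁ ^ 2 / p) ^ k + (w₂ ^ 2 / p) ^ k =
        (w₁ ^ (2 * k) + w₂ ^ (2 * k)) / (p : ℂ) ^ k := by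
      rw [div_pow, div_pow, ← pow_mul, ← pow_mul]; ring
    rw [e3, norm_div, norm_pow, Complex.norm_natCast, div_le_iff₀ (by positivity)]
    exact h
  have hw : ∀ w : ℂ, ‖w ^ 2 / p‖ ≤ 1 → ‖w‖ ≤ Real.sqrt p := by
    intro w hw
    rw [norm_div, norm_pow, Complex.norm_natCast, div_le_one hp0] at hw
    exact Real.le_sqrt_of_sq_le hw
  have b1 := hw w₁ (norm_le_one_of_norm_pow_add_pow_le hbound)
  have b2 := hw w₂ (norm_le_one_of_norm_pow_add_pow_le fun k hk => by
    rw [add_comm]; exact hbound k hk)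
  rw [e1, norm_neg]
  linarith [norm_add_le w₁ w₂]

end

section

open Finset

variable {R : Type*} [CommRing R]

theorem MulChar.inv_apply_eq_of_mul_eq_one (χ : MulChar R ℂ) {a b : R} (h : a * b = 1) :
    χ⁻¹ a = χ b := by
  rw [MulChar.inv_apply, Ring.inverse_of_isUnit (IsUnit.of_mul_eq_one b h)]
  congr 1
  have : IsUnit a := IsUnit.of_mul_eq_one b h
  rw [Units.inv_eq_of_mul_eq_one_right (a := b)]
  simpa using h

/-- The value of `χ` at `y₁ y₂ / (y₃ y₄)`. -/
noncomputable def quadChar (χ : MulChar R ℂ) (y₁ y₂ y₃ y₄ : R) : ℂ :=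
  χ y₁ * χ y₂ * χ⁻¹ y₃ * χ⁻¹ y₄

theorem norm_quadChar_le [Finite R] (χ : MulChar R ℂ) (y₁ y₂ y₃ y₄ : R) :
    ‖quadChar χ y₁ y₂ y₃ y₄‖ ≤ 1 := by
  have h : ∀ (χ : MulChar R ℂ) y, ‖χ y‖ ≤ 1 := fun χ y => by
    by_cases hy : IsUnit y
    · obtain ⟨u, rfl⟩ := hy
      have := Fintype.ofFinite R
      have h1 : χ u ^ Monoid.exponent Rˣ = 1 := by
        rw [← map_pow, ← Units.val_pow_eq_pow_val, Monoid.pow_exponent_eq_one]; simp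
      exact (Complex.norm_eq_one_of_pow_eq_one h1 Monoid.exponent_ne_zero_of_finite).le
    · simp [χ.map_nonunit hy]
  simp only [quadChar, norm_mul]
  have := h χ y₁; have := h χ y₂; have := h χ⁻¹ y₃; have := h χ⁻¹ y₄
  refine mul_le_one₀ (mul_le_one₀ (mul_le_one₀ ?_ ?_ ?_) ?_ ?_) ?_ ?_ <;>
    first | assumption | exact norm_nonneg _

theorem quadChar_eq_zero (χ : MulChar R ℂ) {y₁ y₂ y₃ y₄ : R}
    (h : ¬ (IsUnit y₁ ∧ IsUnit y₂ ∧ IsUnit y₃ ∧ IsUnit y₄)) : quadChar χ y₁ y₂ y₃ y₄ = 0 := by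
  by_contra h0
  apply h
  refine ⟨?_, ?_, ?_, ?_⟩ <;>
  · by_contra hu
    exact h0 (by simp [quadChar, MulChar.map_nonunit _ hu])

theorem quadChar_add (χ : MulChar R ℂ) {y₁ y₂ y₃ y₄ c₁ c₂ c₃ c₄ z : R}
    (h₁ : y₁ * c₁ = 1) (h₂ : y₂ * c₂ = 1) (h₃ : y₃ * c₃ = 1) (h₄ : y₄ * c₄ = 1) (hz : z ^ 3 = 0) :
    quadChar χ (y₁ + z) (y₂ + z) (y₃ + z) (y₄ + z) = quadChar χ y₁ y₂ y₃ y₄ *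
      χ (1 + (c₁ + c₂ - c₃ - c₄) * z +
        (c₁ * c₂ + c₃ ^ 2 + c₄ ^ 2 + c₃ * c₄ - (c₁ + c₂) * (c₃ + c₄)) * z ^ 2) := by
  have e : ∀ y c : R, y * c = 1 → (y + z) * (c * (1 - c * z + c ^ 2 * z ^ 2)) = 1 := by
    intro y c h
    linear_combination (1 - c * z + c ^ 2 * z ^ 2) * h + c ^ 3 * hz
  simp only [quadChar]
  rw [χ.inv_apply_eq_of_mul_eq_one (e _ _ h₃), χ.inv_apply_eq_of_mul_eq_one (e _ _ h₄),
    χ.inv_apply_eq_of_mul_eq_one h₃, χ.inv_apply_eq_of_mul_eq_one h₄]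
  simp only [← map_mul]
  congr 1
  have e₁ : y₁ + z = y₁ * (1 + c₁ * z) := by linear_combination -z * h₁
  have e₂ : y₂ + z = y₂ * (1 + c₂ * z) := by linear_combination -z * h₂
  rw [e₁, e₂]
  have key : ∃ w, (1 + c₁ * z) * (1 + c₂ * z) * (1 - c₃ * z + c₃ ^ 2 * z ^ 2) *
      (1 - c₄ * z + c₄ ^ 2 * z ^ 2) = (1 + (c₁ + c₂ - c₃ - c₄) * z +
        (c₁ * c₂ + c₃ ^ 2 + c₄ ^ 2 + c₃ * c₄ - (c₁ + c₂) * (c₃ + c₄)) * z ^ 2) + w * z ^ 3 := by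
    refine ⟨c₁ * c₂ * (-c₃ - c₄) + (c₁ + c₂) * (c₃ ^ 2 + c₄ ^ 2 + c₃ * c₄)
      - c₃ * c₄ ^ 2 - c₃ ^ 2 * c₄ + z * (c₁ * c₂ * (c₃ ^ 2 + c₄ ^ 2 + c₃ * c₄)
      + (c₁ + c₂) * (- c₃ * c₄ ^ 2 - c₃ ^ 2 * c₄) + c₃ ^ 2 * c₄ ^ 2)
      + z ^ 2 * (c₁ * c₂ * (- c₃ * c₄ ^ 2 - c₃ ^ 2 * c₄) + (c₁ + c₂) * c₃ ^ 2 * c₄ ^ 2)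
      + z ^ 3 * (c₁ * c₂ * c₃ ^ 2 * c₄ ^ 2), by ring⟩
  obtain ⟨w, hw⟩ := key
  linear_combination y₁ * y₂ * c₃ * c₄ * hw + y₁ * y₂ * c₃ * c₄ * w * hz

/-- The additive character `s ↦ χ (1 + π s)` for an element `π` of square zero. -/
noncomputable def MulChar.onePlus (χ : MulChar R ℂ) {π : R} (hπ : π * π = 0) : AddChar R ℂ where
  toFun s := χ (1 + π * s)
  map_zero_eq_one' := by simp
  map_add_eq_mul' s t := by
    rw [← map_mul]; congr 1; linear_combination (-s * t) * hπ

theorem MulChar.onePlus_apply (χ : MulChar R ℂ) {π : R} (hπ : π * π = 0) (s : R) :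
    χ.onePlus hπ s = χ (1 + π * s) := rfl

theorem isUnit_add_iff_of_mul_self_eq_zero {y z : R} (hz : z * z = 0) :
    IsUnit (y + z) ↔ IsUnit y := by
  have key : ∀ y z : R, z * z = 0 → IsUnit y → IsUnit (y + z) := by
    rintro y z hz ⟨u, rfl⟩
    refine IsUnit.of_mul_eq_one ((↑u⁻¹ : R) * (1 - ↑u⁻¹ * z)) ?_
    have := u.mul_inv
    linear_combination (1 - ↑u⁻¹ * z) * this - (↑u⁻¹ : R) ^ 2 * hz
  refine ⟨fun h => ?_, key y z hz⟩
  have := key (y + z) (-z) (by linear_combination hz) h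
  simpa using this

/-- The complete sum of `χ ((x + b₁) (x + b₂) / ((x + b₃) (x + b₄)))`. -/
noncomputable def quadSum [Fintype R] (χ : MulChar R ℂ) (b₁ b₂ b₃ b₄ : R) : ℂ :=
  ∑ x, quadChar χ (x + b₁) (x + b₂) (x + b₃) (x + b₄)

theorem norm_quadSum_le_card [Fintype R] (χ : MulChar R ℂ) (b₁ b₂ b₃ b₄ : R) :
    ‖quadSum χ b₁ b₂ b₃ b₄‖ ≤ Fintype.card R := by
  refine (norm_sum_le _ _).trans ?_
  calc _ ≤ ∑ _x : R, (1 : ℝ) := sum_le_sum fun x _ => norm_quadChar_le _ _ _ _ _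
    _ = _ := by simp

open Classical in
theorem quadSum_eq_sum_filter [Fintype R] (χ : MulChar R ℂ) (b₁ b₂ b₃ b₄ : R) {π : R}
    (hπ : π * π = 0) (X : Finset R)
    (hX : ∀ x c₁ c₂ c₃ c₄ : R, (x + b₁) * c₁ = 1 → (x + b₂) * c₂ = 1 → (x + b₃) * c₃ = 1 →
      (x + b₄) * c₄ = 1 → (x ∈ X ↔ ∀ s, χ (1 + π * ((c₁ + c₂ - c₃ - c₄) * s)) = 1)) :
    quadSum χ b₁ b₂ b₃ b₄ =
      ∑ x ∈ X, quadChar χ (x + b₁) (x + b₂) (x + b₃) (x + b₄) := by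
  have h1 : ∀ s : R, quadSum χ b₁ b₂ b₃ b₄ = ∑ x, quadChar χ (x + π * s + b₁)
      (x + π * s + b₂) (x + π * s + b₃) (x + π * s + b₄) := fun s =>
    (Equiv.sum_comp (Equiv.addRight (π * s)) (fun x => quadChar χ (x + b₁) (x + b₂) (x + b₃)
      (x + b₄))).symm
  have hcard : (Fintype.card R : ℂ) ≠ 0 := by exact_mod_cast Fintype.card_ne_zero
  have h2 : ∀ x, ∑ s, quadChar χ (x + π * s + b₁)
      (x + π * s + b₂) (x + π * s + b₃) (x + π * s + b₄) =
      if x ∈ X then Fintype.card R * quadChar χ (x + b₁) (x + b₂) (x + b₃) (x + b₄) else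
        0 := by
    intro x
    by_cases hu : IsUnit (x + b₁) ∧ IsUnit (x + b₂) ∧ IsUnit (x + b₃) ∧ IsUnit (x + b₄)
    · obtain ⟨c₁, h₁⟩ := hu.1.exists_right_inv
      obtain ⟨c₂, h₂⟩ := hu.2.1.exists_right_inv
      obtain ⟨c₃, h₃⟩ := hu.2.2.1.exists_right_inv
      obtain ⟨c₄, h₄⟩ := hu.2.2.2.exists_right_inv
      have h3 : ∀ s, quadChar χ (x + π * s + b₁) (x + π * s + b₂) (x + π * s + b₃)
          (x + π * s + b₄) = quadChar χ (x + b₁) (x + b₂) (x + b₃) (x + b₄) *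
          (χ.onePlus hπ).mulShift (c₁ + c₂ - c₃ - c₄) s := by
        intro s
        simp only [add_right_comm x (π * s)]
        rw [quadChar_add χ h₁ h₂ h₃ h₄ (by linear_combination (π * s ^ 3) * hπ),
          AddChar.mulShift_apply, MulChar.onePlus_apply]
        congr 2
        linear_combination (c₁ * c₂ + c₃ ^ 2 + c₄ ^ 2 + c₃ * c₄ - (c₁ + c₂) * (c₃ + c₄)) *
          s ^ 2 * hπ
      simp only [h3, ← mul_sum, AddChar.sum_eq_ite]
      have h4 : (χ.onePlus hπ).mulShift (c₁ + c₂ - c₃ - c₄) = 0 ↔ x ∈ X := by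
        rw [hX x c₁ c₂ c₃ c₄ h₁ h₂ h₃ h₄, AddChar.eq_zero_iff]
        rfl
      simp only [h4]
      split_ifs <;> simp [mul_comm]
    · rw [quadChar_eq_zero χ hu]
      simp only [mul_zero, ite_self]
      refine sum_eq_zero fun s _ => quadChar_eq_zero χ fun hu' => hu ?_
      have hs : (π * s) * (π * s) = 0 := by linear_combination s ^ 2 * hπ
      simp only [add_right_comm x (π * s)] at hu'
      simpa only [isUnit_add_iff_of_mul_self_eq_zero hs] using hu'
  have h3 : (Fintype.card R : ℂ) * quadSum χ b₁ b₂ b₃ b₄ = Fintype.card R *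
      ∑ x ∈ X, quadChar χ (x + b₁) (x + b₂) (x + b₃) (x + b₄) := by
    calc _ = ∑ _s : R, quadSum χ b₁ b₂ b₃ b₄ := by simp
      _ = ∑ s, ∑ x, quadChar χ (x + π * s + b₁)
          (x + π * s + b₂) (x + π * s + b₃) (x + π * s + b₄) := sum_congr rfl fun s _ => h1 s
      _ = _ := by
        rw [sum_comm, mul_sum]
        simp only [h2]
        rw [sum_ite_mem, univ_inter]
  exact mul_left_cancel₀ hcard h3

theorem card_mul_sum_quadChar_eq [Fintype R] (χ : MulChar R ℂ) (b₁ b₂ b₃ b₄ : R) {ρ : R}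
    (X : Finset R) (hX : ∀ x s, x + ρ * s ∈ X ↔ x ∈ X) :
    Fintype.card R * ∑ x ∈ X, quadChar χ (x + b₁) (x + b₂) (x + b₃) (x + b₄) =
      ∑ x ∈ X, ∑ s, quadChar χ (x + b₁ + ρ * s) (x + b₂ + ρ * s) (x + b₃ + ρ * s)
        (x + b₄ + ρ * s) := by
  classical
  rw [sum_comm]
  have : ∀ s, ∑ x ∈ X, quadChar χ (x + b₁ + ρ * s) (x + b₂ + ρ * s) (x + b₃ + ρ * s)
      (x + b₄ + ρ * s) = ∑ x ∈ X, quadChar χ (x + b₁) (x + b₂) (x + b₃) (x + b₄) := by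
    intro s
    simp only [← add_right_comm _ (ρ * s)]
    refine sum_bij (fun x _ => x + ρ * s) (fun x hx => (hX x s).2 hx)
      (fun x _ y _ h => add_right_cancel h) (fun y hy => ⟨y - ρ * s, ?_, by ring⟩) fun x _ => rfl
    rw [← hX _ s]; simpa using hy
  simp only [this]
  simp

theorem AddChar.norm_sum_quadratic_sq_le [Fintype R] (ψ : AddChar R ℂ) (a b : R) :
    ‖∑ y, ψ (b * y + a * y ^ 2)‖ ^ 2 ≤
      Fintype.card R * #{h : R | ∀ y, ψ (2 * a * h * y) = 1} := by
  classical
  have h1 : (∑ y, ψ (b * y + a * y ^ 2)) * (starRingEnd ℂ) (∑ y, ψ (b * y + a * y ^ 2)) =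
      ∑ h, ψ (b * h + a * h ^ 2) * ∑ y, (ψ.mulShift (2 * a * h)) y := by
    rw [map_sum, sum_mul_sum, sum_comm]
    have : ∀ y, ∑ x, ψ (b * x + a * x ^ 2) * (starRingEnd ℂ) (ψ (b * y + a * y ^ 2)) =
        ∑ h, ψ (b * h + a * h ^ 2) * ψ (2 * a * h * y) := by
      intro y
      rw [← Equiv.sum_comp (Equiv.addRight y)]
      refine sum_congr rfl fun h _ => ?_
      rw [← AddChar.map_neg_eq_conj, ← AddChar.map_add_eq_mul, ← AddChar.map_add_eq_mul]
      congr 1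
      simp only [Equiv.coe_addRight]
      ring
    simp only [this]
    rw [sum_comm]
    simp only [AddChar.mulShift_apply, mul_sum]
  have h2 : ((‖∑ y, ψ (b * y + a * y ^ 2)‖ ^ 2 : ℝ) : ℂ) =
      ∑ h, ψ (b * h + a * h ^ 2) * ∑ y, (ψ.mulShift (2 * a * h)) y := by
    rw [← h1, Complex.mul_conj, Complex.normSq_eq_norm_sq]
  have h3 : ‖∑ y, ψ (b * y + a * y ^ 2)‖ ^ 2 =
      ‖∑ h, ψ (b * h + a * h ^ 2) * ∑ y, (ψ.mulShift (2 * a * h)) y‖ := by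
    rw [← h2, Complex.norm_real, Real.norm_of_nonneg (by positivity)]
  rw [h3]
  refine (norm_sum_le _ _).trans ?_
  calc _ ≤ ∑ h : R, if ∀ y, ψ (2 * a * h * y) = 1 then (Fintype.card R : ℝ) else 0 := by
        refine sum_le_sum fun h _ => ?_
        rw [norm_mul, AddChar.norm_apply, one_mul, AddChar.sum_eq_ite]
        have : ψ.mulShift (2 * a * h) = 0 ↔ ∀ y, ψ (2 * a * h * y) = 1 := by
          rw [AddChar.eq_zero_iff]; rfl
        simp only [this]
        split_ifs <;> simp
    _ = _ := by
        rw [← sum_filter, sum_const, nsmul_eq_mul, mul_comm]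

end

section

open Finset

theorem Finset.card_le_of_modEq {p e k : ℕ} (hp : 0 < p) (he : e ≤ k) {X : Finset ℕ}
    (hX : X ⊆ range (p ^ k)) (h : ∀ x ∈ X, ∀ y ∈ X, (p : ℤ) ^ e ∣ (x : ℤ) - y) :
    #X ≤ p ^ (k - e) := by
  have : #X ≤ #(range (p ^ (k - e))) := by
    refine card_le_card_of_injOn (fun x => x / p ^ e) (fun x hx => ?_) fun x hx y hy hxy => ?_
    · have h1 := mem_range.1 (hX hx)
      simp only [coe_range, Set.mem_Iio]
      rw [Nat.div_lt_iff_lt_mul (by positivity), ← pow_add, Nat.sub_add_cancel he]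
      exact h1
    · have h1 : x ≡ y [MOD p ^ e] := by
        rw [Nat.modEq_iff_dvd]
        exact_mod_cast h y hy x hx
      have hxy' : x / p ^ e = y / p ^ e := hxy
      rw [← Nat.div_add_mod x (p ^ e), ← Nat.div_add_mod y (p ^ e), hxy', h1]
  simpa using this

theorem Int.pow_dvd_of_pow_dvd_mul {p : ℕ} (hp : p.Prime) {n s : ℕ} {a b : ℤ}
    (h : (p : ℤ) ^ n ∣ a * b) (hb : ¬ (p : ℤ) ^ (s + 1) ∣ b) : (p : ℤ) ^ (n - s) ∣ a := by
  have hpp : Prime (p : ℤ) := Nat.prime_iff_prime_int.1 hp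
  induction s generalizing n b with
  | zero => exact hpp.pow_dvd_of_dvd_mul_right n (by simpa using hb) h
  | succ s ih =>
    by_cases hpb : (p : ℤ) ∣ b
    · obtain ⟨c, rfl⟩ := hpb
      have hc : ¬ (p : ℤ) ^ (s + 1) ∣ c := fun hc => hb (by
        rw [pow_succ']; exact mul_dvd_mul_left _ hc)
      rcases n with _ | n
      · simp
      · have := ih (n := n) (b := c) (by
          rw [pow_succ', mul_left_comm] at h
          exact (mul_dvd_mul_iff_left hpp.ne_zero).1 h) hc
        rwa [Nat.add_sub_add_right]
    · exact (pow_dvd_pow _ (Nat.sub_le _ _)).trans (hpp.pow_dvd_of_dvd_mul_right n hpb h)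

/-- Roots, modulo `p ^ n`, of the derivative of `log ((x + b₁) (x + b₂) / ((x + b₃) (x + b₄)))`. -/
theorem card_sq_le_of_pow_dvd {p n k : ℕ} (hp : p.Prime) (hnk : n ≤ k) {b₁ b₂ b₃ b₄ : ℤ}
    {X : Finset ℕ} (hX : X ⊆ range (p ^ k))
    (hu : ∀ x ∈ X, ¬ (p : ℤ) ∣ (x + b₁) ∧ ¬ (p : ℤ) ∣ (x + b₂) ∧ ¬ (p : ℤ) ∣ (x + b₃) ∧
      ¬ (p : ℤ) ∣ (x + b₄))
    (hr : ∀ x ∈ X, (p : ℤ) ^ n ∣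
      (b₂ - b₄) * ((x + b₁) * (x + b₃)) + (b₁ - b₃) * ((x + b₂) * (x + b₄))) :
    #X ^ 2 ≤ 16 * (p ^ (k - n)) ^ 2 *
      Int.gcd ((b₁ - b₃) * (b₁ - b₄) * (b₂ - b₃) * (b₂ - b₄)) ((p : ℤ) ^ (2 * n)) := by
  have hpp : Prime (p : ℤ) := Nat.prime_iff_prime_int.1 hp
  have haux : ∀ {a b c : ℤ}, a ∣ b → b = c → a ∣ c := fun h e => e ▸ h
  obtain ⟨s, hsn, hs⟩ : ∃ s ≤ n, Int.gcd (2 * (b₁ - b₃) * (b₁ - b₄)) ((p : ℤ) ^ n) = p ^ s :=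
    (Nat.dvd_prime_pow hp).1 (by
      have := Int.gcd_dvd_right (2 * (b₁ - b₃) * (b₁ - b₄)) ((p : ℤ) ^ n)
      exact_mod_cast this)
  have hs1 : (p : ℤ) ^ s ∣ 2 * (b₁ - b₃) * (b₁ - b₄) := by
    have := Int.gcd_dvd_left (2 * (b₁ - b₃) * (b₁ - b₄)) ((p : ℤ) ^ n)
    rw [hs] at this; exact_mod_cast this
  rcases X.eq_empty_or_nonempty with rfl | ⟨x₀, hx₀⟩
  · simp
  have hcop : ∀ {y z : ℤ} {t : ℕ}, ¬ (p : ℤ) ∣ y → (p : ℤ) ^ t ∣ y * z → (p : ℤ) ^ t ∣ z :=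
    fun hy h => hpp.pow_dvd_of_dvd_mul_left _ hy h
  have hs2 : (p : ℤ) ^ s ∣ 2 * (b₂ - b₃) * (b₂ - b₄) := by
    obtain ⟨h1, h2, h3, h4⟩ := hu x₀ hx₀
    have h := (pow_dvd_pow (p : ℤ) hsn).trans (hr x₀ hx₀)
    refine hcop h1 (hcop h1 (hcop h3 (hcop h4 ?_)))
    have := dvd_add (h.mul_right (2 * ((b₂ - b₄) * ((x₀ + b₁) * (x₀ + b₃)) -
      (b₁ - b₄) * ((x₀ + b₂) * (x₀ + b₃)))))
      (hs1.mul_right ((x₀ + b₂) ^ 2 * ((x₀ + b₃) * (x₀ + b₄))))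
    exact haux this (by ring)
  have hD : (p ^ s) ^ 2 ≤ 4 * Int.gcd ((b₁ - b₃) * (b₁ - b₄) * (b₂ - b₃) * (b₂ - b₄))
      ((p : ℤ) ^ (2 * n)) := by
    refine Nat.le_of_dvd (Nat.mul_pos (by norm_num) (Int.gcd_pos_of_ne_zero_right _
      (pow_ne_zero _ hpp.ne_zero))) ?_
    have h1 : (p : ℤ) ^ (2 * s) ∣ 4 * ((b₁ - b₃) * (b₁ - b₄) * (b₂ - b₃) * (b₂ - b₄)) := by
      have := mul_dvd_mul hs1 hs2
      rw [← pow_add, ← two_mul] at this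
      exact haux this (by ring)
    have h2 : (p : ℤ) ^ (2 * s) ∣ 4 * (p : ℤ) ^ (2 * n) :=
      (pow_dvd_pow _ (by omega)).mul_left _
    have h3 := Int.dvd_coe_gcd h1 h2
    rw [Int.gcd_mul_left] at h3
    rw [← pow_mul, mul_comm s 2]
    exact_mod_cast h3
  have hcard : #X ≤ 2 * p ^ (k - n + s) := by
    rcases hsn.eq_or_lt with rfl | hlt
    · have := card_le_card hX
      rw [card_range] at this
      rw [Nat.sub_add_cancel hnk]
      omega
    have hs3 : ¬ (p : ℤ) ^ (s + 1) ∣ 2 * (b₁ - b₃) * (b₁ - b₄) := fun h => by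
      have h2 := Int.dvd_coe_gcd h (pow_dvd_pow (p : ℤ) hlt)
      rw [hs] at h2
      have h3 : p ^ (s + 1) ∣ p ^ s := by exact_mod_cast h2
      rw [Nat.pow_dvd_pow_iff_le_right hp.one_lt] at h3
      omega
    set w : ℤ → ℤ → ℤ := fun x y => (b₂ - b₄) * (x + y + b₁ + b₃) + (b₁ - b₃) * (x + y + b₂ + b₄)
      with hw
    have hww : ∀ x ∈ X, ¬ (p : ℤ) ^ (s + 1) ∣ w x x := by
      intro x hx hd
      obtain ⟨h1, h2, h3, h4⟩ := hu x hx
      refine hs3 (hcop h2 (hcop h3 ?_))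
      have h := (pow_dvd_pow (p : ℤ) hlt).trans (hr x hx)
      have := dvd_add (h.mul_right (b₁ - b₃ - (x + b₁) - (x + b₃)))
        (hd.mul_right ((x + b₁) * (x + b₃)))
      exact haux this (by simp only [hw]; ring)
    have hdich : ∀ x ∈ X, ∀ y ∈ X, (p : ℤ) ^ (n - s) ∣ (x : ℤ) - y ∨ (p : ℤ) ^ (s + 1) ∣ w x y := by
      intro x hx y hy
      by_cases h : (p : ℤ) ^ (s + 1) ∣ w x y
      · exact Or.inr h
      · refine Or.inl (Int.pow_dvd_of_pow_dvd_mul hp ?_ h)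
        have := dvd_sub (hr x hx) (hr y hy)
        exact haux this (by simp only [hw]; ring)
    have hks : k - n + s = k - (n - s) := by omega
    rw [hks, ← card_filter_add_card_filter_not (fun x : ℕ => (p : ℤ) ^ (n - s) ∣ (x : ℤ) - x₀),
      two_mul]
    refine add_le_add ?_ ?_
    · refine card_le_of_modEq hp.pos (by omega) ((filter_subset _ _).trans hX) fun x hx y hy => ?_
      have := dvd_sub (mem_filter.1 hx).2 (mem_filter.1 hy).2
      simpa using this
    · refine card_le_of_modEq hp.pos (by omega) ((filter_subset _ _).trans hX) fun x hx y hy => ?_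
      rw [mem_filter] at hx hy
      refine (hdich x hx.1 y hy.1).resolve_right fun h => hww x₀ hx₀ ?_
      have hx' := (hdich x hx.1 x₀ hx₀).resolve_left hx.2
      have hy' := (hdich y hy.1 x₀ hx₀).resolve_left hy.2
      have := dvd_sub (dvd_add hx' hy') h
      exact haux this (by simp only [hw]; ring)
  calc #X ^ 2 ≤ (2 * p ^ (k - n + s)) ^ 2 := Nat.pow_le_pow_left hcard 2
    _ = 4 * (p ^ (k - n)) ^ 2 * (p ^ s) ^ 2 := by rw [pow_add]; ring
    _ ≤ 4 * (p ^ (k - n)) ^ 2 * (4 * _) := Nat.mul_le_mul_left _ hD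
    _ = _ := by ring

end

section

open Finset

/-- `χ` is nontrivial on the units congruent to `1` modulo `q / p`, for every prime `p ∣ q`. -/
def MulChar.Nondegenerate {q : ℕ} (χ : MulChar (ZMod q) ℂ) : Prop :=
  ∀ p : ℕ, p.Prime → p ∣ q → ∃ w : ZMod q, IsUnit (1 + ((q / p : ℕ) : ZMod q) * w) ∧
    χ (1 + ((q / p : ℕ) : ZMod q) * w) ≠ 1

theorem ZMod.pow_dvd_intCast_iff {p k j : ℕ} (hj : j ≤ k) (n : ℤ) :
    (p : ZMod (p ^ k)) ^ j ∣ (n : ZMod (p ^ k)) ↔ (p : ℤ) ^ j ∣ n := by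
  refine ⟨?_, fun ⟨m, hm⟩ => ⟨m, by rw [hm]; push_cast; ring⟩⟩
  rintro ⟨m, hm⟩
  obtain ⟨m, rfl⟩ := ZMod.intCast_surjective m
  have h1 : (n : ZMod (p ^ k)) = ((p ^ j * m : ℤ) : ZMod (p ^ k)) := by rw [hm]; push_cast; ring
  rw [ZMod.intCast_eq_intCast_iff_dvd_sub] at h1
  have h2 : (p : ℤ) ^ j ∣ p ^ j * m - n := by
    refine dvd_trans (pow_dvd_pow _ hj) ?_
    exact_mod_cast h1
  simpa using dvd_sub (dvd_mul_right ((p : ℤ) ^ j) m) h2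

theorem ZMod.isUnit_intCast_pow_iff {p k : ℕ} (hp : p.Prime) (hk : k ≠ 0) (n : ℤ) :
    IsUnit (n : ZMod (p ^ k)) ↔ ¬ (p : ℤ) ∣ n := by
  rw [ZMod.coe_int_isUnit_iff_isCoprime]
  push_cast
  rw [IsCoprime.pow_left_iff (Nat.pos_of_ne_zero hk),
    (Nat.prime_iff_prime_int.1 hp).coprime_iff_not_dvd]

variable {p k : ℕ}

theorem MulChar.Nondegenerate.forall_eq_one_iff (hp : p.Prime) {χ : MulChar (ZMod (p ^ k)) ℂ}
    (hχ : χ.Nondegenerate) {i j : ℕ} (hij : i + j = k) (l : ZMod (p ^ k)) :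
    (∀ s, χ (1 + (p : ZMod (p ^ k)) ^ i * (l * s)) = 1) ↔ (p : ZMod (p ^ k)) ^ j ∣ l := by
  have h0 : (p : ZMod (p ^ k)) ^ k = 0 := by
    rw [← Nat.cast_pow]; exact ZMod.natCast_self _
  constructor
  · intro h
    by_contra hl
    obtain ⟨L, rfl⟩ := ZMod.intCast_surjective l
    rw [ZMod.pow_dvd_intCast_iff (by omega)] at hl
    have hL : L ≠ 0 := by rintro rfl; simp at hl
    obtain ⟨a, u, rfl, hu⟩ : ∃ (a : ℕ) (u : ℤ), L = (p : ℤ) ^ a * u ∧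
        ¬ (p : ℤ) ∣ u := by
      obtain ⟨u, h1, h2⟩ := (Int.finiteMultiplicity_iff.2
        ⟨by simpa using hp.ne_one, hL⟩ : FiniteMultiplicity (p : ℤ) L).exists_eq_pow_mul_and_not_dvd
      exact ⟨_, u, h1, h2⟩
    have ha : a < j := by
      by_contra ha
      exact hl ((pow_dvd_pow _ (not_lt.1 ha)).mul_right _)
    have hu' := (ZMod.isUnit_intCast_pow_iff (k := k) hp (by omega) u).2 hu
    obtain ⟨v, hv⟩ := hu'.exists_right_inv
    obtain ⟨w, hw, hw'⟩ := hχ p hp (dvd_pow_self _ (by omega))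
    apply hw'
    have hd : p ^ k / p = p ^ (k - 1) := by
      rw [Nat.div_eq_iff_eq_mul_left hp.pos (dvd_pow_self _ (by omega)), ← pow_succ]
      congr 1; omega
    rw [← h (p ^ (k - 1 - i - a) * v * w), hd]
    congr 2
    push_cast
    have e : k - 1 = i + a + (k - 1 - i - a) := by omega
    rw [e, pow_add, pow_add, ← e]
    linear_combination (-(p : ZMod (p ^ k)) ^ i * p ^ a * p ^ (k - 1 - i - a) * w) * hv
  · rintro ⟨m, rfl⟩ s
    have : (p : ZMod (p ^ k)) ^ i * (p ^ j * m * s) = 0 := by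
      have h1 : (p : ZMod (p ^ k)) ^ i * p ^ j = 0 := by rw [← pow_add, hij]; exact h0
      linear_combination m * s * h1
    rw [this]; simp

open Classical in
/-- The stationary points modulo `p ^ j` in the complete sum `quadSum`. -/
noncomputable def stationaryPoints (p k j : ℕ) [NeZero (p ^ k)] (b₁ b₂ b₃ b₄ : ℤ) :
    Finset (ZMod (p ^ k)) :=
  {x | (IsUnit (x + b₁) ∧ IsUnit (x + b₂) ∧ IsUnit (x + b₃) ∧ IsUnit (x + b₄)) ∧
    (p : ZMod (p ^ k)) ^ j ∣
      (b₂ - b₄) * ((x + b₁) * (x + b₃)) + (b₁ - b₃) * ((x + b₂) * (x + b₄))}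

theorem card_stationaryPoints_sq_le (hp : p.Prime) [NeZero (p ^ k)] (hk : k ≠ 0) {j : ℕ}
    (hj : j ≤ k) (b₁ b₂ b₃ b₄ : ℤ) :
    #(stationaryPoints p k j b₁ b₂ b₃ b₄) ^ 2 ≤ 16 * (p ^ (k - j)) ^ 2 *
      Int.gcd ((b₁ - b₃) * (b₁ - b₄) * (b₂ - b₃) * (b₂ - b₄)) ((p : ℤ) ^ (2 * j)) := by
  classical
  rw [← card_image_of_injective _ (ZMod.val_injective (p ^ k))]
  have hc : ∀ x : ZMod (p ^ k), x = ((x.val : ℤ) : ZMod (p ^ k)) := fun x => by simp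
  refine card_sq_le_of_pow_dvd hp hj (fun x hx => ?_) (fun x hx => ?_) (fun x hx => ?_)
  all_goals
    obtain ⟨x, hx', rfl⟩ := mem_image.1 hx
    obtain ⟨h1, h2⟩ := (mem_filter.1 hx').2
  · exact mem_range.2 (ZMod.val_lt x)
  · rw [hc x] at h1
    simp only [← Int.cast_add, ZMod.isUnit_intCast_pow_iff hp hk] at h1
    exact h1
  · rw [hc x] at h2
    rw [← ZMod.pow_dvd_intCast_iff hj]
    push_cast at h2 ⊢
    exact h2

theorem pow_dvd_iff_of_mul_eq_one {R : Type*} [CommRing R] {q y₁ y₂ y₃ y₄ c₁ c₂ c₃ c₄ : R}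
    (h₁ : y₁ * c₁ = 1) (h₂ : y₂ * c₂ = 1) (h₃ : y₃ * c₃ = 1) (h₄ : y₄ * c₄ = 1) :
    q ∣ c₁ + c₂ - c₃ - c₄ ↔ q ∣ (y₂ - y₄) * (y₁ * y₃) + (y₁ - y₃) * (y₂ * y₄) := by
  have e1 : (y₂ - y₄) * (y₁ * y₃) + (y₁ - y₃) * (y₂ * y₄) =
      (c₁ + c₂ - c₃ - c₄) * (-(y₁ * y₂ * y₃ * y₄)) := by
    linear_combination (y₂ * y₃ * y₄) * h₁ + (y₁ * y₃ * y₄) * h₂ - (y₁ * y₂ * y₄) * h₃ -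
      (y₁ * y₂ * y₃) * h₄
  rw [e1]
  refine (IsUnit.dvd_mul_right ?_).symm
  refine (IsUnit.mul (IsUnit.mul (IsUnit.mul ?_ ?_) ?_) ?_).neg
  exacts [IsUnit.of_mul_eq_one _ h₁, IsUnit.of_mul_eq_one _ h₂, IsUnit.of_mul_eq_one _ h₃,
    IsUnit.of_mul_eq_one _ h₄]

theorem quadSum_eq_sum_stationaryPoints (hp : p.Prime) [NeZero (p ^ k)]
    {χ : MulChar (ZMod (p ^ k)) ℂ} (hχ : χ.Nondegenerate) {i j : ℕ} (hij : i + j = k) (hji : j ≤ i)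
    (b₁ b₂ b₃ b₄ : ℤ) :
    quadSum χ (b₁ : ZMod (p ^ k)) b₂ b₃ b₄ = ∑ x ∈ stationaryPoints p k j b₁ b₂ b₃ b₄,
      quadChar χ (x + b₁) (x + b₂) (x + b₃) (x + b₄) := by
  have h0 : (p : ZMod (p ^ k)) ^ k = 0 := by
    rw [← Nat.cast_pow]; exact ZMod.natCast_self _
  refine quadSum_eq_sum_filter χ _ _ _ _ (π := (p : ZMod (p ^ k)) ^ i) ?_ _ ?_
  · rw [← pow_add]; exact pow_eq_zero_of_le (by omega) h0
  · intro x c₁ c₂ c₃ c₄ h₁ h₂ h₃ h₄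
    rw [hχ.forall_eq_one_iff hp hij, pow_dvd_iff_of_mul_eq_one h₁ h₂ h₃ h₄, stationaryPoints,
      mem_filter]
    have hu : IsUnit (x + b₁) ∧ IsUnit (x + b₂) ∧ IsUnit (x + b₃) ∧ IsUnit (x + b₄) :=
      ⟨IsUnit.of_mul_eq_one _ h₁, IsUnit.of_mul_eq_one _ h₂, IsUnit.of_mul_eq_one _ h₃,
        IsUnit.of_mul_eq_one _ h₄⟩
    simp only [mem_univ, true_and, hu, add_sub_add_left_eq_sub]

theorem norm_quadSum_le_card_stationaryPoints (hp : p.Prime) [NeZero (p ^ k)]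
    {χ : MulChar (ZMod (p ^ k)) ℂ} (hχ : χ.Nondegenerate) {i j : ℕ} (hij : i + j = k) (hji : j ≤ i)
    (b₁ b₂ b₃ b₄ : ℤ) :
    ‖quadSum χ (b₁ : ZMod (p ^ k)) b₂ b₃ b₄‖ ≤ #(stationaryPoints p k j b₁ b₂ b₃ b₄) := by
  rw [quadSum_eq_sum_stationaryPoints hp hχ hij hji]
  refine (norm_sum_le _ _).trans ?_
  calc _ ≤ ∑ _x ∈ stationaryPoints p k j b₁ b₂ b₃ b₄, (1 : ℝ) :=
        sum_le_sum fun x _ => norm_quadChar_le _ _ _ _ _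
    _ = _ := by simp

end

section

open Finset

variable {p k : ℕ}

theorem card_filter_dvd_le (hp : p.Prime) [NeZero (p ^ k)] (hk : 1 ≤ k)
    (X : Finset (ZMod (p ^ k))) (hX : ∀ x ∈ X, (p : ZMod (p ^ k)) ∣ x) : #X ≤ p ^ (k - 1) := by
  rw [← card_image_of_injective _ (ZMod.val_injective (p ^ k))]
  refine card_le_of_modEq hp.pos hk (fun x hx => ?_) fun x hx y hy => ?_
  · obtain ⟨x, _, rfl⟩ := mem_image.1 hx
    exact mem_range.2 (ZMod.val_lt x)
  · have : ∀ x ∈ X.image ZMod.val, (p : ℤ) ^ 1 ∣ (x : ℤ) := by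
      intro x hx
      obtain ⟨x, hx', rfl⟩ := mem_image.1 hx
      rw [← ZMod.pow_dvd_intCast_iff hk]
      simpa using hX x hx'
    exact dvd_sub (this x hx) (this y hy)

theorem ZMod.dvd_of_dvd_mul_pow (hp : p.Prime) (hk : 1 ≤ k) {a b : ZMod (p ^ k)}
    (ha : ¬ (p : ZMod (p ^ k)) ∣ a) (h : (p : ZMod (p ^ k)) ∣ a * b) :
    (p : ZMod (p ^ k)) ∣ b := by
  obtain ⟨a, rfl⟩ := ZMod.intCast_surjective a
  obtain ⟨b, rfl⟩ := ZMod.intCast_surjective b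
  rw [← Int.cast_mul, ← pow_one (p : ZMod (p ^ k)), ZMod.pow_dvd_intCast_iff hk, pow_one] at h
  rw [← pow_one (p : ZMod (p ^ k)), ZMod.pow_dvd_intCast_iff hk, pow_one] at ha ⊢
  exact ((Nat.prime_iff_prime_int.1 hp).dvd_or_dvd h).resolve_left ha

theorem norm_sum_onePlus_quadratic_le (hp : p.Prime) (hp2 : p ≠ 2) [NeZero (p ^ k)]
    {χ : MulChar (ZMod (p ^ k)) ℂ} (hχ : χ.Nondegenerate) {i : ℕ} (hi : i + 1 = k) (hi0 : 1 ≤ i)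
    (m e : ZMod (p ^ k)) :
    ‖∑ s, χ (1 + (p : ZMod (p ^ k)) ^ i * (m * s + e * s ^ 2))‖ ≤
      (p ^ k : ℕ) / Real.sqrt p ∨ (p : ZMod (p ^ k)) ∣ m := by
  classical
  have h0 : (p : ZMod (p ^ k)) ^ k = 0 := by
    rw [← Nat.cast_pow]; exact ZMod.natCast_self _
  have hπ : (p : ZMod (p ^ k)) ^ i * (p : ZMod (p ^ k)) ^ i = 0 := by
    rw [← pow_add]; exact pow_eq_zero_of_le (by omega) h0
  have hp0 : (0 : ℝ) < p := by exact_mod_cast hp.pos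
  have htriv : ∀ l, (∀ s, χ.onePlus hπ (l * s) = 1) ↔ (p : ZMod (p ^ k)) ∣ l := by
    intro l
    have := hχ.forall_eq_one_iff hp hi l
    rwa [pow_one] at this
  by_cases hm : (p : ZMod (p ^ k)) ∣ m
  · exact Or.inr hm
  left
  simp only [← MulChar.onePlus_apply χ hπ]
  by_cases he : (p : ZMod (p ^ k)) ∣ e
  · have h1 : ∀ s, χ.onePlus hπ (m * s + e * s ^ 2) = (χ.onePlus hπ).mulShift m s := by
      intro s
      rw [AddChar.map_add_eq_mul, (htriv e).2 he, mul_one, AddChar.mulShift_apply]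
    simp only [h1, AddChar.sum_eq_ite]
    rw [if_neg, norm_zero]
    · positivity
    · rw [AddChar.eq_zero_iff]
      exact fun h => hm ((htriv m).1 h)
  · refine (Real.le_sqrt_of_sq_le (y := (p ^ k : ℕ) * (p ^ (k - 1) : ℕ))
      ((AddChar.norm_sum_quadratic_sq_le _ _ _).trans ?_)).trans (le_of_eq ?_)
    · rw [ZMod.card]
      have := card_filter_dvd_le hp (by omega)
        ({h : ZMod (p ^ k) | ∀ y, χ.onePlus hπ (2 * e * h * y) = 1} : Finset _) (fun h hh => by
          rw [mem_filter, htriv] at hh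
          refine ZMod.dvd_of_dvd_mul_pow hp (by omega) (a := 2 * e) (fun h2 => he ?_) hh.2
          refine ZMod.dvd_of_dvd_mul_pow hp (by omega) (fun h3 => hp2 ?_) h2
          have h4 : (p : ZMod (p ^ k)) ^ 1 ∣ ((2 : ℤ) : ZMod (p ^ k)) := by simpa using h3
          rw [ZMod.pow_dvd_intCast_iff (by omega), pow_one] at h4
          exact (Nat.prime_dvd_prime_iff_eq hp Nat.prime_two).1 (by exact_mod_cast h4))
      gcongr
    · rw [← hi]
      simp only [Nat.add_sub_cancel]
      rw [eq_div_iff (by positivity), ← Real.sqrt_mul (by positivity)]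
      rw [Real.sqrt_eq_iff_mul_self_eq (by positivity) (by positivity)]
      push_cast
      ring

theorem norm_quadSum_le_of_odd_exponent (hp : p.Prime) (hp2 : p ≠ 2) [NeZero (p ^ k)]
    {χ : MulChar (ZMod (p ^ k)) ℂ} (hχ : χ.Nondegenerate) {j : ℕ} (hk : k = 2 * j + 1)
    (hj : 1 ≤ j) (b₁ b₂ b₃ b₄ : ℤ) :
    ‖quadSum χ (b₁ : ZMod (p ^ k)) b₂ b₃ b₄‖ ≤ #(stationaryPoints p k j b₁ b₂ b₃ b₄) / Real.sqrt p +
      #(stationaryPoints p k (j + 1) b₁ b₂ b₃ b₄) := by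
  classical
  have h0 : (p : ZMod (p ^ k)) ^ k = 0 := by
    rw [← Nat.cast_pow]; exact ZMod.natCast_self _
  have hq : (0 : ℝ) < (p ^ k : ℕ) := by exact_mod_cast NeZero.pos (p ^ k)
  have hinv' : ∀ x s, x ∈ stationaryPoints p k j b₁ b₂ b₃ b₄ →
      x + (p : ZMod (p ^ k)) ^ j * s ∈ stationaryPoints p k j b₁ b₂ b₃ b₄ := by
    intro x s hx
    simp only [stationaryPoints, mem_filter, mem_univ, true_and] at hx ⊢
    obtain ⟨⟨h1, h2, h3, h4⟩, h⟩ := hx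
    have hn : IsNilpotent ((p : ZMod (p ^ k)) ^ j * s) := by
      refine ⟨k, ?_⟩
      rw [mul_pow, ← pow_mul, mul_comm j, pow_mul, h0, zero_pow (by omega), zero_mul]
    refine ⟨?_, ?_⟩
    · simp only [add_right_comm x]
      exact ⟨hn.isUnit_add_left_of_commute h1 (Commute.all _ _),
        hn.isUnit_add_left_of_commute h2 (Commute.all _ _),
        hn.isUnit_add_left_of_commute h3 (Commute.all _ _),
        hn.isUnit_add_left_of_commute h4 (Commute.all _ _)⟩
    · refine (dvd_add_right (dvd_mul_right _ (s * (((b₂ - b₄) * ((x + b₁) + (x + b₃) +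
        (p : ZMod (p ^ k)) ^ j * s)) + ((b₁ - b₃) * ((x + b₂) + (x + b₄) +
        (p : ZMod (p ^ k)) ^ j * s)))))).2 h |>.trans (dvd_of_eq ?_)
      ring
  have hinv : ∀ x s, x + (p : ZMod (p ^ k)) ^ j * s ∈ stationaryPoints p k j b₁ b₂ b₃ b₄ ↔
      x ∈ stationaryPoints p k j b₁ b₂ b₃ b₄ := fun x s => ⟨fun h => by
        have := hinv' _ (-s) h
        simpa using this, hinv' x s⟩
  have h1 := card_mul_sum_quadChar_eq χ (b₁ : ZMod (p ^ k)) b₂ b₃ b₄ _ hinv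
  rw [← quadSum_eq_sum_stationaryPoints hp hχ (i := j + 1) (by omega) (by omega), ZMod.card] at h1
  have h2 : ∀ x ∈ stationaryPoints p k j b₁ b₂ b₃ b₄,
      ‖∑ s, quadChar χ (x + b₁ + (p : ZMod (p ^ k)) ^ j * s) (x + b₂ + (p : ZMod (p ^ k)) ^ j * s)
        (x + b₃ + (p : ZMod (p ^ k)) ^ j * s) (x + b₄ + (p : ZMod (p ^ k)) ^ j * s)‖ ≤
      (p ^ k : ℕ) * (1 / Real.sqrt p +
        if x ∈ stationaryPoints p k (j + 1) b₁ b₂ b₃ b₄ then 1 else 0) := by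
    intro x hx
    simp only [stationaryPoints, mem_filter, mem_univ, true_and] at hx ⊢
    obtain ⟨hu, h⟩ := hx
    obtain ⟨c₁, h₁⟩ := hu.1.exists_right_inv
    obtain ⟨c₂, h₂⟩ := hu.2.1.exists_right_inv
    obtain ⟨c₃, h₃⟩ := hu.2.2.1.exists_right_inv
    obtain ⟨c₄, h₄⟩ := hu.2.2.2.exists_right_inv
    have hiff : ∀ n : ℕ, (p : ZMod (p ^ k)) ^ n ∣ c₁ + c₂ - c₃ - c₄ ↔ (p : ZMod (p ^ k)) ^ n ∣
        (b₂ - b₄) * ((x + b₁) * (x + b₃)) + (b₁ - b₃) * ((x + b₂) * (x + b₄)) := fun n => by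
      rw [pow_dvd_iff_of_mul_eq_one h₁ h₂ h₃ h₄]; simp only [add_sub_add_left_eq_sub]
    rw [← hiff] at h
    simp only [← hiff, hu, true_and]
    obtain ⟨m, hm⟩ := h
    set e := c₁ * c₂ + c₃ ^ 2 + c₄ ^ 2 + c₃ * c₄ - (c₁ + c₂) * (c₃ + c₄) with he
    have h3 : ∀ s, quadChar χ (x + b₁ + (p : ZMod (p ^ k)) ^ j * s)
        (x + b₂ + (p : ZMod (p ^ k)) ^ j * s) (x + b₃ + (p : ZMod (p ^ k)) ^ j * s)
        (x + b₄ + (p : ZMod (p ^ k)) ^ j * s) = quadChar χ (x + b₁) (x + b₂) (x + b₃) (x + b₄) *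
        χ (1 + (p : ZMod (p ^ k)) ^ (2 * j) * (m * s + e * s ^ 2)) := by
      intro s
      rw [quadChar_add χ h₁ h₂ h₃ h₄, ← he, hm]
      · congr 2; ring
      · rw [mul_pow, ← pow_mul, pow_eq_zero_of_le (by omega) h0, zero_mul]
    simp only [h3, ← mul_sum, norm_mul]
    refine (mul_le_of_le_one_left (norm_nonneg _) (norm_quadChar_le _ _ _ _ _)).trans ?_
    rcases norm_sum_onePlus_quadratic_le hp hp2 hχ (i := 2 * j) (by omega) (by omega) m e with
      h4 | h4
    · refine h4.trans ?_
      rw [mul_add, mul_one_div]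
      have : (0 : ℝ) ≤ if (p : ZMod (p ^ k)) ^ (j + 1) ∣ c₁ + c₂ - c₃ - c₄ then 1 else 0 := by
        split_ifs <;> norm_num
      nlinarith
    · rw [if_pos (by rw [hm, pow_succ]; exact mul_dvd_mul_left _ h4)]
      refine (norm_sum_le _ _).trans ?_
      have h5 : ∀ y, ‖χ y‖ ≤ 1 := fun y => by
        by_cases hy : IsUnit y
        · have := norm_quadChar_le χ y 1 1 1
          simpa [quadChar] using this
        · simp [χ.map_nonunit hy]
      calc _ ≤ ∑ _s : ZMod (p ^ k), (1 : ℝ) := sum_le_sum fun s _ => h5 _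
        _ = (p ^ k : ℕ) := by simp
        _ ≤ _ := by
          have : 0 ≤ 1 / Real.sqrt p := by positivity
          nlinarith
  have h3 : (p ^ k : ℕ) * ‖quadSum χ (b₁ : ZMod (p ^ k)) b₂ b₃ b₄‖ ≤
      (p ^ k : ℕ) * (#(stationaryPoints p k j b₁ b₂ b₃ b₄) / Real.sqrt p +
        #(stationaryPoints p k (j + 1) b₁ b₂ b₃ b₄)) := by
    calc _ = ‖((p ^ k : ℕ) : ℂ) * quadSum χ (b₁ : ZMod (p ^ k)) b₂ b₃ b₄‖ := by
          rw [norm_mul, Complex.norm_natCast]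
      _ ≤ _ := by
          rw [h1]
          refine (norm_sum_le _ _).trans ((sum_le_sum h2).trans ?_)
          rw [← mul_sum, sum_add_distrib, sum_const, nsmul_eq_mul, mul_one_div, ← sum_filter,
            sum_const, nsmul_eq_mul, mul_one]
          gcongr
          intro x hx
          exact (mem_filter.1 hx).2
  exact le_of_mul_le_mul_left h3 hq

end

section

open Finset

theorem quadSum_swap_left {R : Type*} [CommRing R] [Fintype R] (χ : MulChar R ℂ)
    (b₁ b₂ b₃ b₄ : R) : quadSum χ b₁ b₂ b₃ b₄ = quadSum χ b₂ b₁ b₃ b₄ :=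
  sum_congr rfl fun x _ => by simp only [quadChar]; ring

theorem quadSum_swap_right {R : Type*} [CommRing R] [Fintype R] (χ : MulChar R ℂ)
    (b₁ b₂ b₃ b₄ : R) : quadSum χ b₁ b₂ b₃ b₄ = quadSum χ b₁ b₂ b₄ b₃ :=
  sum_congr rfl fun x _ => by simp only [quadChar]; ring

theorem quadSum_swap_inv {R : Type*} [CommRing R] [Fintype R] (χ : MulChar R ℂ)
    (b₁ b₂ b₃ b₄ : R) : quadSum χ b₁ b₂ b₃ b₄ = quadSum χ⁻¹ b₃ b₄ b₁ b₂ :=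
  sum_congr rfl fun x _ => by simp only [quadChar, inv_inv]; ring

section prime

variable {p : ℕ} [Fact p.Prime] {χ : MulChar (ZMod p) ℂ}

theorem quadSum_eq_sum_sub_one (χ : MulChar (ZMod p) ℂ) (b₁ b₂ b₃ b₄ : ZMod p) :
    quadSum χ b₁ b₂ b₃ b₄ = (∑ t, χ (1 + (b₁ - b₄) * t) * χ (1 + (b₂ - b₄) * t) *
      χ⁻¹ (1 + (b₃ - b₄) * t)) - 1 := by
  classical
  have h1 : quadSum χ b₁ b₂ b₃ b₄ = ∑ t : ZMod p, quadChar χ (t⁻¹ + (b₁ - b₄)) (t⁻¹ + (b₂ - b₄))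
      (t⁻¹ + (b₃ - b₄)) t⁻¹ := by
    refine (Equiv.sum_comp ((Equiv.inv (ZMod p)).trans (Equiv.addRight (-b₄))) _).symm.trans ?_
    refine sum_congr rfl fun t _ => ?_
    simp only [Equiv.trans_apply, Equiv.inv_apply, Equiv.coe_addRight]
    congr 1 <;> ring
  have h2 : ∀ t : ZMod p, quadChar χ (t⁻¹ + (b₁ - b₄)) (t⁻¹ + (b₂ - b₄))
      (t⁻¹ + (b₃ - b₄)) t⁻¹ = χ (1 + (b₁ - b₄) * t) * χ (1 + (b₂ - b₄) * t) *
      χ⁻¹ (1 + (b₃ - b₄) * t) - if t = 0 then 1 else 0 := by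
    intro t
    by_cases ht : t = 0
    · simp [ht, quadChar, MulChar.map_zero]
    · have e : ∀ b : ZMod p, t⁻¹ + b = t⁻¹ * (1 + b * t) := fun b => by field_simp
      have hu : χ t⁻¹ * χ⁻¹ t⁻¹ = 1 := by
        rw [MulChar.inv_apply', ← map_mul, inv_inv, inv_mul_cancel₀ ht, map_one]
      simp only [quadChar, e, map_mul, ht, if_false, sub_zero]
      linear_combination χ (1 + (b₁ - b₄) * t) * χ (1 + (b₂ - b₄) * t) *
        χ⁻¹ (1 + (b₃ - b₄) * t) * (χ t⁻¹ * χ⁻¹ t⁻¹ + 1) * hu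
  rw [h1]
  simp only [h2, sum_sub_distrib, sum_ite_eq', mem_univ, if_true]

theorem norm_quadSum_le_of_ne (hχ : χ ≠ 1) {b₁ b₂ b₃ b₄ : ZMod p} (h₁₃ : b₁ ≠ b₃) (h₁₄ : b₁ ≠ b₄)
    (h₂₃ : b₂ ≠ b₃) (h₂₄ : b₂ ≠ b₄) (h : b₁ ≠ b₂ ∨ b₃ ≠ b₄) :
    ‖quadSum χ b₁ b₂ b₃ b₄‖ ≤ 3 * Real.sqrt p := by
  wlog h₃₄ : b₃ ≠ b₄ generalizing χ b₁ b₂ b₃ b₄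
  · rw [quadSum_swap_inv]
    exact this (inv_ne_one.2 hχ) h₁₃.symm h₂₃.symm h₁₄.symm h₂₄.symm h.symm
      (h.resolve_right h₃₄)
  have hn : ∀ {χ : MulChar (ZMod p) ℂ} {y}, ‖χ y‖ ≤ 1 := fun {χ y} => by
    simpa [quadChar] using norm_quadChar_le χ y 1 1 1
  have e₁ : b₁ - b₄ ≠ 0 := sub_ne_zero.2 h₁₄
  have e₂ : b₂ - b₄ ≠ 0 := sub_ne_zero.2 h₂₄
  have e₃ : b₃ - b₄ ≠ 0 := sub_ne_zero.2 h₃₄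
  have key := weil_bound hχ (a₁ := (b₁ - b₄)⁻¹) (a₂ := (b₂ - b₄)⁻¹) (a₃ := (b₃ - b₄)⁻¹)
    (fun h => h₁₃ (by simpa using h.symm)) (fun h => h₂₃ (by simpa using h.symm))
  have h1 : ∑ t, χ (1 + (b₁ - b₄) * t) * χ (1 + (b₂ - b₄) * t) * χ⁻¹ (1 + (b₃ - b₄) * t) =
      (χ (b₁ - b₄) * χ (b₂ - b₄) * χ⁻¹ (b₃ - b₄)) *
        ∑ t, χ (t + (b₁ - b₄)⁻¹) * χ (t + (b₂ - b₄)⁻¹) * χ⁻¹ (t + (b₃ - b₄)⁻¹) := by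
    rw [mul_sum]
    refine sum_congr rfl fun t _ => ?_
    have e : ∀ b : ZMod p, b ≠ 0 → 1 + b * t = b * (t + b⁻¹) := fun b hb => by field_simp; ring
    rw [e _ e₁, e _ e₂, e _ e₃]
    simp only [map_mul]
    ring
  have hp : 1 ≤ Real.sqrt p := by
    rw [Real.one_le_sqrt]
    exact_mod_cast (Fact.out : p.Prime).one_lt.le
  rw [quadSum_eq_sum_sub_one, h1]
  refine (norm_sub_le _ _).trans ?_
  rw [norm_mul, norm_one]
  have h2 : ‖χ (b₁ - b₄) * χ (b₂ - b₄) * χ⁻¹ (b₃ - b₄)‖ ≤ 1 := by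
    simp only [norm_mul]
    exact mul_le_one₀ (mul_le_one₀ hn (norm_nonneg _) hn) (norm_nonneg _) hn
  nlinarith [norm_nonneg (∑ t, χ (t + (b₁ - b₄)⁻¹) * χ (t + (b₂ - b₄)⁻¹) * χ⁻¹ (t + (b₃ - b₄)⁻¹)),
    norm_nonneg (χ (b₁ - b₄) * χ (b₂ - b₄) * χ⁻¹ (b₃ - b₄))]

theorem norm_quadSum_le_two (hχ : χ ≠ 1) {b₁ b₂ b₄ : ZMod p} (h₂₄ : b₂ ≠ b₄) :
    ‖quadSum χ b₁ b₂ b₁ b₄‖ ≤ 2 := by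
  classical
  have hn : ∀ {χ : MulChar (ZMod p) ℂ} {y}, ‖χ y‖ ≤ 1 := fun {χ y} => by
    simpa [quadChar] using norm_quadChar_le χ y 1 1 1
  have e₂ : b₂ - b₄ ≠ 0 := sub_ne_zero.2 h₂₄
  have h0 : ∑ t, χ (1 + (b₂ - b₄) * t) = 0 := by
    rw [← MulChar.sum_eq_zero_of_ne_one hχ]
    refine Equiv.sum_comp ((Equiv.mulLeft₀ _ e₂).trans (Equiv.addLeft 1)) (fun t => χ t)
  have h1 : ∑ t, χ (1 + (b₁ - b₄) * t) * χ (1 + (b₂ - b₄) * t) * χ⁻¹ (1 + (b₁ - b₄) * t) =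
      -∑ t, if 1 + (b₁ - b₄) * t = 0 then χ (1 + (b₂ - b₄) * t) else 0 := by
    rw [eq_neg_iff_add_eq_zero, ← sum_add_distrib]
    refine (sum_congr rfl fun t _ => ?_).trans h0
    split_ifs with h
    · simp [h, MulChar.map_zero]
    · have hu : χ (1 + (b₁ - b₄) * t) * χ⁻¹ (1 + (b₁ - b₄) * t) = 1 := by
        rw [MulChar.inv_apply', ← map_mul, mul_inv_cancel₀ h, map_one]
      linear_combination χ (1 + (b₂ - b₄) * t) * hu
  rw [quadSum_eq_sum_sub_one, h1]
  refine (norm_sub_le _ _).trans ?_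
  rw [norm_neg, norm_one, ← sum_filter]
  have h2 : #{t : ZMod p | 1 + (b₁ - b₄) * t = 0} ≤ 1 := by
    refine card_le_one.2 fun s hs t ht => ?_
    have hs := (mem_filter.1 hs).2
    have ht := (mem_filter.1 ht).2
    have hb : b₁ - b₄ ≠ 0 := by rintro hb; simp [hb] at hs
    exact mul_left_cancel₀ hb (add_left_cancel (hs.trans ht.symm))
  have h3 : ‖∑ t with 1 + (b₁ - b₄) * t = 0, χ (1 + (b₂ - b₄) * t)‖ ≤ 1 := by
    refine (norm_sum_le _ _).trans ?_
    calc _ ≤ ∑ t with 1 + (b₁ - b₄) * t = 0, (1 : ℝ) := sum_le_sum fun t _ => hn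
      _ = (#{t : ZMod p | 1 + (b₁ - b₄) * t = 0} : ℝ) := by simp
      _ ≤ 1 := by exact_mod_cast h2
  linarith

end prime

end

section

open Finset

theorem Int.gcd_pow_succ_le {p : ℕ} (hp : 0 < p) (D : ℤ) (k : ℕ) :
    Int.gcd D ((p : ℤ) ^ (k + 1)) ≤ p * Int.gcd D ((p : ℤ) ^ k) := by
  rw [pow_succ', Int.gcd_eq_natAbs, Int.gcd_eq_natAbs, Int.natAbs_mul, Int.natAbs_natCast]
  have hpos : 0 < (D.natAbs.gcd ((p : ℤ) ^ k).natAbs) := by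
    refine Nat.gcd_pos_of_pos_right _ ?_
    rw [Int.natAbs_pow, Int.natAbs_natCast]; positivity
  refine (Nat.le_of_dvd (Nat.mul_pos (Nat.gcd_pos_of_pos_right _ hp) hpos)
    (Nat.gcd_mul_right_dvd_mul_gcd _ _ _)).trans ?_
  exact Nat.mul_le_mul_right _ (Nat.gcd_le_right _ hp)

theorem norm_quadSum_sq_le_of_prime_pow_two_le {p k : ℕ} (hp : p.Prime) [NeZero (p ^ k)]
    (hk : 2 ≤ k) {χ : MulChar (ZMod (p ^ k)) ℂ} (hχ : χ.Nondegenerate) (b₁ b₂ b₃ b₄ : ℤ) :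
    ‖quadSum χ (b₁ : ZMod (p ^ k)) b₂ b₃ b₄‖ ^ 2 ≤ 64 * p ^ k *
      Int.gcd ((b₁ - b₃) * (b₁ - b₄) * (b₂ - b₃) * (b₂ - b₄)) ((p : ℤ) ^ k) := by
  have hp0 : (0 : ℝ) < p := by exact_mod_cast hp.pos
  have hc : ∀ j ≤ k, (#(stationaryPoints p k j b₁ b₂ b₃ b₄) : ℝ) ^ 2 ≤ 16 * (p ^ (k - j)) ^ 2 *
      Int.gcd ((b₁ - b₃) * (b₁ - b₄) * (b₂ - b₃) * (b₂ - b₄)) ((p : ℤ) ^ (2 * j)) :=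
    fun j hj => by exact_mod_cast card_stationaryPoints_sq_le hp (by omega) hj b₁ b₂ b₃ b₄
  have hb := fun i j (hij : i + j = k) (hji : j ≤ i) =>
    norm_quadSum_le_card_stationaryPoints hp hχ hij hji b₁ b₂ b₃ b₄
  have ho := fun hp2 j hk hj => norm_quadSum_le_of_odd_exponent hp hp2 hχ (j := j) hk hj b₁ b₂ b₃ b₄
  set D := (b₁ - b₃) * (b₁ - b₄) * (b₂ - b₃) * (b₂ - b₄) with hD
  rcases Nat.even_or_odd' k with ⟨j, rfl | rfl⟩
  · calc _ ≤ (#(stationaryPoints p (2 * j) j b₁ b₂ b₃ b₄) : ℝ) ^ 2 := by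
          gcongr; exact hb j j (by omega) le_rfl
      _ ≤ _ := hc j (by omega)
      _ ≤ _ := by
        rw [← pow_mul, show (2 * j - j) * 2 = 2 * j by omega]
        gcongr
        norm_num
  · have h1 := hc j (by omega)
    have h2 := hc (j + 1) (by omega)
    rw [show 2 * j + 1 - j = j + 1 by omega] at h1
    rw [show 2 * j + 1 - (j + 1) = j by omega] at h2
    have g1 : (Int.gcd D ((p : ℤ) ^ (2 * j)) : ℝ) ≤ Int.gcd D ((p : ℤ) ^ (2 * j + 1)) := by
      refine Nat.cast_le.2 (Nat.le_of_dvd (Int.gcd_pos_of_ne_zero_right _ ?_)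
        (Int.gcd_dvd_gcd_of_dvd_right _ (pow_dvd_pow _ (by omega))))
      exact pow_ne_zero _ (by exact_mod_cast hp.ne_zero)
    have g2 : (Int.gcd D ((p : ℤ) ^ (2 * (j + 1))) : ℝ) ≤
        p * Int.gcd D ((p : ℤ) ^ (2 * j + 1)) := by
      rw [← Nat.cast_mul]
      exact Nat.cast_le.2 (Int.gcd_pow_succ_le hp.pos D (2 * j + 1))
    set G : ℝ := ((Int.gcd D ((p : ℤ) ^ (2 * j + 1)) : ℕ) : ℝ)
    by_cases hp2 : p = 2
    · calc _ ≤ (#(stationaryPoints p (2 * j + 1) j b₁ b₂ b₃ b₄) : ℝ) ^ 2 := by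
            gcongr; exact hb (j + 1) j (by omega) (by omega)
        _ ≤ _ := h1
        _ ≤ 16 * ((p : ℝ) ^ (j + 1)) ^ 2 * G := by gcongr
        _ = 32 * p ^ (2 * j + 1) * G := by
          have : (p : ℝ) = 2 := by rw [hp2]; norm_num
          rw [this]; ring
        _ ≤ _ := by gcongr; norm_num
    · have h3 := ho hp2 j rfl (by omega)
      set a : ℝ := (#(stationaryPoints p (2 * j + 1) j b₁ b₂ b₃ b₄) : ℝ)
      set c : ℝ := (#(stationaryPoints p (2 * j + 1) (j + 1) b₁ b₂ b₃ b₄) : ℝ)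
      have h4 : (a / Real.sqrt p) ^ 2 ≤ 16 * p ^ (2 * j + 1) * G := by
        rw [div_pow, Real.sq_sqrt hp0.le, div_le_iff₀ hp0]
        calc _ ≤ _ := h1
          _ ≤ 16 * ((p : ℝ) ^ (j + 1)) ^ 2 * G := by gcongr
          _ = _ := by ring
      have h5 : c ^ 2 ≤ 16 * p ^ (2 * j + 1) * G := by
        calc _ ≤ _ := h2
          _ ≤ 16 * ((p : ℝ) ^ j) ^ 2 * (p * G) := by gcongr
          _ = _ := by ring
      calc _ ≤ (a / Real.sqrt p + c) ^ 2 := by gcongr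
        _ ≤ 2 * ((a / Real.sqrt p) ^ 2 + c ^ 2) := add_sq_le
        _ ≤ _ := by linarith

theorem MulChar.Nondegenerate.ne_one_of_prime {p : ℕ} (hp : p.Prime) {χ : MulChar (ZMod p) ℂ}
    (hχ : χ.Nondegenerate) : χ ≠ 1 := by
  rintro rfl
  obtain ⟨w, hw, hw'⟩ := hχ p hp dvd_rfl
  exact hw' (MulChar.one_apply hw)

theorem norm_quadSum_sq_le_of_prime_pow {q p k : ℕ} (hq : q = p ^ k) (hp : p.Prime) (hk : k ≠ 0)
    [NeZero q] {χ : MulChar (ZMod q) ℂ} (hχ : χ.Nondegenerate) (b₁ b₂ b₃ b₄ : ℤ) :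
    ‖quadSum χ (b₁ : ZMod q) b₂ b₃ b₄‖ ^ 2 ≤ 64 * q *
      Int.gcd ((b₁ - b₃) * (b₁ - b₄) * (b₂ - b₃) * (b₂ - b₄)) q *
      Int.gcd (Int.gcd (b₁ - b₂) (b₃ - b₄)) q := by
  have hq0 : (0 : ℤ) < q := by exact_mod_cast NeZero.pos q
  have hpos : ∀ a : ℤ, (1 : ℝ) ≤ Int.gcd a q := fun a => by
    exact_mod_cast Int.gcd_pos_of_ne_zero_right _ hq0.ne'
  rcases Nat.lt_or_ge k 2 with hk2 | hk2
  · obtain rfl : k = 1 := by omega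
    rw [pow_one] at hq
    subst hq
    have : Fact q.Prime := ⟨hp⟩
    have hq1 : (1 : ℝ) ≤ q := by exact_mod_cast hp.one_lt.le
    have htriv := norm_quadSum_le_card χ (b₁ : ZMod q) b₂ b₃ b₄
    rw [ZMod.card] at htriv
    have hgcd : ∀ a : ℤ, (a : ZMod q) = 0 → Int.gcd a q = q := fun a ha => by
      rw [ZMod.intCast_zmod_eq_zero_iff_dvd] at ha
      rw [Int.gcd_eq_natAbs, Int.natAbs_natCast]
      exact Nat.gcd_eq_right (Int.natCast_dvd.1 ha)
    by_cases hD : (((b₁ - b₃) * (b₁ - b₄) * (b₂ - b₃) * (b₂ - b₄) : ℤ) : ZMod q) = 0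
    · rw [hgcd _ hD]
      have := hpos (Int.gcd (b₁ - b₂) (b₃ - b₄))
      calc _ ≤ (q : ℝ) ^ 2 := by gcongr
        _ = 1 * q * q * 1 := by ring
        _ ≤ _ := by gcongr; norm_num
    by_cases hh : ((Int.gcd (b₁ - b₂) (b₃ - b₄) : ℤ) : ZMod q) = 0
    · rw [hgcd _ hh]
      have := hpos ((b₁ - b₃) * (b₁ - b₄) * (b₂ - b₃) * (b₂ - b₄))
      calc _ ≤ (q : ℝ) ^ 2 := by gcongr
        _ = 1 * q * 1 * q := by ring
        _ ≤ _ := by gcongr; norm_num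
    push_cast at hD
    simp only [mul_ne_zero_iff, sub_ne_zero] at hD
    obtain ⟨⟨⟨h₁₃, h₁₄⟩, h₂₃⟩, h₂₄⟩ := hD
    have key := norm_quadSum_le_of_ne (hχ.ne_one_of_prime hp) h₁₃ h₁₄ h₂₃ h₂₄ (by
      by_contra! hcon
      apply hh
      rw [ZMod.intCast_zmod_eq_zero_iff_dvd]
      refine Int.dvd_coe_gcd ?_ ?_ <;> rw [← ZMod.intCast_zmod_eq_zero_iff_dvd] <;> push_cast <;>
        rw [sub_eq_zero]
      exacts [hcon.1, hcon.2])
    have h1 := hpos ((b₁ - b₃) * (b₁ - b₄) * (b₂ - b₃) * (b₂ - b₄))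
    have h2 := hpos (Int.gcd (b₁ - b₂) (b₃ - b₄))
    calc _ ≤ (3 * Real.sqrt q) ^ 2 := by gcongr
      _ = 9 * q * 1 * 1 := by rw [mul_pow, Real.sq_sqrt (by positivity)]; ring
      _ ≤ _ := by gcongr; norm_num
  · subst hq
    refine (norm_quadSum_sq_le_of_prime_pow_two_le hp hk2 hχ b₁ b₂ b₃ b₄).trans ?_
    have h2 := hpos (Int.gcd (b₁ - b₂) (b₃ - b₄))
    push_cast at h2 ⊢
    exact le_mul_of_one_le_right (by positivity) h2

theorem norm_quadSum_sq_le_of_prime_pow_of_eq {q p k : ℕ} (hq : q = p ^ k) (hp : p.Prime)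
    (hk : k ≠ 0) [NeZero q] {χ : MulChar (ZMod q) ℂ} (hχ : χ.Nondegenerate) (b₁ b₂ b₄ : ℤ) :
    ‖quadSum χ (b₁ : ZMod q) b₂ b₁ b₄‖ ^ 2 ≤ 64 * q * Int.gcd (b₂ - b₄) q ^ 4 := by
  have hq0 : (0 : ℤ) < q := by exact_mod_cast NeZero.pos q
  have hpos : ∀ a : ℤ, (1 : ℝ) ≤ Int.gcd a q := fun a => by
    exact_mod_cast Int.gcd_pos_of_ne_zero_right _ hq0.ne'
  have htriv := norm_quadSum_le_card χ (b₁ : ZMod q) b₂ b₁ b₄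
  rw [ZMod.card] at htriv
  have hpow : ∀ j, j ≤ k → k ≤ 4 * j → (p : ℤ) ^ j ∣ b₂ - b₄ →
      ‖quadSum χ (b₁ : ZMod q) b₂ b₁ b₄‖ ^ 2 ≤ 64 * q * Int.gcd (b₂ - b₄) q ^ 4 := by
    intro j hjk hkj hd
    have h1 : p ^ j ∣ Int.gcd (b₂ - b₄) q := by
      have : (p : ℤ) ^ j ∣ q := by rw [hq]; push_cast; exact pow_dvd_pow _ hjk
      exact_mod_cast Int.dvd_coe_gcd hd this
    have h2 : p ^ j ≤ Int.gcd (b₂ - b₄) q :=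
      Nat.le_of_dvd (Int.gcd_pos_of_ne_zero_right _ hq0.ne') h1
    have h3 : q ≤ Int.gcd (b₂ - b₄) q ^ 4 := by
      calc q ≤ p ^ (4 * j) := by rw [hq]; exact Nat.pow_le_pow_right hp.pos hkj
        _ = (p ^ j) ^ 4 := by rw [← pow_mul, mul_comm]
        _ ≤ _ := Nat.pow_le_pow_left h2 4
    have h4 : (q : ℝ) ≤ Int.gcd (b₂ - b₄) q ^ 4 := by exact_mod_cast h3
    calc _ ≤ (q : ℝ) ^ 2 := by gcongr
      _ = 1 * q * q := by ring
      _ ≤ _ := by gcongr; norm_num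
  rcases Nat.lt_or_ge k 2 with hk2 | hk2
  · obtain rfl : k = 1 := by omega
    by_cases hd : (p : ℤ) ^ 1 ∣ b₂ - b₄
    · exact hpow 1 le_rfl (by norm_num) hd
    rw [pow_one] at hq hd
    subst hq
    have : Fact q.Prime := ⟨hp⟩
    have hq1 : (1 : ℝ) ≤ q := by exact_mod_cast hp.one_lt.le
    have key := norm_quadSum_le_two (hχ.ne_one_of_prime hp) (b₁ := b₁) (b₂ := b₂) (b₄ := b₄)
      (by rwa [Ne, ← sub_eq_zero, ← Int.cast_sub, ZMod.intCast_zmod_eq_zero_iff_dvd])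
    have := one_le_pow₀ (hpos (b₂ - b₄)) (n := 4)
    calc _ ≤ (2 : ℝ) ^ 2 := by gcongr
      _ = 4 * 1 * 1 := by norm_num
      _ ≤ _ := by gcongr; norm_num
  · by_cases hd : (p : ℤ) ^ (k / 2) ∣ b₂ - b₄
    · exact hpow _ (by omega) (by omega) hd
    subst hq
    have h1 := norm_quadSum_le_card_stationaryPoints hp hχ (i := k - k / 2) (j := k / 2) (by omega)
      (by omega) b₁ b₂ b₁ b₄
    have h2 : stationaryPoints p k (k / 2) b₁ b₂ b₁ b₄ = ∅ := by
      classical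
      rw [stationaryPoints, filter_eq_empty_iff]
      rintro x - ⟨⟨h1, h2, h3, h4⟩, h⟩
      rw [sub_self, zero_mul, add_zero, (h1.mul h1).dvd_mul_right, ← Int.cast_sub,
        ZMod.pow_dvd_intCast_iff (by omega)] at h
      exact hd h
    rw [h2, card_empty, Nat.cast_zero] at h1
    have h3 : ‖quadSum χ (b₁ : ZMod (p ^ k)) b₂ b₁ b₄‖ = 0 := le_antisymm h1 (norm_nonneg _)
    rw [h3, zero_pow two_ne_zero]
    positivity

end

section

open Finset

variable {R S T : Type*} [CommRing R] [CommRing S] [CommRing T]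

/-- The first component of a multiplicative character of a ring that splits as a product. -/
noncomputable def MulChar.fstComponent (χ : MulChar R ℂ) (e : R ≃+* S × T) : MulChar S ℂ where
  toFun x := χ (e.symm (x, 1))
  map_one' := by rw [← Prod.one_eq_mk, map_one, map_one]
  map_mul' x y := by rw [← map_mul, ← map_mul, Prod.mk_mul_mk, one_mul]
  map_nonunit' x hx := by
    refine χ.map_nonunit fun h => hx ?_
    have := h.map e
    rw [e.apply_symm_apply, Prod.isUnit_iff] at this
    exact this.1

theorem MulChar.fstComponent_apply (χ : MulChar R ℂ) (e : R ≃+* S × T) (x : S) :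
    χ.fstComponent e x = χ (e.symm (x, 1)) := rfl

theorem MulChar.fstComponent_mul (χ ψ : MulChar R ℂ) (e : R ≃+* S × T) :
    (χ * ψ).fstComponent e = χ.fstComponent e * ψ.fstComponent e := by
  ext x
  simp [fstComponent_apply, MulChar.mul_apply]

theorem MulChar.fstComponent_inv (χ : MulChar R ℂ) (e : R ≃+* S × T) :
    χ⁻¹.fstComponent e = (χ.fstComponent e)⁻¹ := by
  rw [eq_inv_iff_mul_eq_one, ← fstComponent_mul, inv_mul_cancel]
  ext x
  rw [MulChar.one_apply_coe, fstComponent_apply, MulChar.one_apply]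
  have : IsUnit ((x : S), (1 : T)) := Prod.isUnit_iff.2 ⟨x.isUnit, isUnit_one⟩
  exact this.map e.symm

theorem MulChar.apply_eq_fstComponent_mul (χ : MulChar R ℂ) (e : R ≃+* S × T) (y : R) :
    χ y = χ.fstComponent e (e y).1 *
      χ.fstComponent (e.trans RingEquiv.prodComm) (e y).2 := by
  rw [fstComponent_apply, fstComponent_apply, ← map_mul]
  congr 1
  rw [← e.symm_apply_apply y]
  simp only [RingEquiv.symm_trans_apply, ← map_mul, e.apply_symm_apply]
  congr 1
  ext <;> simp

theorem quadSum_eq_mul [Fintype R] [Fintype S] [Fintype T] (χ : MulChar R ℂ) (e : R ≃+* S × T)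
    (b₁ b₂ b₃ b₄ : ℤ) :
    quadSum χ (b₁ : R) b₂ b₃ b₄ = quadSum (χ.fstComponent e) (b₁ : S) b₂ b₃ b₄ *
      quadSum (χ.fstComponent (e.trans RingEquiv.prodComm)) (b₁ : T) b₂ b₃ b₄ := by
  simp only [quadSum]
  rw [← e.symm.toEquiv.sum_comp, Fintype.sum_prod_type, Finset.sum_mul_sum]
  refine sum_congr rfl fun x _ => sum_congr rfl fun y _ => ?_
  simp only [quadChar, ← MulChar.fstComponent_inv]
  have key : ∀ (χ : MulChar R ℂ) (b : ℤ), χ (e.symm (x, y) + b) = χ.fstComponent e (x + b) *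
      χ.fstComponent (e.trans RingEquiv.prodComm) (y + b) := fun χ b => by
    rw [χ.apply_eq_fstComponent_mul e]
    simp
  simp only [RingEquiv.toEquiv_eq_coe, EquivLike.coe_coe, key]
  ring

theorem MulChar.Nondegenerate.fstComponent {q a b : ℕ} {χ : MulChar (ZMod q) ℂ}
    (hχ : χ.Nondegenerate) (hq : q = a * b) (e : ZMod q ≃+* ZMod a × ZMod b) :
    (χ.fstComponent e).Nondegenerate := by
  intro p hp hpa
  obtain ⟨w, hw, hw'⟩ := hχ p hp (hq ▸ hpa.mul_right b)
  have h1 : q / p = a / p * b := by rw [hq, Nat.div_mul_right_comm hpa]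
  have h2 : e (1 + ((q / p : ℕ) : ZMod q) * w) =
      (1 + ((a / p : ℕ) : ZMod a) * ((b : ZMod a) * (e w).1), 1) := by
    rw [map_add, map_mul, map_one, map_natCast, h1]
    ext
    · simp [mul_assoc]
    · simp
  refine ⟨(b : ZMod a) * (e w).1, ?_, ?_⟩
  · have := hw.map e
    rw [h2, Prod.isUnit_iff] at this
    exact this.1
  · rwa [fstComponent_apply, ← h2, e.symm_apply_apply]

theorem norm_quadSum_sq_le_of_multiplicative {b₁ b₂ b₃ b₄ : ℤ} {F : ℕ → ℝ} (hF₁ : F 1 = 1)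
    (hF : ∀ q, 0 ≤ F q) (hmul : ∀ a b : ℕ, a.Coprime b → F (a * b) = F a * F b)
    (hprime : ∀ p k : ℕ, p.Prime → k ≠ 0 → ∀ (_ : NeZero (p ^ k)) (χ : MulChar (ZMod (p ^ k)) ℂ),
      χ.Nondegenerate → ‖quadSum χ (b₁ : ZMod (p ^ k)) b₂ b₃ b₄‖ ^ 2 ≤ F (p ^ k)) (q : ℕ) :
    ∀ (_ : NeZero q) (χ : MulChar (ZMod q) ℂ), χ.Nondegenerate →
      ‖quadSum χ (b₁ : ZMod q) b₂ b₃ b₄‖ ^ 2 ≤ F q := by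
  induction q using Nat.recOnPosPrimePosCoprime with
  | prime_pow p k hp hk => exact hprime p k hp hk.ne'
  | zero => exact fun h => absurd rfl h.ne
  | one =>
    intro _ χ _
    have := norm_quadSum_le_card χ (b₁ : ZMod 1) b₂ b₃ b₄
    rw [ZMod.card, Nat.cast_one] at this
    rw [hF₁]
    exact pow_le_one₀ (norm_nonneg _) this
  | coprime a b ha hb hab iha ihb =>
    intro _ χ hχ
    have : NeZero a := ⟨by omega⟩
    have : NeZero b := ⟨by omega⟩
    let e := ZMod.chineseRemainder hab
    rw [quadSum_eq_mul χ e, norm_mul, mul_pow, hmul a b hab]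
    exact mul_le_mul (iha _ _ (hχ.fstComponent rfl e)) (ihb _ _ (hχ.fstComponent (mul_comm a b) _))
      (sq_nonneg _) (hF a)

theorem Int.gcd_mul_of_coprime (n : ℤ) {a b : ℕ} (hab : a.Coprime b) :
    Int.gcd n (a * b) = Int.gcd n a * Int.gcd n b := by
  simp only [Int.gcd_eq_natAbs, Int.natAbs_mul, Int.natAbs_natCast]
  exact hab.gcd_mul _

theorem Nat.sixty_four_le_card_divisors_pow {p k : ℕ} (hp : p.Prime) (hk : k ≠ 0) :
    (64 : ℝ) ≤ (#(p ^ k).divisors : ℝ) ^ 6 := by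
  rw [Nat.divisors_prime_pow hp, card_map, card_range]
  have : (2 : ℝ) ≤ ((k + 1 : ℕ) : ℝ) := by exact_mod_cast Nat.succ_le_succ (Nat.pos_of_ne_zero hk)
  calc (64 : ℝ) = 2 ^ 6 := by norm_num
    _ ≤ _ := by gcongr

theorem norm_quadSum_sq_le {q : ℕ} [NeZero q] {χ : MulChar (ZMod q) ℂ} (hχ : χ.Nondegenerate)
    (b₁ b₂ b₃ b₄ : ℤ) :
    ‖quadSum χ (b₁ : ZMod q) b₂ b₃ b₄‖ ^ 2 ≤ (#q.divisors : ℝ) ^ 6 * q *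
      Int.gcd ((b₁ - b₃) * (b₁ - b₄) * (b₂ - b₃) * (b₂ - b₄)) q *
      Int.gcd (Int.gcd (b₁ - b₂) (b₃ - b₄)) q := by
  refine norm_quadSum_sq_le_of_multiplicative (F := fun q => (#q.divisors : ℝ) ^ 6 * q *
      Int.gcd ((b₁ - b₃) * (b₁ - b₄) * (b₂ - b₃) * (b₂ - b₄)) q *
      Int.gcd (Int.gcd (b₁ - b₂) (b₃ - b₄)) q) (by simp) (fun q => by positivity) ?_ ?_ q _ χ hχ
  · intro a b hab
    simp only [hab.card_divisors_mul, Nat.cast_mul, Int.gcd_mul_of_coprime _ hab]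
    ring
  · intro p k hp hk _ χ hχ
    refine (norm_quadSum_sq_le_of_prime_pow rfl hp hk hχ b₁ b₂ b₃ b₄).trans ?_
    have := Nat.sixty_four_le_card_divisors_pow hp hk
    gcongr

theorem norm_quadSum_sq_le_of_eq {q : ℕ} [NeZero q] {χ : MulChar (ZMod q) ℂ}
    (hχ : χ.Nondegenerate) (b₁ b₂ b₄ : ℤ) :
    ‖quadSum χ (b₁ : ZMod q) b₂ b₁ b₄‖ ^ 2 ≤
      (#q.divisors : ℝ) ^ 6 * q * Int.gcd (b₂ - b₄) q ^ 4 := by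
  refine norm_quadSum_sq_le_of_multiplicative (F := fun q => (#q.divisors : ℝ) ^ 6 * q *
      Int.gcd (b₂ - b₄) q ^ 4) (by simp) (fun q => by positivity) ?_ ?_ q _ χ hχ
  · intro a b hab
    simp only [hab.card_divisors_mul, Nat.cast_mul, Int.gcd_mul_of_coprime _ hab]
    ring
  · intro p k hp hk _ χ hχ
    refine (norm_quadSum_sq_le_of_prime_pow_of_eq rfl hp hk hχ b₁ b₂ b₄).trans ?_
    have := Nat.sixty_four_le_card_divisors_pow hp hk
    gcongr

/-- Primitive Dirichlet characters are nondegenerate. -/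
theorem DirichletCharacter.IsPrimitive.nondegenerate {q : ℕ} [NeZero q]
    {χ : DirichletCharacter ℂ q} (hχ : χ.IsPrimitive) : MulChar.Nondegenerate χ := by
  intro p hp hpq
  by_contra! hcon
  have hdvd : q / p ∣ q := Nat.div_dvd_of_dvd hpq
  have hfac : χ.FactorsThrough (q / p) := by
    rw [DirichletCharacter.factorsThrough_iff_ker_unitsMap hdvd]
    intro u hu
    rw [MonoidHom.mem_ker] at hu ⊢
    have h1 : ((u : ZMod q).val : ZMod (q / p)) = ((1 : ℕ) : ZMod (q / p)) := by
      have := congrArg Units.val hu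
      rw [ZMod.unitsMap_val, Units.val_one] at this
      rw [ZMod.natCast_val, this, Nat.cast_one]
    have h2 : ((q / p : ℕ) : ℤ) ∣ ((u : ZMod q).val : ℤ) - 1 := by
      rw [← ZMod.intCast_zmod_eq_zero_iff_dvd]
      push_cast
      rw [h1]; simp
    obtain ⟨w, hw⟩ := h2
    have h3 : (u : ZMod q) = 1 + ((q / p : ℕ) : ZMod q) * (w : ZMod q) := by
      have : (((u : ZMod q).val : ℤ) : ZMod q) = ((1 + ((q / p : ℕ) : ℤ) * w : ℤ) : ZMod q) := by
        rw [← hw]; congr 1; ring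
      simpa only [Int.cast_natCast, ZMod.natCast_zmod_val, Int.cast_add, Int.cast_mul,
        Int.cast_one] using this
    have h4 := hcon w (h3 ▸ u.isUnit)
    rw [← h3] at h4
    ext
    simpa using h4
  have h5 : χ.conductor ≤ q / p := Nat.sInf_le hfac
  rw [hχ] at h5
  exact absurd (Nat.div_lt_self (NeZero.pos q) hp.one_lt) (by omega)

end

section

open Finset

theorem sum_sum_mul_mul_le {ι : Type*} (I : Finset ι) {f g : ι → ι → ℝ} {w : ι × ι → ℝ}
    {X Y W : ℝ} (hg : ∀ a b, 0 ≤ g a b) (hw : ∀ p, 0 ≤ w p)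
    (hX : ∀ a ∈ I, ∑ b ∈ I, f a b ≤ X) (hY : ∀ a ∈ I, ∑ b ∈ I, g a b ≤ Y)
    (hW : ∑ p ∈ I ×ˢ I, w p ≤ W) (hX0 : 0 ≤ X) (hY0 : 0 ≤ Y) :
    ∑ p ∈ I ×ˢ I, ∑ r ∈ I ×ˢ I, w p * (f p.1 r.1 * g p.2 r.2) ≤ W * (X * Y) := by
  calc _ = ∑ p ∈ I ×ˢ I, w p * ((∑ a ∈ I, f p.1 a) * ∑ b ∈ I, g p.2 b) := by
        refine sum_congr rfl fun p _ => ?_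
        rw [← mul_sum, sum_product, sum_mul_sum]
    _ ≤ ∑ p ∈ I ×ˢ I, w p * (X * Y) := by
        refine sum_le_sum fun p hp => ?_
        rw [mem_product] at hp
        exact mul_le_mul_of_nonneg_left (mul_le_mul (hX _ hp.1) (hY _ hp.2)
          (sum_nonneg fun _ _ => hg _ _) hX0) (hw p)
    _ ≤ _ := by rw [← sum_mul]; exact mul_le_mul_of_nonneg_right hW (by positivity)

theorem sum_sum_mul_mul_le' {ι : Type*} (I : Finset ι) {f g : ι → ι → ℝ} {w : ι × ι → ℝ}
    {X Y W : ℝ} (hg : ∀ a b, 0 ≤ g a b) (hw : ∀ p, 0 ≤ w p)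
    (hX : ∀ a ∈ I, ∑ b ∈ I, f a b ≤ X) (hY : ∀ a ∈ I, ∑ b ∈ I, g a b ≤ Y)
    (hW : ∑ p ∈ I ×ˢ I, w p ≤ W) (hX0 : 0 ≤ X) (hY0 : 0 ≤ Y) :
    ∑ p ∈ I ×ˢ I, ∑ r ∈ I ×ˢ I, w p * (f p.1 r.2 * g p.2 r.1) ≤ W * (X * Y) := by
  refine le_of_eq_of_le (sum_congr rfl fun p _ => ?_) (sum_sum_mul_mul_le I hg hw hX hY hW hX0 hY0)
  rw [sum_product, sum_comm, ← sum_product']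

/-- `gcd (a - b, q)` off the diagonal, and `0` on it. -/
noncomputable def gcdOff (q a b : ℕ) : ℝ := if a = b then 0 else Int.gcd ((a : ℤ) - b) q

theorem gcdOff_nonneg (q a b : ℕ) : 0 ≤ gcdOff q a b := by
  unfold gcdOff; split_ifs <;> positivity

theorem gcdOff_comm (q a b : ℕ) : gcdOff q a b = gcdOff q b a := by
  unfold gcdOff
  rw [← Int.neg_gcd, neg_sub]
  simp only [eq_comm]

theorem gcdOff_of_ne (q : ℕ) {a b : ℕ} (h : a ≠ b) : gcdOff q a b = Int.gcd ((a : ℤ) - b) q :=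
  if_neg h

theorem gcdOff_le (q : ℕ) {a b B : ℕ} (ha : a < B) (hb : b < B) : gcdOff q a b ≤ B := by
  unfold gcdOff
  split_ifs with h
  · positivity
  · have h1 : Int.gcd ((a : ℤ) - b) q ∣ ((a : ℤ) - b).natAbs := Int.gcd_dvd_natAbs_left _ _
    have h2 := Nat.le_of_dvd (by omega) h1
    exact_mod_cast h2.trans (by omega)

theorem sum_gcdOff_le {q : ℕ} (hq : q ≠ 0) {a B : ℕ} (ha : a ∈ range B) :
    ∑ b ∈ range B, gcdOff q a b ≤ B * #q.divisors := by
  have h1 : ∀ b, gcdOff q a b ≤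
      ∑ d ∈ q.divisors, if b ≠ a ∧ b ≡ a [MOD d] then (d : ℝ) else 0 := fun b => by
    unfold gcdOff
    split_ifs with h
    · exact sum_nonneg fun d _ => by split_ifs <;> positivity
    · set d := Int.gcd ((a : ℤ) - b) q
      have hd : d ∈ q.divisors := by
        rw [Nat.mem_divisors]
        exact ⟨Int.natCast_dvd_natCast.1 (Int.gcd_dvd_right _ _), hq⟩
      refine le_trans ?_ (single_le_sum (fun d _ => ?_) hd)
      · rw [if_pos]
        exact ⟨Ne.symm h, (Nat.modEq_iff_dvd).2 (Int.gcd_dvd_left _ _)⟩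
      · split_ifs <;> positivity
  calc _ ≤ ∑ b ∈ range B, ∑ d ∈ q.divisors, if b ≠ a ∧ b ≡ a [MOD d] then (d : ℝ) else 0 :=
        sum_le_sum fun b _ => h1 b
    _ = ∑ d ∈ q.divisors, (#{b ∈ range B | b ≠ a ∧ b ≡ a [MOD d]} : ℝ) * d := by
        rw [sum_comm]
        refine sum_congr rfl fun d _ => ?_
        rw [← sum_filter, sum_const, nsmul_eq_mul]
    _ ≤ ∑ d ∈ q.divisors, (B : ℝ) := by
        refine sum_le_sum fun d hd => ?_
        have hd0 : 0 < d := Nat.pos_of_mem_divisors hd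
        have h2 : #{b ∈ range B | b ≠ a ∧ b ≡ a [MOD d]} ≤ B / d := by
          have e : ({b ∈ range B | b ≠ a ∧ b ≡ a [MOD d]} : Finset ℕ) =
              ({b ∈ range B | b ≡ a [MOD d]} : Finset ℕ).erase a := by
            ext b; simp; tauto
          have h3 := Nat.count_modEq_card B hd0 a
          rw [Nat.count_eq_card_filter_range] at h3
          have h4 : a ∈ ({b ∈ range B | b ≡ a [MOD d]} : Finset ℕ) := mem_filter.2 ⟨ha, rfl⟩
          rw [e, card_erase_of_mem h4, h3]
          generalize B / d = e
          split_ifs <;> omega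
        have h3 := (Nat.mul_le_mul_right d h2).trans (Nat.div_mul_le_self B d)
        exact_mod_cast h3
    _ = _ := by rw [sum_const, nsmul_eq_mul, mul_comm]

theorem Int.gcd_mul_le (a b : ℤ) {q : ℕ} (hq : q ≠ 0) :
    Int.gcd (a * b) q ≤ Int.gcd a q * Int.gcd b q := by
  simp only [Int.gcd_eq_natAbs, Int.natAbs_mul, Int.natAbs_natCast]
  exact Nat.le_of_dvd (Nat.mul_pos (Nat.gcd_pos_of_pos_right _ (by omega))
    (Nat.gcd_pos_of_pos_right _ (by omega))) (Nat.gcd_mul_left_dvd_mul_gcd _ _ _)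

end

section

open Finset

/-- The indicator function of the diagonal. -/
def diagInd (a b : ℕ) : ℝ := if a = b then 1 else 0

theorem diagInd_nonneg (a b : ℕ) : 0 ≤ diagInd a b := by unfold diagInd; split_ifs <;> norm_num

theorem diagInd_self (a : ℕ) : diagInd a a = 1 := if_pos rfl

theorem diagInd_of_ne {a b : ℕ} (h : a ≠ b) : diagInd a b = 0 := if_neg h

theorem norm_quadSum_le_of_fst_eq {q : ℕ} [NeZero q] {χ : MulChar (ZMod q) ℂ}
    (hχ : χ.Nondegenerate) {b₁ b₃ : ℕ} (h₁₃ : b₁ = b₃) (b₂ b₄ : ℕ) :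
    ‖quadSum χ (b₁ : ZMod q) b₂ b₃ b₄‖ ≤ q * (diagInd b₁ b₃ * diagInd b₂ b₄) +
      (#q.divisors : ℝ) ^ 3 * √q * (diagInd b₁ b₃ * gcdOff q b₂ b₄ ^ 2) := by
  subst h₁₃
  rw [diagInd_self, one_mul, one_mul]
  by_cases h : b₂ = b₄
  · rw [h, diagInd_self]
    have := norm_quadSum_le_card χ (b₁ : ZMod q) b₄ b₁ b₄
    rw [ZMod.card] at this
    have h2 := gcdOff_nonneg q b₄ b₄
    calc _ ≤ (q : ℝ) * 1 + 0 := by simpa using this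
      _ ≤ _ := by gcongr; positivity
  · rw [diagInd_of_ne h, mul_zero, zero_add, gcdOff_of_ne q h]
    have key := norm_quadSum_sq_le_of_eq hχ b₁ b₂ b₄
    push_cast at key
    refine abs_le_of_sq_le_sq' ?_ (by positivity) |>.2
    refine key.trans_eq ?_
    rw [mul_pow, mul_pow, Real.sq_sqrt (by positivity)]
    ring

theorem norm_quadSum_le_of_forall_ne {q : ℕ} [NeZero q] {χ : MulChar (ZMod q) ℂ}
    (hχ : χ.Nondegenerate) {b₁ b₂ b₃ b₄ : ℕ} (h₁₃ : b₁ ≠ b₃) (h₁₄ : b₁ ≠ b₄) (h₂₃ : b₂ ≠ b₃)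
    (h₂₄ : b₂ ≠ b₄) (h : ¬ (b₁ = b₂ ∧ b₃ = b₄)) :
    ‖quadSum χ (b₁ : ZMod q) b₂ b₃ b₄‖ ≤ (#q.divisors : ℝ) ^ 3 * √q *
      ((gcdOff q b₁ b₂ + gcdOff q b₃ b₄) *
        (gcdOff q b₁ b₃ * gcdOff q b₂ b₄ + gcdOff q b₁ b₄ * gcdOff q b₂ b₃)) := by
  have hq : q ≠ 0 := NeZero.ne q
  have hq' : (q : ℤ) ≠ 0 := by exact_mod_cast hq
  have key := norm_quadSum_sq_le hχ b₁ b₂ b₃ b₄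
  push_cast at key
  set g : ℕ := Int.gcd (Int.gcd ((b₁ : ℤ) - b₂) (b₃ - b₄)) q with hg
  set D : ℕ := Int.gcd (((b₁ : ℤ) - b₃) * (b₁ - b₄) * (b₂ - b₃) * (b₂ - b₄)) q with hD
  have hD1 : (D : ℝ) ≤ gcdOff q b₁ b₃ * gcdOff q b₁ b₄ * gcdOff q b₂ b₃ * gcdOff q b₂ b₄ := by
    rw [gcdOff_of_ne q h₁₃, gcdOff_of_ne q h₁₄, gcdOff_of_ne q h₂₃, gcdOff_of_ne q h₂₄]
    rw [← Nat.cast_mul, ← Nat.cast_mul, ← Nat.cast_mul]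
    refine Nat.cast_le.2 ?_
    refine (Int.gcd_mul_le _ _ hq).trans (Nat.mul_le_mul_right _ ?_)
    refine (Int.gcd_mul_le _ _ hq).trans (Nat.mul_le_mul_right _ ?_)
    exact Int.gcd_mul_le _ _ hq
  have hg0 : 0 < g := Int.gcd_pos_of_ne_zero_right _ hq'
  have hg1 : (g : ℝ) ≤ gcdOff q b₁ b₂ + gcdOff q b₃ b₄ := by
    have hle : ∀ x : ℤ, ((Int.gcd ((b₁ : ℤ) - b₂) (b₃ - b₄) : ℕ) : ℤ) ∣ x → g ≤ Int.gcd x q :=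
      fun x hx => Nat.le_of_dvd (Int.gcd_pos_of_ne_zero_right _ hq')
        (Int.gcd_dvd_gcd_of_dvd_left _ hx)
    by_cases h12 : b₁ = b₂
    · have h34 : b₃ ≠ b₄ := fun h34 => h ⟨h12, h34⟩
      rw [gcdOff_of_ne q h34]
      have := hle _ (Int.gcd_dvd_right _ _)
      have h5 := gcdOff_nonneg q b₁ b₂
      have : (g : ℝ) ≤ Int.gcd ((b₃ : ℤ) - b₄) q := Nat.cast_le.2 this
      linarith
    · rw [gcdOff_of_ne q h12]
      have := hle _ (Int.gcd_dvd_left _ _)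
      have h5 := gcdOff_nonneg q b₃ b₄
      have : (g : ℝ) ≤ Int.gcd ((b₁ : ℤ) - b₂) q := Nat.cast_le.2 this
      linarith
  have hg2 : (1 : ℝ) ≤ g := by exact_mod_cast hg0
  have n₁ := gcdOff_nonneg q b₁ b₂
  have n₂ := gcdOff_nonneg q b₃ b₄
  have n₃ := gcdOff_nonneg q b₁ b₃
  have n₄ := gcdOff_nonneg q b₂ b₄
  have n₅ := gcdOff_nonneg q b₁ b₄
  have n₆ := gcdOff_nonneg q b₂ b₃
  refine abs_le_of_sq_le_sq' ?_ (by positivity) |>.2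
  rw [mul_pow, mul_pow, mul_pow, Real.sq_sqrt (by positivity), ← pow_mul]
  refine key.trans ?_
  rw [mul_assoc _ (D : ℝ), mul_comm (D : ℝ)]
  refine mul_le_mul_of_nonneg_left (mul_le_mul ?_ ?_ (by positivity) (by positivity))
    (by positivity)
  · nlinarith
  · refine hD1.trans ?_
    nlinarith [sq_nonneg (gcdOff q b₁ b₃ * gcdOff q b₂ b₄ - gcdOff q b₁ b₄ * gcdOff q b₂ b₃),
      sq_nonneg (gcdOff q b₁ b₃ * gcdOff q b₂ b₄), sq_nonneg (gcdOff q b₁ b₄ * gcdOff q b₂ b₃)]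

theorem norm_quadSum_le {q : ℕ} [NeZero q] {χ : MulChar (ZMod q) ℂ}
    (hχ : χ.Nondegenerate) (b₁ b₂ b₃ b₄ : ℕ) :
    ‖quadSum χ (b₁ : ZMod q) b₂ b₃ b₄‖ ≤
      q * (diagInd b₁ b₃ * diagInd b₂ b₄ + diagInd b₁ b₄ * diagInd b₂ b₃ +
          diagInd b₁ b₂ * diagInd b₃ b₄) +
      (#q.divisors : ℝ) ^ 3 * √q * (diagInd b₁ b₃ * gcdOff q b₂ b₄ ^ 2 +
        gcdOff q b₁ b₃ ^ 2 * diagInd b₂ b₄ + diagInd b₁ b₄ * gcdOff q b₂ b₃ ^ 2 +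
        gcdOff q b₁ b₄ ^ 2 * diagInd b₂ b₃) +
      (#q.divisors : ℝ) ^ 3 * √q * ((gcdOff q b₁ b₂ + gcdOff q b₃ b₄) *
        (gcdOff q b₁ b₃ * gcdOff q b₂ b₄ + gcdOff q b₁ b₄ * gcdOff q b₂ b₃)) := by
  have n := gcdOff_nonneg q
  have m := diagInd_nonneg
  have hq : (0 : ℝ) ≤ q := by positivity
  set u := (#q.divisors : ℝ) ^ 3 * √q with hu
  have hu0 : 0 ≤ u := by positivity
  have d₁ := mul_nonneg hq (mul_nonneg (m b₁ b₃) (m b₂ b₄))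
  have d₂ := mul_nonneg hq (mul_nonneg (m b₁ b₄) (m b₂ b₃))
  have d₃ := mul_nonneg hq (mul_nonneg (m b₁ b₂) (m b₃ b₄))
  have e₁ := mul_nonneg hu0 (mul_nonneg (m b₁ b₃) (sq_nonneg (gcdOff q b₂ b₄)))
  have e₂ := mul_nonneg hu0 (mul_nonneg (m b₂ b₄) (sq_nonneg (gcdOff q b₁ b₃)))
  have e₃ := mul_nonneg hu0 (mul_nonneg (m b₁ b₄) (sq_nonneg (gcdOff q b₂ b₃)))
  have e₄ := mul_nonneg hu0 (mul_nonneg (m b₂ b₃) (sq_nonneg (gcdOff q b₁ b₄)))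
  have f := mul_nonneg hu0 (mul_nonneg (add_nonneg (n b₁ b₂) (n b₃ b₄))
    (add_nonneg (mul_nonneg (n b₁ b₃) (n b₂ b₄)) (mul_nonneg (n b₁ b₄) (n b₂ b₃))))
  by_cases h₁₃ : b₁ = b₃
  · linarith [norm_quadSum_le_of_fst_eq hχ h₁₃ b₂ b₄]
  by_cases h₁₄ : b₁ = b₄
  · have := norm_quadSum_le_of_fst_eq hχ h₁₄ b₂ b₃
    rw [quadSum_swap_right] at this
    linarith
  by_cases h₂₃ : b₂ = b₃
  · have := norm_quadSum_le_of_fst_eq hχ h₂₃ b₁ b₄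
    rw [quadSum_swap_left] at this
    linarith
  by_cases h₂₄ : b₂ = b₄
  · have := norm_quadSum_le_of_fst_eq hχ h₂₄ b₁ b₃
    rw [quadSum_swap_left, quadSum_swap_right] at this
    linarith
  by_cases h : b₁ = b₂ ∧ b₃ = b₄
  · have := norm_quadSum_le_card χ (b₁ : ZMod q) b₂ b₃ b₄
    rw [ZMod.card] at this
    have h1 : (q : ℝ) = q * (diagInd b₁ b₂ * diagInd b₃ b₄) := by
      rw [h.1, h.2, diagInd_self, diagInd_self]; ring
    linarith
  · linarith [norm_quadSum_le_of_forall_ne hχ h₁₃ h₁₄ h₂₃ h₂₄ h]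

theorem sum_range_diagInd_le {B a : ℕ} (ha : a ∈ range B) : ∑ b ∈ range B, diagInd a b ≤ 1 := by
  simp only [diagInd]
  rw [sum_ite_eq, if_pos ha]

theorem sum_gcdOff_sq_le {q : ℕ} (hq : q ≠ 0) {a B : ℕ} (ha : a ∈ range B) :
    ∑ b ∈ range B, gcdOff q a b ^ 2 ≤ B * (B * #q.divisors) := by
  refine le_trans ?_ (mul_le_mul_of_nonneg_left (sum_gcdOff_le hq ha) (Nat.cast_nonneg B))
  rw [mul_sum]
  refine sum_le_sum fun b hb => ?_
  rw [sq]
  exact mul_le_mul_of_nonneg_right (gcdOff_le q (mem_range.1 ha) (mem_range.1 hb))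
    (gcdOff_nonneg q a b)

theorem sum_norm_quadSum_le {q : ℕ} [NeZero q] {χ : MulChar (ZMod q) ℂ}
    (hχ : χ.Nondegenerate) (B : ℕ) :
    ∑ p ∈ range B ×ˢ range B, ∑ r ∈ range B ×ˢ range B,
      ‖quadSum χ (p.1 : ZMod q) p.2 r.1 r.2‖ ≤
      8 * (#q.divisors : ℝ) ^ 6 * (q * B ^ 2 + √q * B ^ 4) := by
  have hq : q ≠ 0 := NeZero.ne q
  have ht : (1 : ℝ) ≤ #q.divisors := by
    exact_mod_cast card_pos.2 (Nat.nonempty_divisors.2 hq)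
  set t : ℝ := (#q.divisors : ℝ)
  have n := gcdOff_nonneg q
  have n2 : ∀ a b, 0 ≤ gcdOff q a b ^ 2 := fun a b => sq_nonneg _
  have m := diagInd_nonneg
  have rd : ∀ a ∈ range B, ∑ b ∈ range B, diagInd a b ≤ 1 := fun a ha => sum_range_diagInd_le ha
  have rg : ∀ a ∈ range B, ∑ b ∈ range B, gcdOff q a b ≤ B * t := fun a ha => sum_gcdOff_le hq ha
  have rg2 : ∀ a ∈ range B, ∑ b ∈ range B, gcdOff q a b ^ 2 ≤ B * (B * t) :=
    fun a ha => sum_gcdOff_sq_le hq ha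
  have w1 : ∑ _p ∈ range B ×ˢ range B, (1 : ℝ) ≤ B * B := by simp
  have wd : ∑ p ∈ range B ×ˢ range B, diagInd p.1 p.2 ≤ B := by
    rw [sum_product]; exact (sum_le_sum fun a ha => rd a ha).trans_eq (by simp)
  have wg : ∑ p ∈ range B ×ˢ range B, gcdOff q p.1 p.2 ≤ B * (B * t) := by
    rw [sum_product]; exact (sum_le_sum fun a ha => rg a ha).trans_eq (by simp)
  have hBt : 0 ≤ B * t := by positivity
  have hBt2 : 0 ≤ B * (B * t) := by positivity
  have a₁ := sum_sum_mul_mul_le (range B) m (fun _ => zero_le_one) rd rd w1 zero_le_one zero_le_one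
  have a₂ := sum_sum_mul_mul_le' (range B) m (fun _ => zero_le_one) rd rd w1 zero_le_one
    zero_le_one
  have a₃ : ∑ p ∈ range B ×ˢ range B, ∑ r ∈ range B ×ˢ range B,
      diagInd p.1 p.2 * diagInd r.1 r.2 ≤ (B : ℝ) * B := by
    rw [← sum_mul_sum]
    exact mul_le_mul wd wd (sum_nonneg fun _ _ => m _ _) (Nat.cast_nonneg B)
  have b₁ := sum_sum_mul_mul_le (range B) n2 (fun _ => zero_le_one) rd rg2 w1 zero_le_one hBt2
  have b₂ := sum_sum_mul_mul_le (range B) m (fun _ => zero_le_one) rg2 rd w1 hBt2 zero_le_one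
  have b₃ := sum_sum_mul_mul_le' (range B) n2 (fun _ => zero_le_one) rd rg2 w1 zero_le_one hBt2
  have b₄ := sum_sum_mul_mul_le' (range B) m (fun _ => zero_le_one) rg2 rd w1 hBt2 zero_le_one
  have c₁ := sum_sum_mul_mul_le (range B) n (fun p => n p.1 p.2) rg rg wg hBt hBt
  have c₂ := sum_sum_mul_mul_le' (range B) n (fun p => n p.1 p.2) rg rg wg hBt hBt
  have c₃ : ∑ p ∈ range B ×ˢ range B, ∑ r ∈ range B ×ˢ range B,
      gcdOff q r.1 r.2 * (gcdOff q p.1 r.1 * gcdOff q p.2 r.2) ≤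
        B * (B * t) * (B * t * (B * t)) := by
    rw [sum_comm]
    refine le_of_eq_of_le (sum_congr rfl fun r _ => sum_congr rfl fun p _ => ?_) c₁
    rw [gcdOff_comm q p.1, gcdOff_comm q p.2]
  have c₄ : ∑ p ∈ range B ×ˢ range B, ∑ r ∈ range B ×ˢ range B,
      gcdOff q r.1 r.2 * (gcdOff q p.1 r.2 * gcdOff q p.2 r.1) ≤
        B * (B * t) * (B * t * (B * t)) := by
    rw [sum_comm]
    refine le_of_eq_of_le (sum_congr rfl fun r _ => sum_congr rfl fun p _ => ?_) c₂
    rw [gcdOff_comm q p.1, gcdOff_comm q p.2, mul_comm (gcdOff q r.2 p.1)]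
  simp only [one_mul, mul_one] at a₁ a₂ b₁ b₂ b₃ b₄
  calc _ ≤ _ := sum_le_sum fun p _ => sum_le_sum fun r _ => norm_quadSum_le hχ p.1 p.2 r.1 r.2
    _ = q * (∑ p ∈ range B ×ˢ range B, ∑ r ∈ range B ×ˢ range B, diagInd p.1 r.1 * diagInd p.2 r.2 +
          ∑ p ∈ range B ×ˢ range B, ∑ r ∈ range B ×ˢ range B, diagInd p.1 r.2 * diagInd p.2 r.1 +
          ∑ p ∈ range B ×ˢ range B, ∑ r ∈ range B ×ˢ range B, diagInd p.1 p.2 * diagInd r.1 r.2) +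
        t ^ 3 * √q * (
          ∑ p ∈ range B ×ˢ range B, ∑ r ∈ range B ×ˢ range B,
            diagInd p.1 r.1 * gcdOff q p.2 r.2 ^ 2 +
          ∑ p ∈ range B ×ˢ range B, ∑ r ∈ range B ×ˢ range B,
            gcdOff q p.1 r.1 ^ 2 * diagInd p.2 r.2 +
          ∑ p ∈ range B ×ˢ range B, ∑ r ∈ range B ×ˢ range B,
            diagInd p.1 r.2 * gcdOff q p.2 r.1 ^ 2 +
          ∑ p ∈ range B ×ˢ range B, ∑ r ∈ range B ×ˢ range B,
            gcdOff q p.1 r.2 ^ 2 * diagInd p.2 r.1) +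
        t ^ 3 * √q * (
          ∑ p ∈ range B ×ˢ range B, ∑ r ∈ range B ×ˢ range B,
            gcdOff q p.1 p.2 * (gcdOff q p.1 r.1 * gcdOff q p.2 r.2) +
          ∑ p ∈ range B ×ˢ range B, ∑ r ∈ range B ×ˢ range B,
            gcdOff q p.1 p.2 * (gcdOff q p.1 r.2 * gcdOff q p.2 r.1) +
          ∑ p ∈ range B ×ˢ range B, ∑ r ∈ range B ×ˢ range B,
            gcdOff q r.1 r.2 * (gcdOff q p.1 r.1 * gcdOff q p.2 r.2) +
          ∑ p ∈ range B ×ˢ range B, ∑ r ∈ range B ×ˢ range B,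
            gcdOff q r.1 r.2 * (gcdOff q p.1 r.2 * gcdOff q p.2 r.1)) := by
        simp only [mul_add, mul_sum, ← sum_add_distrib]
        refine sum_congr rfl fun p _ => sum_congr rfl fun r _ => ?_
        ring
    _ ≤ q * (B * B + B * B + B * B) + t ^ 3 * √q *
          (B * B * (B * (B * t)) + B * B * (B * (B * t)) + B * B * (B * (B * t)) +
            B * B * (B * (B * t))) +
        t ^ 3 * √q * (B * (B * t) * (B * t * (B * t)) + B * (B * t) * (B * t * (B * t)) +
          B * (B * t) * (B * t * (B * t)) + B * (B * t) * (B * t * (B * t))) := by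
        gcongr
    _ = 3 * 1 * (q * B ^ 2) + (4 * t ^ 4 + 4 * t ^ 6) * (√q * B ^ 4) := by ring
    _ ≤ 8 * t ^ 6 * (q * B ^ 2) + (4 * t ^ 6 + 4 * t ^ 6) * (√q * B ^ 4) := by
        have : 1 ≤ t ^ 6 := one_le_pow₀ ht
        gcongr
        · norm_num
        · norm_num
    _ = _ := by ring

/-- Fourth moment of short character sums. -/
theorem sum_norm_pow_four_le {q : ℕ} [NeZero q] {χ : MulChar (ZMod q) ℂ}
    (hχ : χ.Nondegenerate) (B : ℕ) :
    ∑ x : ZMod q, ‖∑ b ∈ range B, χ (x + b)‖ ^ 4 ≤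
      8 * (#q.divisors : ℝ) ^ 6 * (q * B ^ 2 + √q * B ^ 4) := by
  refine le_trans ?_ (sum_norm_quadSum_le hχ B)
  have h1 : ((∑ x : ZMod q, ‖∑ b ∈ range B, χ (x + b)‖ ^ 4 : ℝ) : ℂ) =
      ∑ p ∈ range B ×ˢ range B, ∑ r ∈ range B ×ˢ range B,
        quadSum χ (p.1 : ZMod q) p.2 r.1 r.2 := by
    push_cast
    simp only [quadSum]
    have h2 : ∀ x : ZMod q, ((‖∑ b ∈ range B, χ (x + b)‖ : ℂ)) ^ 4 =
        ∑ p ∈ range B ×ˢ range B, ∑ r ∈ range B ×ˢ range B,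
          quadChar χ (x + p.1) (x + p.2) (x + r.1) (x + r.2) := fun x => by
      have h3 : starRingEnd ℂ (∑ b ∈ range B, χ (x + b)) = ∑ b ∈ range B, χ⁻¹ (x + b) := by
        rw [map_sum]
        exact sum_congr rfl fun b _ => by rw [starRingEnd_apply, MulChar.star_apply']
      calc _ = (((‖∑ b ∈ range B, χ (x + b)‖ : ℂ)) ^ 2) ^ 2 := by ring
        _ = ((∑ b ∈ range B, χ (x + b)) * ∑ b ∈ range B, χ (x + b)) *
            ((∑ b ∈ range B, χ⁻¹ (x + b)) * ∑ b ∈ range B, χ⁻¹ (x + b)) := by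
          rw [← Complex.mul_conj', h3]; ring
        _ = _ := by
          rw [sum_mul_sum, sum_mul_sum, ← sum_product', ← sum_product', sum_mul_sum]
          refine sum_congr rfl fun p _ => sum_congr rfl fun r _ => ?_
          simp only [quadChar]; ring
    simp only [h2]
    rw [sum_comm]
    exact sum_congr rfl fun p _ => sum_comm
  calc _ = ‖((∑ x : ZMod q, ‖∑ b ∈ range B, χ (x + b)‖ ^ 4 : ℝ) : ℂ)‖ := by
        rw [Complex.norm_real, Real.norm_of_nonneg (sum_nonneg fun _ _ => by positivity)]
    _ ≤ _ := by
        rw [h1]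
        exact (norm_sum_le _ _).trans (sum_le_sum fun p _ => norm_sum_le _ _)

end

section

open Finset

theorem Nat.cast_succ_le_mul_two_rpow {ε : ℝ} (hε : 0 < ε) (k : ℕ) :
    ((k + 1 : ℕ) : ℝ) ≤ (1 + 1 / (ε * Real.log 2)) * (2 : ℝ) ^ (ε * k) := by
  have hl : 0 < Real.log 2 := Real.log_pos one_lt_two
  have hel : 0 < ε * Real.log 2 := mul_pos hε hl
  have h1 : 1 + ε * Real.log 2 * k ≤ (2 : ℝ) ^ (ε * k) := by
    rw [Real.rpow_def_of_pos two_pos]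
    have := Real.add_one_le_exp (Real.log 2 * (ε * k))
    linarith
  calc ((k + 1 : ℕ) : ℝ) ≤ (1 + 1 / (ε * Real.log 2)) * (1 + ε * Real.log 2 * k) := by
        have e : (1 + 1 / (ε * Real.log 2)) * (1 + ε * Real.log 2 * k) =
          1 + k + 1 / (ε * Real.log 2) + ε * Real.log 2 * k := by field_simp; ring
        rw [e]; push_cast
        have : 0 ≤ 1 / (ε * Real.log 2) := by positivity
        have : 0 ≤ ε * Real.log 2 * k := by positivity
        linarith
    _ ≤ _ := by gcongr

/-- The divisor bound. -/
theorem Nat.exists_card_divisors_le {ε : ℝ} (hε : 0 < ε) :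
    ∃ C : ℝ, 1 ≤ C ∧ ∀ n : ℕ, 0 < n → (#n.divisors : ℝ) ≤ C * (n : ℝ) ^ ε := by
  obtain ⟨P, hP⟩ := exists_nat_gt ((2 : ℝ) ^ (1 / ε))
  set K : ℝ := 1 + 1 / (ε * Real.log 2) with hK
  have hl : 0 < Real.log 2 := Real.log_pos one_lt_two
  have hK1 : 1 ≤ K := by
    have : 0 ≤ 1 / (ε * Real.log 2) := by positivity
    linarith
  refine ⟨K ^ P, one_le_pow₀ hK1, fun n hn => ?_⟩
  have h1 : (n : ℝ) ^ ε = ∏ p ∈ n.primeFactors, ((p : ℝ) ^ (ε * n.factorization p)) := by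
    conv_lhs => rw [← Nat.prod_factorization_pow_eq_self hn.ne']
    rw [Finsupp.prod, Nat.support_factorization, Nat.cast_prod,
      ← Real.finsetProd_rpow _ _ (fun i _ => by positivity)]
    refine prod_congr rfl fun p _ => ?_
    rw [Nat.cast_pow, ← Real.rpow_natCast, ← Real.rpow_mul (by positivity), mul_comm]
  have h2 : ∀ p ∈ n.primeFactors, ((n.factorization p + 1 : ℕ) : ℝ) ≤
      (if p < P then K else 1) * (p : ℝ) ^ (ε * n.factorization p) := fun p hp => by
    have hp2 : (2 : ℝ) ≤ p := by exact_mod_cast (Nat.prime_of_mem_primeFactors hp).two_le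
    split_ifs with h
    · refine (Nat.cast_succ_le_mul_two_rpow hε _).trans ?_
      gcongr
    · have h3 : (2 : ℝ) ≤ (p : ℝ) ^ ε := by
        have h4 : (2 : ℝ) ^ (1 / ε) ≤ p := hP.le.trans (by exact_mod_cast not_lt.1 h)
        calc (2 : ℝ) = ((2 : ℝ) ^ (1 / ε)) ^ ε := by
              rw [← Real.rpow_mul two_pos.le, one_div_mul_cancel hε.ne', Real.rpow_one]
          _ ≤ _ := by gcongr
      rw [one_mul, Real.rpow_mul (by positivity), Real.rpow_natCast]
      calc ((n.factorization p + 1 : ℕ) : ℝ) ≤ (2 : ℝ) ^ n.factorization p := by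
            exact_mod_cast Nat.lt_two_pow_self
        _ ≤ _ := by gcongr
  rw [Nat.card_divisors hn.ne', Nat.cast_prod, h1]
  calc _ ≤ ∏ p ∈ n.primeFactors, ((if p < P then K else 1) *
        (p : ℝ) ^ (ε * n.factorization p)) := prod_le_prod (fun _ _ => by positivity) h2
    _ = (∏ p ∈ n.primeFactors, (if p < P then K else 1)) *
        ∏ p ∈ n.primeFactors, (p : ℝ) ^ (ε * n.factorization p) := prod_mul_distrib
    _ ≤ K ^ P * _ := by
        refine mul_le_mul_of_nonneg_right ?_ (prod_nonneg fun _ _ => by positivity)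
        rw [← prod_filter, prod_const]
        refine pow_le_pow_right₀ hK1 ?_
        calc _ ≤ #(range P) := card_le_card fun p hp => by
              rw [mem_filter] at hp; exact mem_range.2 hp.2
          _ = P := card_range P

theorem Nat.le_totient_mul_card_divisors (n : ℕ) : n ≤ n.totient * #n.divisors := by
  induction n using Nat.recOnPosPrimePosCoprime with
  | prime_pow p k hp hk =>
    rw [Nat.totient_prime_pow hp hk, Nat.divisors_prime_pow hp, card_map, card_range]
    obtain ⟨j, rfl⟩ : ∃ j, k = j + 1 := ⟨k - 1, by omega⟩
    obtain ⟨r, rfl⟩ : ∃ r, p = r + 2 := ⟨p - 2, by have := hp.two_le; omega⟩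
    rw [show j + 1 - 1 = j by omega, show r + 2 - 1 = r + 1 by omega, pow_succ, mul_assoc]
    refine Nat.mul_le_mul_left _ ?_
    nlinarith
  | zero => simp
  | one => simp
  | coprime a b ha hb hab iha ihb =>
    rw [Nat.totient_mul hab, hab.card_divisors_mul]
    calc a * b ≤ (a.totient * #a.divisors) * (b.totient * #b.divisors) := Nat.mul_le_mul iha ihb
      _ = _ := by ring

theorem sum_moebius_divisors_gcd {m : ℕ} (hm : m ≠ 0) (n : ℕ) :
    (∑ d ∈ m.divisors with d ∣ n, ArithmeticFunction.moebius d) =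
      if n.Coprime m then 1 else 0 := by
  have h1 : ({d ∈ m.divisors | d ∣ n} : Finset ℕ) = (n.gcd m).divisors := by
    ext d
    simp only [mem_filter, Nat.mem_divisors, Nat.dvd_gcd_iff]
    have : n.gcd m ≠ 0 := Nat.gcd_ne_zero_right hm
    tauto
  rw [h1, ← ArithmeticFunction.coe_mul_zeta_apply, ArithmeticFunction.moebius_mul_coe_zeta,
    ArithmeticFunction.one_apply]

theorem sum_filter_coprime {m : ℕ} (hm : m ≠ 0) (N : ℕ) (f : ℕ → ℂ) :
    ∑ n ∈ Icc 1 N with n.Coprime m, f n =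
      ∑ d ∈ m.divisors, (ArithmeticFunction.moebius d : ℂ) * ∑ k ∈ Icc 1 (N / d), f (d * k) := by
  have h1 : ∀ d ∈ m.divisors, ∑ k ∈ Icc 1 (N / d), f (d * k) =
      ∑ n ∈ Icc 1 N with d ∣ n, f n := fun d hd => by
    have hd0 : 0 < d := Nat.pos_of_mem_divisors hd
    refine sum_bij (fun k _ => d * k) ?_ ?_ ?_ (fun _ _ => rfl)
    · intro k hk
      rw [mem_Icc] at hk
      rw [mem_filter, mem_Icc]
      refine ⟨⟨Nat.mul_pos hd0 hk.1, ?_⟩, dvd_mul_right _ _⟩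
      rw [mul_comm]; exact (Nat.le_div_iff_mul_le hd0).1 hk.2
    · exact fun a _ b _ h => Nat.eq_of_mul_eq_mul_left hd0 h
    · intro n hn
      rw [mem_filter, mem_Icc] at hn
      obtain ⟨⟨h1, h2⟩, k, rfl⟩ := hn
      refine ⟨k, mem_Icc.2 ⟨Nat.pos_of_mul_pos_left h1, ?_⟩, rfl⟩
      rw [Nat.le_div_iff_mul_le hd0, mul_comm]; exact h2
  have h3 : ∀ d ∈ m.divisors, (ArithmeticFunction.moebius d : ℂ) *
      ∑ k ∈ Icc 1 (N / d), f (d * k) = ∑ n ∈ Icc 1 N, (ArithmeticFunction.moebius d : ℂ) *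
        if d ∣ n then f n else 0 := fun d hd => by rw [h1 d hd, sum_filter, mul_sum]
  rw [sum_congr rfl h3, sum_comm, sum_filter]
  refine sum_congr rfl fun n _ => ?_
  have h2 := congrArg (fun z : ℤ => (z : ℂ) * f n) (sum_moebius_divisors_gcd hm n)
  simp only [Int.cast_sum, sum_mul, Int.cast_ite, Int.cast_one, Int.cast_zero, ite_mul, one_mul,
    zero_mul] at h2
  rw [← h2, sum_filter]
  refine sum_congr rfl fun d _ => ?_
  split_ifs <;> simp

theorem abs_card_coprime_sub_le {m : ℕ} (hm : m ≠ 0) (N : ℕ) :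
    |(#{n ∈ Icc 1 N | n.Coprime m} : ℝ) - N * (m.totient / m)| ≤ #m.divisors := by
  have hm' : (m : ℝ) ≠ 0 := by exact_mod_cast hm
  have key : ∀ N : ℕ, (#{n ∈ Icc 1 N | n.Coprime m} : ℝ) =
      ∑ d ∈ m.divisors, (ArithmeticFunction.moebius d : ℝ) * (N / d : ℕ) := fun N => by
    have := sum_filter_coprime hm N (fun _ => 1)
    simp only [sum_const, Nat.card_Icc, add_tsub_cancel_right, nsmul_eq_mul, mul_one] at this
    apply Complex.ofReal_injective
    push_cast
    exact this
  have h1 : (m.totient : ℝ) = ∑ d ∈ m.divisors, (ArithmeticFunction.moebius d : ℝ) * (m / d) := by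
    have h2 := key m
    have h3 : #{n ∈ Icc 1 m | n.Coprime m} = m.totient := by
      have := Nat.filter_coprime_Ico_eq_totient m 1
      rw [← this]
      congr 1
      ext n; simp only [mem_filter, mem_Icc, mem_Ico, Nat.coprime_comm]
      constructor <;> rintro ⟨h, h'⟩ <;> exact ⟨by omega, h'⟩
    rw [← h3, h2]
    refine sum_congr rfl fun d hd => ?_
    rw [Nat.cast_div (Nat.dvd_of_mem_divisors hd)]
    exact_mod_cast (Nat.pos_of_mem_divisors hd).ne'
  have h4 : (N : ℝ) * (m.totient / m) =
      ∑ d ∈ m.divisors, (ArithmeticFunction.moebius d : ℝ) * (N / d) := by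
    rw [h1, sum_div, mul_sum]
    refine sum_congr rfl fun d _ => ?_
    field_simp
  rw [key, h4, ← sum_sub_distrib, card_eq_sum_ones, Nat.cast_sum]
  refine (abs_sum_le_sum_abs _ _).trans (sum_le_sum fun d hd => ?_)
  have hd0 : (0 : ℝ) < d := by exact_mod_cast Nat.pos_of_mem_divisors hd
  rw [← mul_sub, abs_mul, Nat.cast_one]
  refine mul_le_one₀ ?_ (abs_nonneg _) ?_
  · exact_mod_cast ArithmeticFunction.abs_moebius_le_one (n := d)
  · rw [← Nat.floor_div_eq_div (K := ℝ), abs_le]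
    have h5 := Nat.floor_le (a := (N : ℝ) / d) (by positivity)
    have h6 := Nat.lt_floor_add_one ((N : ℝ) / d)
    constructor <;> linarith

theorem Nat.card_filter_modEq_le {q : ℕ} (hq : 0 < q) (X c : ℕ) :
    #{v ∈ Icc 1 X | v ≡ c [MOD q]} ≤ X / q + 1 := by
  have h1 := Nat.count_modEq_card X hq (c + (q - 1))
  rw [Nat.count_eq_card_filter_range] at h1
  have h2 : #{v ∈ Icc 1 X | v ≡ c [MOD q]} ≤ #{w ∈ range X | w ≡ c + (q - 1) [MOD q]} := by
    refine card_le_card_of_injOn (· - 1) (fun v hv => ?_) (fun v hv w hw h => ?_)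
    · simp only [coe_filter, mem_Icc, mem_range, Set.mem_ofPred_eq] at hv ⊢
      refine ⟨by omega, ?_⟩
      have h3 : v - 1 + q = v + (q - 1) := by omega
      exact (Nat.add_mod_right (v - 1) q).symm.trans (h3 ▸ hv.2.add_right (q - 1))
    · simp only [coe_filter, mem_Icc, Set.mem_ofPred_eq] at hv hw
      simp only at h
      omega
  rw [h1] at h2
  refine h2.trans (Nat.add_le_add_left ?_ _)
  split_ifs <;> omega

/-- An energy bound: pairs with congruent images under a map with small fibres. -/
theorem card_filter_modEq_pairs_le {ι : Type*} (W : Finset ι) (φ : ι → ℕ) {q X F : ℕ}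
    (hq : 0 < q) (hφ : ∀ w ∈ W, φ w ∈ Icc 1 X)
    (hF : ∀ v ∈ Icc 1 X, #{w ∈ W | φ w = v} ≤ F) :
    #{p ∈ W ×ˢ W | φ p.1 ≡ φ p.2 [MOD q]} ≤ #W * ((X / q + 1) * F) := by
  classical
  rw [card_filter, sum_product]
  refine (sum_le_card_nsmul _ _ ((X / q + 1) * F) fun w hw => ?_).trans_eq (smul_eq_mul _ _)
  rw [← card_filter]
  have h1 := card_eq_sum_card_fiberwise (s := {w' ∈ W | φ w ≡ φ w' [MOD q]}) (f := φ)
    (t := {v ∈ Icc 1 X | v ≡ φ w [MOD q]}) (fun w' hw' => by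
      simp only [coe_filter, Set.mem_ofPred_eq] at hw' ⊢
      exact ⟨hφ _ hw'.1, hw'.2.symm⟩)
  rw [h1]
  refine (sum_le_card_nsmul _ _ F fun v hv => ?_).trans ?_
  · refine le_trans (card_le_card ?_) (hF v (mem_filter.1 hv).1)
    intro w' hw'
    simp only [mem_filter] at hw' ⊢
    exact ⟨hw'.1.1, hw'.2⟩
  · rw [smul_eq_mul]
    exact Nat.mul_le_mul_right _ (Nat.card_filter_modEq_le hq X _)

end

section

open Finset

theorem norm_sum_Icc_shift_sub_le {f : ℕ → ℂ} (hf : ∀ n, ‖f n‖ ≤ 1) (N h : ℕ) :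
    ‖∑ n ∈ Icc 1 N, f (n + h) - ∑ n ∈ Icc 1 N, f n‖ ≤ 2 * h := by
  induction h with
  | zero => simp
  | succ h ih =>
    have h1 : ∑ n ∈ Icc 1 N, f (n + (h + 1)) =
        ∑ n ∈ Icc 1 N, f (n + h) + (f (N + 1 + h) - f (1 + h)) := by
      rw [← sub_eq_iff_eq_add', ← sum_sub_distrib]
      have h2 : ∀ n ∈ Icc 1 N, f (n + (h + 1)) - f (n + h) =
          (fun k => f (k + h)) (n + 1) - (fun k => f (k + h)) n := fun n _ => by
        simp only [add_right_comm, add_assoc]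
      rw [sum_congr rfl h2, ← Finset.Ico_add_one_right_eq_Icc,
        Finset.sum_Ico_sub (fun k => f (k + h)) (by omega)]
    rw [h1]
    calc _ = ‖(∑ n ∈ Icc 1 N, f (n + h) - ∑ n ∈ Icc 1 N, f n) +
            (f (N + 1 + h) - f (1 + h))‖ := by congr 1; ring
      _ ≤ 2 * h + (1 + 1) := (norm_add_le _ _).trans
          (add_le_add ih ((norm_sub_le _ _).trans (add_le_add (hf _) (hf _))))
      _ = _ := by push_cast; ring

/-- Hölder's inequality for a sum over a map with bounded energy. -/
theorem sum_comp_pow_four_le {ι κ : Type*} [Fintype κ] [DecidableEq κ] (P : Finset ι) (g : ι → κ)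
    (T : κ → ℝ) :
    (∑ p ∈ P, T (g p)) ^ 4 ≤
      (#P : ℝ) ^ 2 * (#{w ∈ P ×ˢ P | g w.1 = g w.2} : ℝ) * ∑ x, T x ^ 4 := by
  set ν : κ → ℝ := fun x => (#{p ∈ P | g p = x} : ℝ) with hν
  have h1 : ∀ U : κ → ℝ, ∑ p ∈ P, U (g p) = ∑ x, ν x * U x := fun U => by
    rw [← sum_fiberwise_of_maps_to (s := P) (t := univ) (g := g) (fun _ _ => mem_univ _)]
    refine sum_congr rfl fun x _ => ?_
    rw [sum_congr rfl (fun p hp => by rw [(mem_filter.1 hp).2] :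
      ∀ p ∈ P.filter (g · = x), U (g p) = U x), sum_const, nsmul_eq_mul]
  have h2 : (#{w ∈ P ×ˢ P | g w.1 = g w.2} : ℝ) = ∑ x, ν x ^ 2 := by
    have := h1 ν
    simp only [← pow_two] at this
    rw [← this, card_filter, sum_product]
    push_cast
    refine sum_congr rfl fun p _ => ?_
    simp only [hν, eq_comm (a := g p), card_filter, Nat.cast_sum,
      Nat.cast_ite, Nat.cast_one, Nat.cast_zero]
  have h3 : (∑ p ∈ P, T (g p)) ^ 2 ≤ #P * ∑ p ∈ P, T (g p) ^ 2 := sq_sum_le_card_mul_sum_sq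
  have h4 : (∑ p ∈ P, T (g p) ^ 2) ^ 2 ≤ (∑ x, ν x ^ 2) * ∑ x, T x ^ 4 := by
    rw [h1 (fun x => T x ^ 2)]
    refine (sum_mul_sq_le_sq_mul_sq _ _ _).trans_eq ?_
    simp only [← pow_mul]
  calc (∑ p ∈ P, T (g p)) ^ 4 = ((∑ p ∈ P, T (g p)) ^ 2) ^ 2 := by ring
    _ ≤ (#P * ∑ p ∈ P, T (g p) ^ 2) ^ 2 := by gcongr
    _ = (#P : ℝ) ^ 2 * (∑ p ∈ P, T (g p) ^ 2) ^ 2 := by ring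
    _ ≤ (#P : ℝ) ^ 2 * ((∑ x, ν x ^ 2) * ∑ x, T x ^ 4) := by gcongr
    _ = _ := by rw [h2]; ring

theorem card_filter_mul_eq_le (s : Finset (ℕ × ℕ)) {v : ℕ} (hv : v ≠ 0) :
    #{w ∈ s | w.1 * w.2 = v} ≤ #v.divisors := by
  refine card_le_card_of_injOn Prod.fst (fun w hw => ?_) (fun w hw w' hw' h => ?_)
  · simp only [coe_filter, Set.mem_ofPred_eq] at hw
    exact mem_coe.2 (Nat.mem_divisors.2 ⟨⟨w.2, hw.2.symm⟩, hv⟩)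
  · simp only [coe_filter, Set.mem_ofPred_eq] at hw hw'
    have h1 : w.1 ≠ 0 := fun h0 => hv (by rw [← hw.2, h0, zero_mul])
    refine Prod.ext h (Nat.eq_of_mul_eq_mul_left (Nat.pos_of_ne_zero h1) ?_)
    rw [hw.2, h, hw'.2]

/-- Burgess's amplification inequality, before choosing parameters. -/
theorem exists_norm_sum_le_of_amplification {q : ℕ} [NeZero q] {χ : MulChar (ZMod q) ℂ}
    (hχ : χ.Nondegenerate) {A : ℕ} {s : Finset ℕ} (hs : ∀ a ∈ s, a ∈ Icc 1 A ∧ a.Coprime q)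
    (B N F : ℕ) (hF : ∀ u ∈ Icc 1 (A * N), #u.divisors ≤ F) :
    ∃ Z : ℝ, 0 ≤ Z ∧
      #s * B * ‖∑ n ∈ Icc 1 N, χ n‖ ≤ Z + #s * B * (2 * (A * B)) ∧
      Z ^ 4 ≤ (#s * N) ^ 3 * (((A * N / q + 1) * F : ℕ) : ℝ) *
        (8 * (#q.divisors : ℝ) ^ 6 * (q * (B : ℝ) ^ 2 + √q * (B : ℝ) ^ 4)) := by
  set T : ZMod q → ℝ := fun x => ‖∑ b ∈ range B, χ (x + b)‖ with hT
  set g : ℕ × ℕ → ZMod q := fun w => (w.1 : ZMod q)⁻¹ * w.2 with hg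
  set P := s ×ˢ Icc 1 N with hP
  have hχ1 : ∀ x, ‖χ x‖ ≤ 1 := fun x => DirichletCharacter.norm_le_one χ x
  have hPc : (#P : ℝ) = #s * N := by simp [hP, card_product]
  refine ⟨∑ p ∈ P, T (g p), sum_nonneg fun _ _ => norm_nonneg _, ?_, ?_⟩
  · have h1 : ∀ a ∈ s, ∀ b ∈ range B, ‖∑ n ∈ Icc 1 N, χ n -
        ∑ n ∈ Icc 1 N, χ ((n + a * b : ℕ) : ZMod q)‖ ≤ 2 * (A * B) := fun a ha b hb => by
      have h2 := norm_sum_Icc_shift_sub_le (f := fun n => χ (n : ZMod q)) (fun n => hχ1 _) N (a * b)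
      have h3 : ((a * b : ℕ) : ℝ) ≤ A * B := by
        rw [← Nat.cast_mul]
        exact Nat.cast_le.2 (Nat.mul_le_mul (mem_Icc.1 (hs a ha).1).2 (mem_range.1 hb).le)
      rw [norm_sub_rev] at h2
      linarith
    have h2 : ∀ a ∈ s, ‖∑ b ∈ range B, ∑ n ∈ Icc 1 N, χ ((n + a * b : ℕ) : ZMod q)‖ ≤
        ∑ n ∈ Icc 1 N, T (g (a, n)) := fun a ha => by
      rw [sum_comm]
      refine (norm_sum_le _ _).trans (sum_le_sum fun n _ => ?_)
      have h3 : ∑ b ∈ range B, χ ((n + a * b : ℕ) : ZMod q) =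
          χ a * ∑ b ∈ range B, χ (g (a, n) + b) := by
        rw [mul_sum]
        refine sum_congr rfl fun b _ => ?_
        rw [← map_mul, hg, mul_add, ← mul_assoc, ZMod.coe_mul_inv_eq_one a (hs a ha).2, one_mul]
        push_cast
        rfl
      rw [h3, norm_mul]
      exact mul_le_of_le_one_left (norm_nonneg _) (hχ1 _)
    have h4 : ∀ a ∈ s, B * ‖∑ n ∈ Icc 1 N, χ n‖ ≤
        ∑ n ∈ Icc 1 N, T (g (a, n)) + B * (2 * (A * B)) := fun a ha => by
      have h5 : (B : ℝ) * ‖∑ n ∈ Icc 1 N, χ n‖ = ‖∑ _b ∈ range B, ∑ n ∈ Icc 1 N, χ n‖ := by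
        rw [sum_const, card_range, nsmul_eq_mul, norm_mul, Complex.norm_natCast]
      have h6 : ∑ _b ∈ range B, ∑ n ∈ Icc 1 N, χ n =
          ∑ b ∈ range B, ∑ n ∈ Icc 1 N, χ ((n + a * b : ℕ) : ZMod q) +
          ∑ b ∈ range B, (∑ n ∈ Icc 1 N, χ n -
            ∑ n ∈ Icc 1 N, χ ((n + a * b : ℕ) : ZMod q)) := by
        rw [← sum_add_distrib]
        exact sum_congr rfl fun _ _ => (add_sub_cancel _ _).symm
      rw [h5, h6]
      refine (norm_add_le _ _).trans (add_le_add (h2 a ha) ((norm_sum_le _ _).trans ?_))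
      refine (sum_le_card_nsmul _ _ _ (h1 a ha)).trans_eq ?_
      rw [card_range, nsmul_eq_mul]
    have h5 := sum_le_sum h4
    rw [sum_const, nsmul_eq_mul, sum_add_distrib, sum_const, nsmul_eq_mul, ← sum_product'] at h5
    linarith
  · have hE : #{w ∈ P ×ˢ P | g w.1 = g w.2} ≤ #P * ((A * N / q + 1) * F) := by
      have h1 := card_filter_modEq_pairs_le P (fun w => w.1 * w.2) (q := q) (X := A * N) (F := F)
        (NeZero.pos q) (fun w hw => by
          have h2 := mem_product.1 hw
          have h3 := mem_Icc.1 (hs _ h2.1).1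
          have h4 := mem_Icc.1 h2.2
          exact mem_Icc.2 ⟨Nat.mul_pos h3.1 h4.1, Nat.mul_le_mul h3.2 h4.2⟩)
        (fun v hv => (card_filter_mul_eq_le P (by have := mem_Icc.1 hv; omega)).trans (hF v hv))
      refine le_trans ?_ h1
      refine card_le_card_of_injOn (fun w => ((w.2.1, w.1.2), (w.1.1, w.2.2))) (fun w hw => ?_)
        (fun w _ w' _ h => ?_)
      · simp only [coe_filter, Set.mem_ofPred_eq, hP, mem_product] at hw ⊢
        refine ⟨⟨⟨hw.1.2.1, hw.1.1.2⟩, hw.1.1.1, hw.1.2.2⟩, ?_⟩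
        rw [← ZMod.natCast_eq_natCast_iff]
        have h2 := hw.2
        have h3 := ZMod.coe_mul_inv_eq_one w.1.1 (hs _ hw.1.1.1).2
        have h4 := ZMod.coe_mul_inv_eq_one w.2.1 (hs _ hw.1.2.1).2
        simp only [hg] at h2
        push_cast
        calc ((w.2.1 : ℕ) : ZMod q) * w.1.2
            = w.2.1 * w.1.1 * ((w.1.1 : ZMod q)⁻¹ * w.1.2) := by
              linear_combination (-(w.2.1 : ZMod q) * w.1.2) * h3
          _ = w.1.1 * w.2.2 := by
              rw [h2]
              linear_combination ((w.1.1 : ZMod q) * w.2.2) * h4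
      · simp only [Prod.mk.injEq] at h
        exact Prod.ext (Prod.ext h.2.1 h.1.2) (Prod.ext h.1.1 h.2.2)
    have h1 := sum_comp_pow_four_le P g T
    have h2 := sum_norm_pow_four_le hχ B
    have hE' : (#{w ∈ P ×ˢ P | g w.1 = g w.2} : ℝ) ≤ #P * (((A * N / q + 1) * F : ℕ) : ℝ) := by
      rw [← Nat.cast_mul]
      exact Nat.cast_le.2 hE
    have h0 : (0 : ℝ) ≤ ∑ x, T x ^ 4 := sum_nonneg fun _ _ => by positivity
    rw [← hPc]
    calc _ ≤ _ := h1
      _ ≤ (#P : ℝ) ^ 2 * (#P * (((A * N / q + 1) * F : ℕ) : ℝ)) *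
          (8 * (#q.divisors : ℝ) ^ 6 * (q * (B : ℝ) ^ 2 + √q * (B : ℝ) ^ 4)) := by gcongr
      _ = _ := by ring

end

section

open Finset Filter

theorem eventually_const_le_rpow (C : ℝ) {κ : ℝ} (hκ : 0 < κ) :
    ∀ᶠ q : ℕ in atTop, C ≤ (q : ℝ) ^ κ :=
  ((tendsto_rpow_atTop hκ).comp tendsto_natCast_atTop_atTop).eventually_ge_atTop C

theorem eventually_card_divisors_le {κ : ℝ} (hκ : 0 < κ) (k : ℕ) :
    ∀ᶠ q : ℕ in atTop, ∀ u, 0 < u → u ≤ q ^ k → (#u.divisors : ℝ) ≤ (q : ℝ) ^ κ := by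
  have hk : (0 : ℝ) < k + 1 := by positivity
  obtain ⟨C, -, hC⟩ := Nat.exists_card_divisors_le (div_pos (half_pos hκ) hk)
  filter_upwards [eventually_const_le_rpow C (half_pos hκ), eventually_ge_atTop 1]
    with q hq hq1 u hu huq
  have hq1' : (1 : ℝ) ≤ q := by exact_mod_cast hq1
  calc (#u.divisors : ℝ) ≤ C * (u : ℝ) ^ (κ / 2 / (k + 1)) := hC u hu
    _ ≤ (q : ℝ) ^ (κ / 2) * (q : ℝ) ^ (κ / 2) := by
        refine mul_le_mul hq ?_ (by positivity) (by positivity)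
        calc (u : ℝ) ^ (κ / 2 / (k + 1)) ≤ ((q : ℝ) ^ (k + 1 : ℝ)) ^ (κ / 2 / (k + 1)) := by
              refine Real.rpow_le_rpow (by positivity) ?_ (by positivity)
              calc (u : ℝ) ≤ (q : ℝ) ^ k := by exact_mod_cast huq
                _ ≤ (q : ℝ) ^ (k + 1) := pow_le_pow_right₀ hq1' (Nat.le_succ k)
                _ = _ := by rw [← Real.rpow_natCast]; push_cast; rfl
          _ = (q : ℝ) ^ (κ / 2) := by
              rw [← Real.rpow_mul (by positivity)]
              congr 1
              field_simp
    _ = (q : ℝ) ^ κ := by rw [← Real.rpow_add (by positivity), add_halves]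

theorem le_div_of_amplification {x L N A B s S Z : ℝ} (hL : 2 ≤ L) (hx : L ^ 20 ≤ x)
    (hN : x ^ 3 * L ^ 20 ≤ N) (hB : x ^ 2 / 2 ≤ B) (hB' : B ≤ x ^ 2)
    (hA : N / (2 * x ^ 2 * L ^ 10) ≤ A) (hA' : A ≤ N / (x ^ 2 * L ^ 10)) (hs : A / (2 * L) ≤ s)
    (hS : s * B * S ≤ Z + s * B * (2 * (A * B)))
    (hZS : Z ^ 4 ≤ (s * N) ^ 3 * ((A * N / x ^ 8 + 1) * L) *
      (8 * L ^ 6 * (x ^ 8 * B ^ 2 + x ^ 4 * B ^ 4))) :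
    S ≤ N / L := by
  have hL0 : 0 < L := by linarith
  have hx0 : 0 < x := lt_of_lt_of_le (by positivity) hx
  have hN0 : 0 < N := lt_of_lt_of_le (by positivity) hN
  have hA0 : 0 < A := lt_of_lt_of_le (by positivity) hA
  have hB0 : 0 < B := lt_of_lt_of_le (by positivity) hB
  have hs0 : 0 < s := lt_of_lt_of_le (by positivity) hs
  have hL2 : ∀ k : ℕ, (2 : ℝ) ^ k ≤ L ^ k := fun k => pow_le_pow_left₀ (by norm_num) hL k
  have h1 : 512 * L ^ 16 * (A * N * x ^ 4 + x ^ 12) ≤ A * N * x ^ 8 := by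
    have h2 : 1024 * L ^ 16 ≤ x ^ 4 := by
      calc 1024 * L ^ 16 ≤ L ^ 64 * L ^ 16 := by
            gcongr
            exact le_trans (by norm_num) (hL2 64)
        _ = (L ^ 20) ^ 4 := by ring
        _ ≤ x ^ 4 := by gcongr
    have h3 : 1024 * L ^ 16 * x ^ 4 ≤ A * N := by
      calc 1024 * L ^ 16 * x ^ 4 ≤ (L ^ 14 / 2) * L ^ 16 * x ^ 4 := by
            gcongr
            have := hL2 14
            norm_num at this
            linarith
        _ = (x ^ 3 * L ^ 20) * (x ^ 3 * L ^ 20) / (2 * x ^ 2 * L ^ 10) := by field_simp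
        _ ≤ N * N / (2 * x ^ 2 * L ^ 10) := by gcongr
        _ = N / (2 * x ^ 2 * L ^ 10) * N := by ring
        _ ≤ A * N := by gcongr
    have h4 : 1024 * L ^ 16 * (A * N * x ^ 4) ≤ x ^ 4 * (A * N * x ^ 4) := by gcongr
    have h5 : 1024 * L ^ 16 * x ^ 4 * x ^ 8 ≤ A * N * x ^ 8 := by gcongr
    nlinarith
  have h2 : Z ≤ s * B * N / L ^ 2 := by
    refine le_of_pow_le_pow_left₀ (n := 4) (by norm_num) (by positivity) (hZS.trans ?_)
    calc (s * N) ^ 3 * ((A * N / x ^ 8 + 1) * L) * (8 * L ^ 6 * (x ^ 8 * B ^ 2 + x ^ 4 * B ^ 4))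
        ≤ (s * N) ^ 3 * ((A * N / x ^ 8 + 1) * L) *
          (8 * L ^ 6 * (x ^ 8 * (x ^ 2) ^ 2 + x ^ 4 * (x ^ 2) ^ 4)) := by gcongr
      _ = (s * N) ^ 3 * (512 * L ^ 16 * (A * N * x ^ 4 + x ^ 12)) / (32 * L ^ 9) := by
          field_simp; ring
      _ ≤ (s * N) ^ 3 * (A * N * x ^ 8) / (32 * L ^ 9) := by gcongr
      _ = (s * N) ^ 3 * (A / (2 * L)) * (x ^ 2 / 2) ^ 4 * N / L ^ 8 := by field_simp; ring
      _ ≤ (s * N) ^ 3 * s * B ^ 4 * N / L ^ 8 := by gcongr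
      _ = (s * B * N / L ^ 2) ^ 4 := by field_simp
  have h3 : A * B ≤ N / L ^ 10 := by
    calc A * B ≤ N / (x ^ 2 * L ^ 10) * x ^ 2 := by gcongr
      _ = N / L ^ 10 := by field_simp
  have h4 : s * B * S ≤ s * B * (N / L ^ 2 + 2 * (N / L ^ 10)) := by
    calc s * B * S ≤ Z + s * B * (2 * (A * B)) := hS
      _ ≤ s * B * N / L ^ 2 + s * B * (2 * (N / L ^ 10)) := by gcongr
      _ = _ := by ring
  refine (le_of_mul_le_mul_left h4 (by positivity)).trans ?_
  have h5 : N / L ^ 2 ≤ N / L / 2 := by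
    rw [div_div]; gcongr; nlinarith
  have h6 : N / L ^ 10 ≤ N / L / 4 := by
    rw [div_div]; gcongr
    have := hL2 9
    calc L * 4 ≤ L * L ^ 9 := by gcongr; linarith
      _ = L ^ 10 := by ring
  linarith

/-- Burgess's bound with exponent `3/8` for nondegenerate characters. -/
theorem exists_norm_sum_le_of_nondegenerate {ε : ℝ} (hε : 0 < ε) (hε8 : ε ≤ 1 / 8) :
    ∃ q₀ : ℕ, ∀ q : ℕ, q₀ ≤ q → ∀ _ : NeZero q, ∀ χ : MulChar (ZMod q) ℂ, χ.Nondegenerate →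
      ∀ N : ℕ, (q : ℝ) ^ (3 / 8 + ε) ≤ N → N ≤ q ^ 2 →
        ‖∑ n ∈ Icc 1 N, χ n‖ ≤ N * (q : ℝ) ^ (-(ε / 20)) := by
  have hε' : 0 < ε / 20 := by positivity
  obtain ⟨q₀, hq₀⟩ := eventually_atTop.1 ((eventually_const_le_rpow 2 hε').and
    ((eventually_card_divisors_le hε' 4).and (eventually_ge_atTop 1)))
  refine ⟨q₀, fun q hq _ χ hχ N hN hNq => ?_⟩
  obtain ⟨hL, hτ, hq1⟩ := hq₀ q hq
  have hQ1 : (1 : ℝ) ≤ q := by exact_mod_cast hq1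
  have hQ0 : (0 : ℝ) < q := by positivity
  set L := (q : ℝ) ^ (ε / 20) with hLd
  set x := (q : ℝ) ^ (1 / 8 : ℝ) with hxd
  have hx8 : x ^ 8 = q := by
    rw [hxd, ← Real.rpow_natCast, ← Real.rpow_mul hQ0.le]; norm_num
  have hL20 : L ^ 20 = (q : ℝ) ^ ε := by
    rw [hLd, ← Real.rpow_natCast, ← Real.rpow_mul hQ0.le]; congr 1; push_cast; ring
  have hx4 : √(q : ℝ) = x ^ 4 := by
    rw [← hx8, show x ^ 8 = (x ^ 4) ^ 2 by ring, Real.sqrt_sq (by positivity)]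
  have hx : L ^ 20 ≤ x := by
    rw [hL20]; exact Real.rpow_le_rpow_of_exponent_le hQ1 hε8
  have hNx : x ^ 3 * L ^ 20 ≤ N := by
    rw [hL20, hxd, ← Real.rpow_natCast, ← Real.rpow_mul hQ0.le, ← Real.rpow_add hQ0]
    refine le_trans (le_of_eq ?_) hN
    norm_num
  have hL0 : 0 < L := by linarith
  have hx0 : 0 < x := by positivity
  have hL1 : 1 ≤ L := by linarith
  have hx1 : 1 ≤ x := (one_le_pow₀ hL1).trans hx
  set B := ⌊x ^ 2⌋₊ with hB
  set A := ⌊(N : ℝ) / (x ^ 2 * L ^ 10)⌋₊ with hA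
  have hfl : ∀ y : ℝ, 1 ≤ y → y / 2 ≤ (⌊y⌋₊ : ℝ) := fun y hy => by
    have h1 := Nat.lt_floor_add_one y
    have h2 : (1 : ℝ) ≤ ⌊y⌋₊ := by exact_mod_cast Nat.le_floor (by simpa using hy)
    linarith
  have hxL : x * L ^ 10 ≤ (N : ℝ) / (x ^ 2 * L ^ 10) := by
    rw [le_div_iff₀ (by positivity)]
    exact le_trans (le_of_eq (by ring)) hNx
  have hxL1 : 1 ≤ x * L ^ 10 := one_le_mul_of_one_le_of_one_le hx1 (one_le_pow₀ hL1)
  have hA1 : (N : ℝ) / (2 * x ^ 2 * L ^ 10) ≤ A :=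
    le_trans (le_of_eq (by field_simp)) (hfl _ (hxL1.trans hxL))
  have hA2 : (A : ℝ) ≤ (N : ℝ) / (x ^ 2 * L ^ 10) := Nat.floor_le (by positivity)
  have hAN : A ≤ N := by
    have : (A : ℝ) ≤ N := hA2.trans (div_le_self (by positivity)
      (one_le_mul_of_one_le_of_one_le (one_le_pow₀ hx1) (one_le_pow₀ hL1)))
    exact_mod_cast this
  set s := {a ∈ Icc 1 A | a.Coprime q} with hs
  have hτq : (#q.divisors : ℝ) ≤ L := hτ q hq1 (Nat.le_self_pow (by norm_num) q)
  have hsA : (A : ℝ) / (2 * L) ≤ #s := by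
    have h1 := (abs_le.1 (abs_card_coprime_sub_le (m := q) (by omega) A)).1
    have h2 : (1 : ℝ) / L ≤ q.totient / q := by
      have h3 : (q : ℝ) ≤ q.totient * #q.divisors := by
        exact_mod_cast Nat.le_totient_mul_card_divisors q
      rw [div_le_div_iff₀ hL0 hQ0, one_mul]
      exact h3.trans (by gcongr)
    have h3 : (A : ℝ) * (1 / L) ≤ A * (q.totient / q) := by gcongr
    have h4 : 2 * L ^ 2 ≤ A := by
      calc 2 * L ^ 2 ≤ L ^ 20 * L ^ 10 / 2 := by
            have : (4 : ℝ) ≤ L ^ 28 := le_trans (by norm_num) (pow_le_pow_left₀ (by norm_num) hL 28)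
            nlinarith [mul_le_mul_of_nonneg_right this (sq_nonneg L)]
        _ ≤ x * L ^ 10 / 2 := by gcongr
        _ ≤ (N : ℝ) / (x ^ 2 * L ^ 10) / 2 := by gcongr
        _ ≤ A := hfl _ (hxL1.trans hxL)
    have h5 : (L : ℝ) ≤ A / (2 * L) := by
      rw [le_div_iff₀ (by positivity)]; linarith
    have h6 : (A : ℝ) * (1 / L) = A / (2 * L) + A / (2 * L) := by field_simp; ring
    linarith
  set F := ⌊L⌋₊ with hF
  obtain ⟨Z, -, hZ1, hZ2⟩ := exists_norm_sum_le_of_amplification hχ (A := A) (s := s)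
    (fun a ha => mem_filter.1 ha) B N F (fun u hu => Nat.le_floor (hτ u (mem_Icc.1 hu).1
      ((mem_Icc.1 hu).2.trans (by nlinarith))))
  rw [Real.rpow_neg hQ0.le, ← hLd, ← div_eq_mul_inv]
  refine le_div_of_amplification hL hx hNx (hfl _ (one_le_pow₀ hx1)) (Nat.floor_le (by positivity))
    hA1 hA2 hsA hZ1 (hZ2.trans ?_)
  rw [hx4, hx8]
  have h7 : (((A * N / q + 1) * F : ℕ) : ℝ) ≤ (A * N / q + 1) * L := by
    push_cast
    refine mul_le_mul ?_ (Nat.floor_le hL0.le) (by positivity) (by positivity)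
    gcongr
    exact Nat.cast_div_le.trans_eq (by push_cast; rfl)
  gcongr

end

section

open Finset Filter

theorem MulChar.sum_range_eq_zero {q : ℕ} [NeZero q] {χ : MulChar (ZMod q) ℂ} (hχ : χ ≠ 1) :
    ∑ n ∈ range q, χ (n : ZMod q) = 0 := by
  rw [← MulChar.sum_eq_zero_of_ne_one hχ]
  exact sum_nbij' (fun n => (n : ZMod q)) ZMod.val (fun _ _ => mem_univ _)
    (fun x _ => mem_range.2 (ZMod.val_lt x)) (fun n hn => ZMod.val_cast_of_lt (mem_range.1 hn))
    (fun x _ => ZMod.natCast_zmod_val x) (fun _ _ => rfl)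

theorem MulChar.sum_range_mod {q : ℕ} [NeZero q] {χ : MulChar (ZMod q) ℂ} (hχ : χ ≠ 1) (N : ℕ) :
    ∑ n ∈ range N, χ (n : ZMod q) = ∑ n ∈ range (N % q), χ (n : ZMod q) := by
  induction N using Nat.strong_induction_on with
  | _ N ih =>
    rcases lt_or_ge N q with h | h
    · rw [Nat.mod_eq_of_lt h]
    · obtain ⟨M, rfl⟩ := Nat.exists_eq_add_of_le h
      rw [Finset.sum_range_add, MulChar.sum_range_eq_zero hχ, zero_add, Nat.add_mod_left,
        ← ih M (by have := NeZero.pos q; omega)]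
      simp

theorem MulChar.norm_sum_Icc_le {q : ℕ} [NeZero q] {χ : MulChar (ZMod q) ℂ} (hχ : χ ≠ 1) (N : ℕ) :
    ‖∑ n ∈ Icc 1 N, χ (n : ZMod q)‖ ≤ q := by
  have h1 : ∑ n ∈ Icc 1 N, χ (n : ZMod q) = ∑ n ∈ range (N + 1), χ (n : ZMod q) - χ 0 := by
    rw [Finset.sum_range_eq_add_Ico _ (by omega), ← Finset.Ico_add_one_right_eq_Icc]
    simp
  have h2 : (χ : MulChar (ZMod q) ℂ) 0 = 0 := by
    refine DirichletCharacter.map_zero' χ fun h => hχ ?_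
    exact DirichletCharacter.level_one' χ h
  rw [h1, h2, sub_zero, MulChar.sum_range_mod hχ]
  refine (norm_sum_le _ _).trans ((sum_le_card_nsmul _ _ 1 fun n _ =>
    DirichletCharacter.norm_le_one χ _).trans ?_)
  rw [card_range, nsmul_one]
  exact_mod_cast (Nat.mod_lt _ (NeZero.pos q)).le

theorem DirichletCharacter.norm_sum_le_sum_divisors {m : ℕ} [NeZero m]
    (χ : DirichletCharacter ℂ m) (N : ℕ) :
    ‖∑ n ∈ Icc 1 N, χ n‖ ≤
      ∑ d ∈ m.divisors, ‖∑ k ∈ Icc 1 (N / d), χ.primitiveCharacter (k : ZMod χ.conductor)‖ := by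
  have h1 : ∑ n ∈ Icc 1 N, χ n =
      ∑ n ∈ Icc 1 N with n.Coprime m, χ.primitiveCharacter (n : ZMod χ.conductor) := by
    rw [sum_filter]
    refine sum_congr rfl fun n _ => ?_
    split_ifs with h
    · have := χ.primitiveCharacter_apply_of_isCoprime (Nat.isCoprime_iff_coprime.2 h)
      simpa using this.symm
    · exact MulChar.map_nonunit _ (by rwa [ZMod.isUnit_iff_coprime])
  rw [h1, sum_filter_coprime (NeZero.ne m)]
  refine (norm_sum_le _ _).trans (sum_le_sum fun d _ => ?_)
  have h2 : ∑ k ∈ Icc 1 (N / d), χ.primitiveCharacter ((d * k : ℕ) : ZMod χ.conductor) =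
      χ.primitiveCharacter (d : ZMod χ.conductor) *
        ∑ k ∈ Icc 1 (N / d), χ.primitiveCharacter (k : ZMod χ.conductor) := by
    rw [mul_sum]
    exact sum_congr rfl fun k _ => by rw [Nat.cast_mul, map_mul]
  rw [h2, norm_mul, norm_mul, ← mul_assoc]
  refine mul_le_of_le_one_left (norm_nonneg _) (mul_le_one₀ ?_ (norm_nonneg _)
    (DirichletCharacter.norm_le_one _ _))
  rw [Complex.norm_intCast]
  exact_mod_cast ArithmeticFunction.abs_moebius_le_one (n := d)

/-- Burgess's bound with exponent `3/8` for nonprincipal characters to any modulus. -/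
theorem exists_norm_sum_le_of_ne_one {ε : ℝ} (hε : 0 < ε) (hε8 : ε ≤ 1 / 8) :
    ∃ δ : ℝ, 0 < δ ∧ ∃ m₀ : ℕ, ∀ m : ℕ, m₀ ≤ m → ∀ _ : NeZero m, ∀ χ : DirichletCharacter ℂ m,
      χ ≠ 1 → ∀ N : ℕ, (m : ℝ) ^ (3 / 8 + ε) ≤ N → (N : ℝ) ≤ (m : ℝ) ^ (3 / 4 : ℝ) →
        ‖∑ n ∈ Icc 1 N, χ n‖ ≤ N * (m : ℝ) ^ (-δ) := by
  obtain ⟨q₀, hq₀⟩ := exists_norm_sum_le_of_nondegenerate (ε := ε / 4) (by positivity) (by linarith)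
  refine ⟨ε / 640, by positivity, ?_⟩
  obtain ⟨m₀, hm₀⟩ := eventually_atTop.1
    ((eventually_const_le_rpow 2 (κ := ε / 4) (by positivity)).and
    ((eventually_card_divisors_le (κ := ε / 640) (by positivity) 1).and
    ((eventually_const_le_rpow q₀ (κ := 3 / 8) (by positivity)).and (eventually_ge_atTop 1))))
  refine ⟨m₀, fun m hm _ χ hχ N hN hN' => ?_⟩
  obtain ⟨h2, hτ, hmq, hm1⟩ := hm₀ m hm
  have hM1 : (1 : ℝ) ≤ m := by exact_mod_cast hm1
  have hM0 : (0 : ℝ) < m := by positivity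
  set q := χ.conductor with hq
  have hqm : q ∣ m := χ.conductor_dvd_level
  have : NeZero q := ⟨χ.conductor_ne_zero⟩
  have hψ : χ.primitiveCharacter ≠ 1 := fun h => hχ (by
    rw [← χ.changeLevel_primitiveCharacter, h, DirichletCharacter.changeLevel_one])
  have hmono : ∀ {a b : ℝ}, a ≤ b → (m : ℝ) ^ a ≤ (m : ℝ) ^ b :=
    fun h => Real.rpow_le_rpow_of_exponent_le hM1 h
  have key : ∀ d ∈ m.divisors, ‖∑ k ∈ Icc 1 (N / d), χ.primitiveCharacter (k : ZMod q)‖ ≤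
      N * (m : ℝ) ^ (-(3 * ε / 640)) := fun d hd => by
    have hd0 := Nat.pos_of_mem_divisors hd
    have hd0' : (0 : ℝ) < d := by exact_mod_cast hd0
    rcases le_or_gt (q : ℝ) ((m : ℝ) ^ (3 / 8 + ε / 2)) with h | h
    · refine (MulChar.norm_sum_Icc_le hψ _).trans (h.trans ?_)
      calc (m : ℝ) ^ (3 / 8 + ε / 2) = (m : ℝ) ^ (3 / 8 + ε) * (m : ℝ) ^ (-(ε / 2)) := by
            rw [← Real.rpow_add hM0]; congr 1; ring
        _ ≤ N * (m : ℝ) ^ (-(3 * ε / 640)) :=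
            mul_le_mul hN (hmono (by linarith)) (by positivity) (by positivity)
    · rcases le_or_gt (d : ℝ) ((m : ℝ) ^ (ε / 2)) with h' | h'
      · have hqM : (q : ℝ) ≤ m := by exact_mod_cast Nat.le_of_dvd (by omega) hqm
        have h3 : (m : ℝ) ^ (3 / 8 + ε / 2) ≤ N / d := by
          rw [le_div_iff₀ hd0']
          calc _ ≤ (m : ℝ) ^ (3 / 8 + ε / 2) * (m : ℝ) ^ (ε / 2) := by gcongr
            _ = (m : ℝ) ^ (3 / 8 + ε) := by rw [← Real.rpow_add hM0]; congr 1; ring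
            _ ≤ N := hN
        have h4 : (m : ℝ) ^ (3 / 8 + ε / 4) ≤ (N / d : ℕ) := by
          have h5 : (m : ℝ) ^ (3 / 8 + ε / 4) * 2 ≤ N / d := by
            calc _ ≤ (m : ℝ) ^ (3 / 8 + ε / 4) * (m : ℝ) ^ (ε / 4) := by gcongr
              _ = (m : ℝ) ^ (3 / 8 + ε / 2) := by rw [← Real.rpow_add hM0]; congr 1; ring
              _ ≤ _ := h3
          have h6 := Nat.lt_floor_add_one ((N : ℝ) / d)
          rw [Nat.floor_div_eq_div] at h6
          have h7 : 1 ≤ (m : ℝ) ^ (3 / 8 + ε / 4) := Real.one_le_rpow hM1 (by positivity)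
          linarith
        have h5 : N / d ≤ q ^ 2 := by
          have h6 : (N : ℝ) ≤ (q : ℝ) ^ 2 := by
            calc (N : ℝ) ≤ (m : ℝ) ^ (3 / 4 : ℝ) := hN'
              _ ≤ ((m : ℝ) ^ (3 / 8 + ε / 2)) ^ 2 := by
                rw [← Real.rpow_natCast, ← Real.rpow_mul hM0.le]
                exact hmono (by push_cast; linarith)
              _ ≤ (q : ℝ) ^ 2 := by gcongr
          exact (Nat.div_le_self _ _).trans (by exact_mod_cast h6)
        have h6 : q₀ ≤ q := by
          have : (q₀ : ℝ) ≤ q := hmq.trans ((hmono (by linarith)).trans h.le)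
          exact_mod_cast this
        refine (hq₀ q h6 this _ χ.primitiveCharacter_isPrimitive.nondegenerate (N / d)
          (le_trans ?_ h4) h5).trans ?_
        · exact Real.rpow_le_rpow (by positivity) hqM (by positivity)
        · refine mul_le_mul ?_ ?_ (by positivity) (by positivity)
          · exact_mod_cast Nat.div_le_self _ _
          · calc (q : ℝ) ^ (-(ε / 4 / 20)) ≤ ((m : ℝ) ^ (3 / 8 + ε / 2)) ^ (-(ε / 4 / 20)) :=
                  Real.rpow_le_rpow_of_nonpos (by positivity) h.le (by linarith)
              _ ≤ _ := by
                rw [← Real.rpow_mul hM0.le]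
                exact hmono (by nlinarith)
      · refine (norm_sum_le _ _).trans ((sum_le_card_nsmul _ _ 1 fun n _ =>
          DirichletCharacter.norm_le_one _ _).trans ?_)
        rw [Nat.card_Icc, nsmul_one, Nat.add_sub_cancel]
        calc ((N / d : ℕ) : ℝ) ≤ N / d := Nat.cast_div_le
          _ ≤ N / (m : ℝ) ^ (ε / 2) := by gcongr
          _ = N * (m : ℝ) ^ (-(ε / 2)) := by rw [Real.rpow_neg hM0.le, div_eq_mul_inv]
          _ ≤ _ := mul_le_mul_of_nonneg_left (hmono (by linarith)) (by positivity)
  refine (χ.norm_sum_le_sum_divisors N).trans ((sum_le_card_nsmul _ _ _ key).trans ?_)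
  rw [nsmul_eq_mul]
  calc _ ≤ (m : ℝ) ^ (ε / 640) * (N * (m : ℝ) ^ (-(3 * ε / 640))) := by
        gcongr
        exact hτ m hm1 (by simp)
    _ = N * (m : ℝ) ^ (-(2 * ε / 640)) := by
        rw [mul_left_comm, ← Real.rpow_add hM0]; congr 2; ring
    _ ≤ _ := mul_le_mul_of_nonneg_left (hmono (by linarith)) (by positivity)

end

section

open Finset

theorem sum_units_one {m : ℕ} (E : Finset (ZMod m)ˣ) :
    ∑ e ∈ E, (1 : DirichletCharacter ℂ m) (e : ZMod m)⁻¹ = #E := by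
  rw [card_eq_sum_ones, Nat.cast_sum]
  refine sum_congr rfl fun e _ => ?_
  rw [MulChar.one_apply, Nat.cast_one]
  exact ⟨⟨_, _, ZMod.inv_mul_of_unit _ e.isUnit, ZMod.mul_inv_of_unit _ e.isUnit⟩, rfl⟩

variable {m : ℕ} [NeZero m]

theorem sum_norm_sum_char_sq_le {ι : Type*} (W : Finset ι) (φ : ι → ℕ) {X F : ℕ}
    (hφ : ∀ w ∈ W, φ w ∈ Icc 1 X ∧ (φ w).Coprime m) (hF : ∀ v ∈ Icc 1 X, #{w ∈ W | φ w = v} ≤ F)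
    (hW : #W ≤ X) (hX : m ≤ X) :
    ∑ χ : DirichletCharacter ℂ m, ‖∑ w ∈ W, χ (φ w)‖ ^ 2 ≤ 2 * (X : ℝ) ^ 2 * F := by
  classical
  have h1 : ∑ χ : DirichletCharacter ℂ m, ((‖∑ w ∈ W, χ (φ w)‖ ^ 2 : ℝ) : ℂ) =
      ∑ w ∈ W, ∑ w' ∈ W, if (φ w : ZMod m) = φ w' then (m.totient : ℂ) else 0 := by
    have h2 : ∀ χ : DirichletCharacter ℂ m, ((‖∑ w ∈ W, χ (φ w)‖ ^ 2 : ℝ) : ℂ) =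
        ∑ w ∈ W, ∑ w' ∈ W, χ (φ w : ZMod m)⁻¹ * χ (φ w') := fun χ => by
      rw [Complex.ofReal_pow, ← Complex.conj_mul', map_sum, sum_mul_sum]
      refine sum_congr rfl fun w hw => sum_congr rfl fun w' _ => ?_
      have h3 := (ZMod.isUnit_iff_coprime (φ w) m).2 (hφ w hw).2
      rw [starRingEnd_apply, MulChar.star_apply', MulChar.inv_apply_eq_of_mul_eq_one χ
        (ZMod.coe_mul_inv_eq_one _ (hφ w hw).2)]
    rw [sum_congr rfl fun χ _ => h2 χ, sum_comm]
    refine sum_congr rfl fun w hw => ?_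
    rw [sum_comm]
    refine sum_congr rfl fun w' _ => ?_
    exact DirichletCharacter.sum_char_inv_mul_char_eq ℂ
      ((ZMod.isUnit_iff_coprime (φ w) m).2 (hφ w hw).2) _
  have h2 : ∑ χ : DirichletCharacter ℂ m, ‖∑ w ∈ W, χ (φ w)‖ ^ 2 =
      m.totient * (#{p ∈ W ×ˢ W | φ p.1 ≡ φ p.2 [MOD m]} : ℝ) := by
    have h3 : ((∑ χ : DirichletCharacter ℂ m, ‖∑ w ∈ W, χ (φ w)‖ ^ 2 : ℝ) : ℂ) =
        ((m.totient * (#{p ∈ W ×ˢ W | φ p.1 ≡ φ p.2 [MOD m]} : ℝ) : ℝ) : ℂ) := by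
      rw [Complex.ofReal_sum, h1, card_filter, sum_product]
      push_cast
      simp only [ZMod.natCast_eq_natCast_iff, mul_sum]
      refine sum_congr rfl fun w _ => sum_congr rfl fun w' _ => ?_
      split_ifs <;> simp
    exact Complex.ofReal_injective h3
  have h3 := card_filter_modEq_pairs_le W φ (NeZero.pos m) (fun w hw => (hφ w hw).1) hF
  have hm0 : (0 : ℝ) < m := by exact_mod_cast NeZero.pos m
  have hX' : (m : ℝ) ≤ X := by exact_mod_cast hX
  rw [h2]
  calc (m.totient : ℝ) * (#{p ∈ W ×ˢ W | φ p.1 ≡ φ p.2 [MOD m]} : ℝ)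
      ≤ m * (#W * ((X / m + 1) * F) : ℕ) := by
        gcongr
        exact Nat.totient_le m
    _ ≤ m * (X * ((X / m + X / m) * F)) := by
        push_cast
        gcongr
        · exact Nat.cast_div_le
        · rwa [one_le_div hm0]
    _ = 2 * (X : ℝ) ^ 2 * F := by field_simp; ring

theorem totient_mul_card_filter_eq_sum {ι : Type*} (E : Finset (ZMod m)ˣ) (W : Finset ι)
    (x : ι → ZMod m) :
    (m.totient : ℂ) * (#{w ∈ W | ∃ e ∈ E, (e : ZMod m) = x w} : ℂ) =
      ∑ χ : DirichletCharacter ℂ m, (∑ e ∈ E, χ (e : ZMod m)⁻¹) * ∑ w ∈ W, χ (x w) := by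
  classical
  simp_rw [sum_mul_sum]
  rw [sum_comm]
  have h1 : ∀ e ∈ E, ∑ χ : DirichletCharacter ℂ m, ∑ w ∈ W, χ (e : ZMod m)⁻¹ * χ (x w) =
      ∑ w ∈ W, if (e : ZMod m) = x w then (m.totient : ℂ) else 0 := fun e _ => by
    rw [sum_comm]
    exact sum_congr rfl fun w _ => DirichletCharacter.sum_char_inv_mul_char_eq ℂ e.isUnit _
  rw [sum_congr rfl h1, sum_comm, card_filter]
  push_cast
  rw [mul_sum]
  refine sum_congr rfl fun w _ => ?_
  by_cases h : ∃ e ∈ E, (e : ZMod m) = x w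
  · obtain ⟨e, he, hew⟩ := h
    rw [if_pos ⟨e, he, hew⟩, mul_one, sum_eq_single_of_mem e he (fun e' _ h' => if_neg fun h2 =>
      h' (Units.ext (h2.trans hew.symm))), if_pos hew]
  · rw [if_neg h, mul_zero]
    exact (sum_eq_zero fun e he => if_neg fun h2 => h ⟨e, he, h2⟩).symm

theorem sum_norm_sum_units_sq (E : Finset (ZMod m)ˣ) :
    ∑ χ : DirichletCharacter ℂ m, ‖∑ e ∈ E, χ (e : ZMod m)⁻¹‖ ^ 2 = m.totient * (#E : ℝ) := by
  classical
  have h2 : ∀ χ : DirichletCharacter ℂ m, ((‖∑ e ∈ E, χ (e : ZMod m)⁻¹‖ ^ 2 : ℝ) : ℂ) =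
      (∑ e ∈ E, χ (e : ZMod m)⁻¹) * ∑ e ∈ E, χ e := fun χ => by
    rw [Complex.ofReal_pow, ← Complex.mul_conj', map_sum]
    congr 1
    refine sum_congr rfl fun e _ => ?_
    rw [starRingEnd_apply, MulChar.star_apply', MulChar.inv_apply_eq_of_mul_eq_one χ
      (b := (e : ZMod m)) (by rw [mul_comm]; exact ZMod.mul_inv_of_unit _ e.isUnit)]
  have h3 := totient_mul_card_filter_eq_sum E E (fun e => (e : ZMod m))
  rw [filter_true_of_mem fun e he => ⟨e, he, rfl⟩] at h3
  apply Complex.ofReal_injective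
  rw [Complex.ofReal_sum, sum_congr rfl fun χ _ => h2 χ, ← h3]
  push_cast
  rfl

end

section

open Finset

/-- Tuples `(s, n, k₁, …, k_j)` with coordinates in the given sets. -/
def tupleSet (S I K : Finset ℕ) (j : ℕ) : Finset (ℕ × ℕ × (Fin j → ℕ)) :=
  S ×ˢ I ×ˢ Fintype.piFinset fun _ => K

def tupleProd {j : ℕ} (w : ℕ × ℕ × (Fin j → ℕ)) : ℕ := w.1 * w.2.1 * ∏ i, w.2.2 i

theorem mem_tupleSet {S I K : Finset ℕ} {j : ℕ} {w : ℕ × ℕ × (Fin j → ℕ)} :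
    w ∈ tupleSet S I K j ↔ w.1 ∈ S ∧ w.2.1 ∈ I ∧ ∀ i, w.2.2 i ∈ K := by
  simp [tupleSet]

theorem card_tupleSet (S I K : Finset ℕ) (j : ℕ) :
    #(tupleSet S I K j) = #S * #I * #K ^ j := by
  simp [tupleSet, mul_assoc]

theorem sum_tupleSet {R : Type*} [CommSemiring R] (f : ℕ →* R) (S I K : Finset ℕ) (j : ℕ) :
    ∑ w ∈ tupleSet S I K j, f (tupleProd w) =
      (∑ s ∈ S, f s) * (∑ n ∈ I, f n) * (∑ k ∈ K, f k) ^ j := by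
  have h : (∑ k ∈ K, f k) ^ j = ∑ p ∈ Fintype.piFinset fun _ : Fin j => K, ∏ i, f (p i) := by
    rw [← prod_univ_sum, prod_const, card_univ, Fintype.card_fin]
  rw [h, mul_assoc, sum_mul_sum I, sum_mul, tupleSet, sum_product]
  refine sum_congr rfl fun s _ => ?_
  rw [sum_product, mul_sum]
  refine sum_congr rfl fun n _ => ?_
  rw [mul_sum]
  refine sum_congr rfl fun p _ => ?_
  simp only [tupleProd, map_mul, map_prod, mul_assoc]

theorem card_filter_tupleProd_eq_le (S I K : Finset ℕ) (j : ℕ) {v : ℕ} (hv : v ≠ 0) :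
    #{w ∈ tupleSet S I K j | tupleProd w = v} ≤ #v.divisors ^ (j + 2) := by
  have h : #(tupleSet v.divisors v.divisors v.divisors j) = #v.divisors ^ (j + 2) := by
    rw [card_tupleSet]; ring
  rw [← h]
  refine card_le_card fun w hw => ?_
  have h1 := (mem_filter.1 hw).2
  simp only [tupleProd] at h1
  refine mem_tupleSet.2 ⟨?_, ?_, fun i => ?_⟩ <;> refine Nat.mem_divisors.2 ⟨?_, hv⟩ <;> rw [← h1]
  · exact (dvd_mul_right _ _).mul_right _
  · exact (dvd_mul_left _ _).mul_right _
  · exact (dvd_prod_of_mem _ (mem_univ i)).mul_left _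

theorem tupleProd_mem {S I K : Finset ℕ} {j X N y m : ℕ}
    (hS : ∀ s ∈ S, s ∈ Icc 1 X ∧ s.Coprime m) (hI : ∀ n ∈ I, n ∈ Icc 1 N ∧ n.Coprime m)
    (hK : ∀ k ∈ K, k ∈ Icc 1 y ∧ k.Coprime m) {w : ℕ × ℕ × (Fin j → ℕ)}
    (hw : w ∈ tupleSet S I K j) :
    tupleProd w ∈ Icc 1 (X * N * y ^ j) ∧ (tupleProd w).Coprime m := by
  obtain ⟨h1, h2, h3⟩ := mem_tupleSet.1 hw
  have h4 := mem_Icc.1 (hS _ h1).1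
  have h5 := mem_Icc.1 (hI _ h2).1
  refine ⟨mem_Icc.2 ⟨?_, ?_⟩, ?_⟩
  · exact Nat.mul_pos (Nat.mul_pos h4.1 h5.1)
      (prod_pos fun i _ => (mem_Icc.1 (hK _ (h3 i)).1).1)
  · refine Nat.mul_le_mul (Nat.mul_le_mul h4.2 h5.2) ?_
    refine (prod_le_pow_card _ _ y fun i _ => (mem_Icc.1 (hK _ (h3 i)).1).2).trans_eq ?_
    rw [card_univ, Fintype.card_fin]
  · exact Nat.Coprime.mul_left (Nat.Coprime.mul_left (hS _ h1).2 (hI _ h2).2)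
      (Nat.Coprime.prod_left fun i _ => (hK _ (h3 i)).2)

theorem sum_tupleSet_char {m : ℕ} (χ : DirichletCharacter ℂ m) (S I K : Finset ℕ) (j : ℕ) :
    ∑ w ∈ tupleSet S I K j, χ (tupleProd w : ℕ) =
      (∑ s ∈ S, χ s) * (∑ n ∈ I, χ n) * (∑ k ∈ K, χ k) ^ j :=
  sum_tupleSet ((χ : ZMod m →* ℂ).comp (Nat.castRingHom (ZMod m) : ℕ →* ZMod m)) S I K j

variable {m : ℕ} [NeZero m]

theorem sum_norm_sq_tuple_le {S I K : Finset ℕ} {j X N y D : ℕ}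
    (hS : ∀ s ∈ S, s ∈ Icc 1 X ∧ s.Coprime m) (hI : ∀ n ∈ I, n ∈ Icc 1 N ∧ n.Coprime m)
    (hK : ∀ k ∈ K, k ∈ Icc 1 y ∧ k.Coprime m) (hm : m ≤ X * N * y ^ j)
    (hD : ∀ v ∈ Icc 1 (X * N * y ^ j), #v.divisors ≤ D) :
    ∑ χ : DirichletCharacter ℂ m,
      ‖(∑ s ∈ S, χ s) * (∑ n ∈ I, χ n) * (∑ k ∈ K, χ k) ^ j‖ ^ 2 ≤
        2 * ((X : ℝ) * N * y ^ j) ^ 2 * (D : ℝ) ^ (j + 2) := by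
  have hc : ∀ {A : Finset ℕ} {Z : ℕ}, (∀ a ∈ A, a ∈ Icc 1 Z ∧ a.Coprime m) → #A ≤ Z :=
    fun h => (card_le_card fun a ha => (h a ha).1).trans_eq (by simp)
  have h1 := sum_norm_sum_char_sq_le (m := m) (tupleSet S I K j) tupleProd
    (X := X * N * y ^ j) (F := D ^ (j + 2)) (fun w hw => tupleProd_mem hS hI hK hw)
    (fun v hv => (card_filter_tupleProd_eq_le S I K j (by have := mem_Icc.1 hv; omega)).trans
      (Nat.pow_le_pow_left (hD v hv) _))
    (by
      rw [card_tupleSet]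
      exact Nat.mul_le_mul (Nat.mul_le_mul (hc hS) (hc hI))
        (Nat.pow_le_pow_left (hc hK) _)) hm
  push_cast at h1
  refine le_trans (le_of_eq (sum_congr rfl fun χ _ => ?_)) h1
  rw [sum_tupleSet_char]

theorem sum_mul_mul_le_of_norm_sq_le {κ : Type*} (s : Finset κ) {e a k : κ → ℝ}
    {E A K B y T : ℝ} {r : ℕ} (he : ∀ i ∈ s, 0 ≤ e i) (ha : ∀ i ∈ s, 0 ≤ a i ∧ a i ≤ B)
    (hk : ∀ i ∈ s, 0 ≤ k i ∧ k i ≤ y) (hy : 0 < y) (hT : 0 < T) (hB : 0 ≤ B)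
    (hE : ∑ i ∈ s, e i ^ 2 ≤ E) (hA : ∑ i ∈ s, a i ^ 2 ≤ A)
    (hK : ∑ i ∈ s, (k i ^ r) ^ 2 ≤ y ^ (2 * r) * K) :
    ∑ i ∈ s, e i * a i * k i ≤ y * √E * (√A / T + B * (√K * T ^ r)) := by
  classical
  have hE0 : ∀ t ⊆ s, ∑ i ∈ t, e i ^ 2 ≤ E := fun t ht =>
    (sum_le_sum_of_subset_of_nonneg ht fun _ _ _ => sq_nonneg _).trans hE
  rw [← sum_filter_add_sum_filter_not s (fun i => k i ≤ y / T)]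
  have h1 : ∑ i ∈ s with k i ≤ y / T, e i * a i * k i ≤ y * √E * (√A / T) := by
    calc _ ≤ ∑ i ∈ s with k i ≤ y / T, e i * a i * (y / T) := by
          refine sum_le_sum fun i hi => ?_
          have := mem_filter.1 hi
          have := mul_nonneg (he i this.1) (ha i this.1).1
          gcongr
          tauto
      _ = (∑ i ∈ s with k i ≤ y / T, e i * a i) * (y / T) := by rw [sum_mul]
      _ ≤ √E * √A * (y / T) := by
          gcongr
          rw [← Real.sqrt_mul' _ ((sum_nonneg fun _ _ => sq_nonneg _).trans hA)]
          refine Real.le_sqrt_of_sq_le ((sum_mul_sq_le_sq_mul_sq _ _ _).trans ?_)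
          refine mul_le_mul (hE0 _ (filter_subset _ _)) ?_ (sum_nonneg fun _ _ => sq_nonneg _)
            ((sum_nonneg fun _ _ => sq_nonneg _).trans hE)
          exact (sum_le_sum_of_subset_of_nonneg (filter_subset _ _)
            fun _ _ _ => sq_nonneg _).trans hA
      _ = _ := by ring
  have hK0 : (#{i ∈ s | ¬ k i ≤ y / T} : ℝ) ≤ K * (T ^ r) ^ 2 := by
    have h2 : (#{i ∈ s | ¬ k i ≤ y / T} : ℝ) * ((y / T) ^ r) ^ 2 ≤ y ^ (2 * r) * K := by
      rw [← nsmul_eq_mul]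
      refine (card_nsmul_le_sum _ (fun i => (k i ^ r) ^ 2) _ fun i hi => ?_).trans
        ((sum_le_sum_of_subset_of_nonneg (filter_subset _ _) fun _ _ _ => sq_nonneg _).trans hK)
      have := (mem_filter.1 hi).2
      push Not at this
      gcongr
    have h3 : ((y / T) ^ r) ^ 2 = y ^ (2 * r) / (T ^ r) ^ 2 := by
      rw [div_pow, div_pow]; ring
    rw [h3, mul_div_assoc', div_le_iff₀ (by positivity)] at h2
    have h4 : 0 < y ^ (2 * r) := by positivity
    nlinarith
  have h2 : ∑ i ∈ s with ¬ k i ≤ y / T, e i * a i * k i ≤ y * √E * (B * (√K * T ^ r)) := by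
    calc _ ≤ ∑ i ∈ s with ¬ k i ≤ y / T, e i * B * y := by
          refine sum_le_sum fun i hi => ?_
          have := (mem_filter.1 hi).1
          have h5 := he i this
          have h6 := ha i this
          have h7 := hk i this
          have h8 := mul_nonneg h5 hB
          exact mul_le_mul (mul_le_mul_of_nonneg_left h6.2 h5) h7.2 h7.1 h8
      _ = (∑ i ∈ s with ¬ k i ≤ y / T, e i) * (B * y) := by
          rw [sum_mul]; exact sum_congr rfl fun _ _ => by ring
      _ ≤ √(K * (T ^ r) ^ 2 * E) * (B * y) := by
          gcongr
          refine Real.le_sqrt_of_sq_le (sq_sum_le_card_mul_sum_sq.trans ?_)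
          exact mul_le_mul hK0 (hE0 _ (filter_subset _ _)) (sum_nonneg fun _ _ => sq_nonneg _)
            ((Nat.cast_nonneg _).trans hK0)
      _ = _ := by
          rw [Real.sqrt_mul' _ ((sum_nonneg fun _ _ => sq_nonneg _).trans hE),
            Real.sqrt_mul' _ (sq_nonneg _), Real.sqrt_sq (by positivity)]
          ring
  linarith

/-- Equidistribution of products `s n k₁ ⋯ k_{j+1}` in a set of units, from a bound for the
nonprincipal character sums over `n`. -/
theorem abs_card_tuple_sub_le {S I K : Finset ℕ} {j r X N y D : ℕ} {σ T : ℝ}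
    (E : Finset (ZMod m)ˣ) (hy : 0 < y)
    (hS : ∀ s ∈ S, s ∈ Icc 1 X ∧ s.Coprime m) (hI : ∀ n ∈ I, n ∈ Icc 1 N ∧ n.Coprime m)
    (hK : ∀ k ∈ K, k ∈ Icc 1 y ∧ k.Coprime m) (hm : m ≤ X * N * y ^ j) (hr : m ≤ y ^ r)
    (hD : ∀ v ∈ Icc 1 (X * N * y ^ j), #v.divisors ≤ D) (hD' : ∀ v ∈ Icc 1 (y ^ r), #v.divisors ≤ D)
    (hσ : 0 ≤ σ) (hT : 0 < T)
    (hχ : ∀ χ : DirichletCharacter ℂ m, χ ≠ 1 → ‖∑ n ∈ I, χ n‖ ≤ N * σ) :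
    |(#{w ∈ tupleSet S I K (j + 1) | ∃ e ∈ E, (e : ZMod m) = (tupleProd w : ℕ)} : ℝ) -
        #S * #I * #K ^ (j + 1) * (#E / m.totient)| ≤
      X * N * y ^ (j + 1) * √(#E / m.totient) *
        (√(2 * (D : ℝ) ^ (j + 2)) / T + σ * (√(2 * (D : ℝ) ^ (r + 2)) * T ^ r)) := by
  classical
  have hφ : (0 : ℝ) < m.totient := by exact_mod_cast Nat.totient_pos.2 (NeZero.pos m)
  have hc : ∀ {A : Finset ℕ} {Z : ℕ}, (∀ a ∈ A, a ∈ Icc 1 Z ∧ a.Coprime m) → #A ≤ Z :=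
    fun h => (card_le_card fun a ha => (h a ha).1).trans_eq (by simp)
  have hn : ∀ {A : Finset ℕ} {Z : ℕ}, (∀ a ∈ A, a ∈ Icc 1 Z ∧ a.Coprime m) →
      ∀ χ : DirichletCharacter ℂ m, ‖∑ a ∈ A, χ a‖ ≤ Z := fun h χ => by
    refine (norm_sum_le_of_le _ fun a _ => DirichletCharacter.norm_le_one χ _).trans ?_
    rw [sum_const, nsmul_eq_mul, mul_one]
    exact_mod_cast hc h
  have hone : ∀ {A : Finset ℕ} {Z : ℕ}, (∀ a ∈ A, a ∈ Icc 1 Z ∧ a.Coprime m) →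
      ∑ a ∈ A, (1 : DirichletCharacter ℂ m) a = #A := fun h => by
    rw [card_eq_sum_ones, Nat.cast_sum]
    refine sum_congr rfl fun a ha => ?_
    rw [MulChar.one_apply ((ZMod.isUnit_iff_coprime a m).2 (h a ha).2), Nat.cast_one]
  have h1 := totient_mul_card_filter_eq_sum E (tupleSet S I K (j + 1))
    (fun w => ((tupleProd w : ℕ) : ZMod m))
  rw [← add_sum_erase _ _ (mem_univ 1)] at h1
  simp only [sum_tupleSet_char] at h1
  rw [sum_units_one, hone hS, hone hI, hone hK] at h1
  set P := #{w ∈ tupleSet S I K (j + 1) | ∃ e ∈ E, (e : ZMod m) = (tupleProd w : ℕ)} with hP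
  have h2 : ‖((m.totient * P - #E * (#S * #I * #K ^ (j + 1)) : ℝ) : ℂ)‖ ≤
      ∑ χ ∈ univ.erase (1 : DirichletCharacter ℂ m), ‖∑ e ∈ E, χ (e : ZMod m)⁻¹‖ *
        ‖(∑ s ∈ S, χ s) * (∑ n ∈ I, χ n) * (∑ k ∈ K, χ k) ^ j‖ * ‖∑ k ∈ K, χ k‖ := by
    push_cast
    rw [h1, add_sub_cancel_left]
    refine norm_sum_le_of_le _ fun χ _ => le_of_eq ?_
    rw [← norm_mul, ← norm_mul]
    ring_nf
  rw [Complex.norm_real, Real.norm_eq_abs] at h2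
  have h3 := sum_mul_mul_le_of_norm_sq_le (univ.erase (1 : DirichletCharacter ℂ m))
    (e := fun χ => ‖∑ e ∈ E, χ (e : ZMod m)⁻¹‖)
    (a := fun χ => ‖(∑ s ∈ S, χ s) * (∑ n ∈ I, χ n) * (∑ k ∈ K, χ k) ^ j‖)
    (k := fun χ => ‖∑ k ∈ K, χ k‖) (E := m.totient * #E)
    (A := 2 * ((X : ℝ) * N * y ^ j) ^ 2 * (D : ℝ) ^ (j + 2)) (K := 2 * (D : ℝ) ^ (r + 2))
    (B := X * N * y ^ j * σ) (y := y) (T := T) (r := r)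
    (fun _ _ => norm_nonneg _) (fun χ hχ' => ⟨norm_nonneg _, ?_⟩)
    (fun χ _ => ⟨norm_nonneg _, hn hK χ⟩) (by exact_mod_cast hy) hT (by positivity)
    ((sum_le_sum_of_subset_of_nonneg (subset_univ _) fun _ _ _ => sq_nonneg _).trans_eq
      (sum_norm_sum_units_sq E))
    ((sum_le_sum_of_subset_of_nonneg (subset_univ _) fun _ _ _ => sq_nonneg _).trans
      (sum_norm_sq_tuple_le hS hI hK hm hD)) ?_
  · have h4 : |(P : ℝ) - #S * #I * #K ^ (j + 1) * (#E / m.totient)| * m.totient =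
        |(m.totient : ℝ) * P - #E * (#S * #I * #K ^ (j + 1))| := by
      rw [show (m.totient : ℝ) * P - #E * (#S * #I * #K ^ (j + 1)) =
        (P - #S * #I * #K ^ (j + 1) * (#E / m.totient)) * m.totient by field_simp,
        abs_mul, abs_of_pos hφ]
    refine le_of_mul_le_mul_right (h4.trans_le (h2.trans (h3.trans_eq ?_))) hφ
    have h5 : √((m.totient : ℝ) * #E) = √(#E / m.totient) * m.totient := by
      rw [show (m.totient : ℝ) * #E = #E / m.totient * (m.totient : ℝ) ^ 2 by field_simp,
        Real.sqrt_mul' _ (sq_nonneg _), Real.sqrt_sq hφ.le]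
    have h6 : √(2 * ((X : ℝ) * N * y ^ j) ^ 2 * (D : ℝ) ^ (j + 2)) =
        X * N * y ^ j * √(2 * (D : ℝ) ^ (j + 2)) := by
      rw [mul_comm 2, mul_assoc, Real.sqrt_mul (sq_nonneg _), Real.sqrt_sq (by positivity)]
    rw [h5, h6]
    ring
  · rw [norm_mul, norm_mul, norm_pow]
    calc _ ≤ (X : ℝ) * (N * σ) * (y : ℝ) ^ j := by
          gcongr
          · exact hn hS χ
          · exact hχ χ (mem_erase.1 hχ').1
          · exact hn hK χ
      _ = _ := by ring
  · have h4 := sum_norm_sq_tuple_le (m := m) (S := {1}) (I := {1}) (K := K) (j := r) (X := 1)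
      (N := 1)
      (y := y) (D := D) (by simp) (by simp) hK (by simpa using hr) (by simpa using hD')
    refine (sum_le_sum_of_subset_of_nonneg (subset_univ _) fun _ _ _ => sq_nonneg _).trans ?_
    simp only [sum_singleton, Nat.cast_one, map_one, one_mul, norm_pow] at h4
    refine h4.trans_eq ?_
    ring

end

section

open Finset Filter

/-- The integers in `[1, N]` coprime to `m`. -/
def unitsUpTo (m N : ℕ) : Finset ℕ := {n ∈ Icc 1 N | n.Coprime m}

theorem mem_unitsUpTo {m N n : ℕ} : n ∈ unitsUpTo m N ↔ (1 ≤ n ∧ n ≤ N) ∧ n.Coprime m := by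
  simp [unitsUpTo]

theorem sum_unitsUpTo_char {m : ℕ} (χ : DirichletCharacter ℂ m) (N : ℕ) :
    ∑ n ∈ unitsUpTo m N, χ n = ∑ n ∈ Icc 1 N, χ n := by
  rw [unitsUpTo, sum_filter]
  refine sum_congr rfl fun n _ => ?_
  split_ifs with h
  · rfl
  · exact (χ.map_nonunit fun hu => h ((ZMod.isUnit_iff_coprime n m).1 hu)).symm

theorem rpow_half_le_floor {x θ : ℝ} (hx : 1 ≤ x) (h : 2 ≤ x ^ (θ / 2)) :
    x ^ (θ / 2) ≤ (⌊x ^ θ⌋₊ : ℝ) := by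
  have h1 : x ^ θ = x ^ (θ / 2) * x ^ (θ / 2) := by
    rw [← Real.rpow_add (by linarith)]; congr 1; ring
  have := Nat.lt_floor_add_one (x ^ θ)
  nlinarith

theorem rpow_sub_le_floor {x θ κ : ℝ} (hx : 1 ≤ x) (hκ : κ ≤ θ) (h : 2 ≤ x ^ κ) :
    x ^ (θ - κ) ≤ (⌊x ^ θ⌋₊ : ℝ) := by
  have h1 : x ^ θ = x ^ (θ - κ) * x ^ κ := by
    rw [← Real.rpow_add (by linarith)]; congr 1; ring
  have h2 := Nat.lt_floor_add_one (x ^ θ)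
  have h3 : 1 ≤ x ^ (θ - κ) := Real.one_le_rpow hx (by linarith)
  nlinarith

theorem le_rpow_neg_of_eq {x δ₀ κ : ℝ} {r : ℕ} {D₁ D₂ : ℝ} (hx : 1 ≤ x)
    (h2 : 2 ≤ x ^ κ) (hδ : 4 * κ * (r + 1) ≤ δ₀)
    (h₁ : D₁ ≤ x ^ (2 * κ)) (h₂ : D₂ ≤ x ^ (2 * κ)) :
    √D₁ / x ^ (3 * κ) + x ^ (-δ₀) * (√D₂ * (x ^ (3 * κ)) ^ r) ≤ x ^ (-κ) := by
  have hx0 : 0 < x := by linarith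
  have hs : √(x ^ (2 * κ)) = x ^ κ := by
    rw [show 2 * κ = κ + κ by ring, Real.rpow_add hx0, Real.sqrt_mul_self (by positivity)]
  have hκ : 0 ≤ κ := by
    by_contra hκ
    have := Real.rpow_le_one_of_one_le_of_nonpos hx (not_le.1 hκ).le
    linarith
  have h3 : √D₁ / x ^ (3 * κ) ≤ x ^ (-(2 * κ)) := by
    rw [div_le_iff₀ (by positivity), ← Real.rpow_add hx0, show -(2 * κ) + 3 * κ = κ by ring, ← hs]
    exact Real.sqrt_le_sqrt h₁
  have h4 : x ^ (-δ₀) * (√D₂ * (x ^ (3 * κ)) ^ r) ≤ x ^ (-(2 * κ)) := by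
    calc _ ≤ x ^ (-δ₀) * (x ^ κ * (x ^ (3 * κ)) ^ r) := by
          rw [← hs]; gcongr
      _ = x ^ (-δ₀ + (κ + 3 * κ * r)) := by
          rw [← Real.rpow_natCast, ← Real.rpow_mul hx0.le, ← Real.rpow_add hx0,
            ← Real.rpow_add hx0]
      _ ≤ _ := Real.rpow_le_rpow_of_exponent_le hx (by
          have : 0 ≤ κ * r := by positivity
          nlinarith)
  have h5 : x ^ (-κ) = x ^ (-(2 * κ)) * x ^ κ := by
    rw [← Real.rpow_add hx0]; congr 1; ring
  have : 0 < x ^ (-(2 * κ)) := by positivity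
  nlinarith

theorem exists_abs_card_tuple_sub_le {ε η : ℝ} (hε : 0 < ε) (hε8 : ε ≤ 1 / 8) (hη : 0 < η)
    (hη1 : η ≤ 1) (j : ℕ) :
    ∃ δ : ℝ, 0 < δ ∧ ∀ᶠ m : ℕ in atTop, ∀ _ : NeZero m, ∀ (E : Finset (ZMod m)ˣ) (X : ℕ)
      (S : Finset ℕ), (∀ s ∈ S, s ∈ Icc 1 X ∧ s.Coprime m) → X ≤ m →
      m ≤ X * ⌊(m : ℝ) ^ (3 / 8 + ε)⌋₊ * ⌊(m : ℝ) ^ η⌋₊ ^ j →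
      |(#{w ∈ tupleSet S (unitsUpTo m ⌊(m : ℝ) ^ (3 / 8 + ε)⌋₊)
            (unitsUpTo m ⌊(m : ℝ) ^ η⌋₊) (j + 1) |
            ∃ e ∈ E, (e : ZMod m) = (tupleProd w : ℕ)} : ℝ) -
          #S * #(unitsUpTo m ⌊(m : ℝ) ^ (3 / 8 + ε)⌋₊) * #(unitsUpTo m ⌊(m : ℝ) ^ η⌋₊) ^ (j + 1) *
            (#E / m.totient)| ≤
        X * ⌊(m : ℝ) ^ (3 / 8 + ε)⌋₊ * ⌊(m : ℝ) ^ η⌋₊ ^ (j + 1) * √(#E / m.totient) *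
          (m : ℝ) ^ (-δ) := by
  obtain ⟨δ₀, hδ₀, m₀, hm₀⟩ := exists_norm_sum_le_of_ne_one (half_pos hε) (by linarith)
  obtain ⟨r, hr⟩ := exists_nat_ge (2 / η)
  rw [div_le_iff₀ hη] at hr
  set κ : ℝ := δ₀ / (4 * (r + 1)) with hκdef
  have hκ : 0 < κ := by positivity
  set k : ℕ := j + r + 2 with hk
  have hk0 : (0 : ℝ) < k := by rw [hk]; positivity
  refine ⟨κ, hκ, ?_⟩
  filter_upwards [eventually_ge_atTop m₀, eventually_ge_atTop 1, eventually_const_le_rpow 2 hκ,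
    eventually_card_divisors_le (div_pos hκ hk0) k, eventually_const_le_rpow 2 (half_pos hη),
    eventually_const_le_rpow 2 (half_pos hε)] with m hmm₀ hm1 h2 hdiv hy2 hN2 _ E X S hS hX hm
  have hx : (1 : ℝ) ≤ m := by exact_mod_cast hm1
  have hx0 : (0 : ℝ) < m := by linarith
  have hle : ∀ {θ : ℝ}, θ ≤ 1 → ⌊(m : ℝ) ^ θ⌋₊ ≤ m := fun {θ} hθ => by
    refine Nat.floor_le_of_le ?_
    simpa using Real.rpow_le_rpow_of_exponent_le hx hθ
  have hNlow : (m : ℝ) ^ (3 / 8 + ε / 2) ≤ ⌊(m : ℝ) ^ (3 / 8 + ε)⌋₊ := by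
    have := rpow_sub_le_floor hx (κ := ε / 2) (θ := 3 / 8 + ε) (by linarith) hN2
    rwa [show 3 / 8 + ε - ε / 2 = 3 / 8 + ε / 2 by ring] at this
  have hylow := rpow_half_le_floor hx hy2
  set N := ⌊(m : ℝ) ^ (3 / 8 + ε)⌋₊ with hN
  set y := ⌊(m : ℝ) ^ η⌋₊ with hy
  have hy0 : 0 < y := by
    have : (0 : ℝ) < y := by linarith
    exact_mod_cast this
  have hym : y ≤ m := hle hη1
  have hNm : N ≤ m := hle (by linarith)
  have hNup : (N : ℝ) ≤ (m : ℝ) ^ (3 / 4 : ℝ) :=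
    (Nat.floor_le (by positivity)).trans (Real.rpow_le_rpow_of_exponent_le hx (by linarith))
  have hmr : m ≤ y ^ r := by
    have : (m : ℝ) ≤ (y : ℝ) ^ r := by
      calc (m : ℝ) = (m : ℝ) ^ (1 : ℝ) := (Real.rpow_one _).symm
        _ ≤ (m : ℝ) ^ (η / 2 * r) := Real.rpow_le_rpow_of_exponent_le hx (by linarith)
        _ = ((m : ℝ) ^ (η / 2)) ^ r := by rw [Real.rpow_mul hx0.le, Real.rpow_natCast]
        _ ≤ _ := by gcongr
    exact_mod_cast this
  have hD : ∀ v, 0 < v → v ≤ m ^ k → #v.divisors ≤ ⌊(m : ℝ) ^ (κ / k)⌋₊ := fun v hv hvk =>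
    Nat.le_floor (hdiv v hv hvk)
  have hDk : ∀ i ≤ k, 2 * (⌊(m : ℝ) ^ (κ / k)⌋₊ : ℝ) ^ i ≤ (m : ℝ) ^ (2 * κ) := fun i hi => by
    have h3 : (⌊(m : ℝ) ^ (κ / k)⌋₊ : ℝ) ^ i ≤ (m : ℝ) ^ κ := by
      calc _ ≤ ((m : ℝ) ^ (κ / k)) ^ i := by gcongr; exact Nat.floor_le (by positivity)
        _ = (m : ℝ) ^ (κ / k * i) := by rw [Real.rpow_mul hx0.le, Real.rpow_natCast]
        _ ≤ (m : ℝ) ^ κ := Real.rpow_le_rpow_of_exponent_le hx (by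
            rw [div_mul_eq_mul_div, div_le_iff₀ hk0]
            have : (i : ℝ) ≤ k := by exact_mod_cast hi
            gcongr)
    rw [show 2 * κ = κ + κ by ring, Real.rpow_add hx0]
    gcongr
  refine (abs_card_tuple_sub_le (X := X) (N := N) (y := y) (r := r)
    (D := ⌊(m : ℝ) ^ (κ / k)⌋₊) (σ := (m : ℝ) ^ (-δ₀)) (T := (m : ℝ) ^ (3 * κ)) E hy0 hS
    (fun n hn => ?_) (fun n hn => ?_) hm hmr (fun v hv => ?_) (fun v hv => ?_) (by positivity)
    (by positivity) fun χ hχ => ?_).trans ?_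
  · simpa [unitsUpTo] using hn
  · simpa [unitsUpTo] using hn
  · have := mem_Icc.1 hv
    refine hD v this.1 (this.2.trans ?_)
    calc X * N * y ^ j ≤ m * m * m ^ j := by gcongr
      _ = m ^ (j + 2) := by ring
      _ ≤ m ^ k := Nat.pow_le_pow_right hm1 (by omega)
  · have := mem_Icc.1 hv
    refine hD v this.1 (this.2.trans ?_)
    calc y ^ r ≤ m ^ r := by gcongr
      _ ≤ m ^ k := Nat.pow_le_pow_right hm1 (by omega)
  · rw [sum_unitsUpTo_char]
    exact hm₀ m hmm₀ inferInstance χ hχ N hNlow hNup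
  · refine mul_le_mul_of_nonneg_left ?_ (by positivity)
    refine le_rpow_neg_of_eq hx h2 ?_ (hDk _ (by omega)) (hDk _ (by omega))
    rw [hκdef]
    apply le_of_eq
    field_simp

end

section

open Finset

theorem exists_mul_eq_of_mul_pow_le {y N₁ N₂ N₃ : ℕ} :
    ∀ (J : ℕ) (k : Fin J → ℕ) (e₁ e₂ e₃ : ℕ), (∀ i, k i ∈ Icc 1 y) → e₁ ∈ Icc 1 N₁ →
      e₂ ∈ Icc 1 N₂ → e₃ ∈ Icc 1 N₃ → e₁ * e₂ * e₃ * y ^ (J + 2) ≤ N₁ * N₂ * N₃ →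
      ∃ x₁ x₂ x₃, x₁ ∈ Icc 1 N₁ ∧ x₂ ∈ Icc 1 N₂ ∧ x₃ ∈ Icc 1 N₃ ∧
        e₁ * e₂ * e₃ * ∏ i, k i = x₁ * x₂ * x₃ := by
  intro J
  induction J with
  | zero => exact fun k e₁ e₂ e₃ _ h₁ h₂ h₃ _ => ⟨e₁, e₂, e₃, h₁, h₂, h₃, by simp⟩
  | succ J ih =>
    intro k e₁ e₂ e₃ hk h₁ h₂ h₃ h
    have hk0 := mem_Icc.1 (hk 0)
    have hy : 0 < y := by omega
    rw [Fin.prod_univ_succ]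
    have hstep : e₁ * e₂ * e₃ * k 0 * y ^ (J + 2) ≤ N₁ * N₂ * N₃ := by
      refine le_trans ?_ h
      rw [pow_succ' y (J + 2), ← mul_assoc]
      gcongr
      exact hk0.2
    have hcases : e₁ * k 0 ≤ N₁ ∨ e₂ * k 0 ≤ N₂ ∨ e₃ * k 0 ≤ N₃ := by
      by_contra! hcon
      obtain ⟨g₁, g₂, g₃⟩ := hcon
      have h4 : N₁ * N₂ * N₃ < e₁ * k 0 * (e₂ * k 0) * (e₃ * k 0) := by gcongr
      have h5 : e₁ * k 0 * (e₂ * k 0) * (e₃ * k 0) ≤ e₁ * e₂ * e₃ * y ^ (J + 1 + 2) := by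
        calc _ = e₁ * e₂ * e₃ * k 0 ^ 3 := by ring
          _ ≤ e₁ * e₂ * e₃ * y ^ 3 := by gcongr; exact hk0.2
          _ ≤ _ := Nat.mul_le_mul_left _ (Nat.pow_le_pow_right hy (by omega))
      omega
    have hk' : ∀ i : Fin J, k i.succ ∈ Icc 1 y := fun i => hk _
    rw [mem_Icc] at h₁ h₂ h₃
    rcases hcases with g | g | g
    · obtain ⟨x₁, x₂, x₃, a₁, a₂, a₃, h⟩ := ih (fun i => k i.succ) (e₁ * k 0) e₂ e₃ hk'
        (mem_Icc.2 ⟨Nat.mul_pos h₁.1 hk0.1, g⟩) (mem_Icc.2 h₂) (mem_Icc.2 h₃)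
        (by convert hstep using 2; ring)
      exact ⟨x₁, x₂, x₃, a₁, a₂, a₃, by rw [← h]; ring⟩
    · obtain ⟨x₁, x₂, x₃, a₁, a₂, a₃, h⟩ := ih (fun i => k i.succ) e₁ (e₂ * k 0) e₃ hk'
        (mem_Icc.2 h₁) (mem_Icc.2 ⟨Nat.mul_pos h₂.1 hk0.1, g⟩) (mem_Icc.2 h₃)
        (by convert hstep using 2; ring)
      exact ⟨x₁, x₂, x₃, a₁, a₂, a₃, by rw [← h]; ring⟩
    · obtain ⟨x₁, x₂, x₃, a₁, a₂, a₃, h⟩ := ih (fun i => k i.succ) e₁ e₂ (e₃ * k 0) hk'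
        (mem_Icc.2 h₁) (mem_Icc.2 h₂) (mem_Icc.2 ⟨Nat.mul_pos h₃.1 hk0.1, g⟩)
        (by convert hstep using 2; ring)
      exact ⟨x₁, x₂, x₃, a₁, a₂, a₃, by rw [← h]; ring⟩

theorem exists_subset_prod_mem_Icc {P : Finset ℕ} {U Y : ℝ} (hU : 1 ≤ U) (hUY : U ^ 2 ≤ Y)
    (hP : ∀ p ∈ P, (p : ℝ) ≤ Y) (h : U ≤ (∏ p ∈ P, p : ℕ)) :
    ∃ Q ⊆ P, U ≤ (∏ p ∈ Q, p : ℕ) ∧ ((∏ p ∈ Q, p : ℕ) : ℝ) ≤ Y := by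
  induction P using Finset.induction_on with
  | empty => exact ⟨∅, Subset.rfl, h, by rw [prod_empty, Nat.cast_one]; nlinarith⟩
  | insert a s ha ih =>
    rcases le_or_gt U (∏ p ∈ s, p : ℕ) with h1 | h1
    · obtain ⟨Q, hQ, h2⟩ := ih (fun p hp => hP p (mem_insert_of_mem hp)) h1
      exact ⟨Q, hQ.trans (subset_insert _ _), h2⟩
    rcases le_or_gt U a with h2 | h2
    · exact ⟨{a}, by simp, by simpa using h2, by simpa using hP a (mem_insert_self _ _)⟩
    · refine ⟨insert a s, Subset.rfl, h, ?_⟩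
      rw [prod_insert ha, Nat.cast_mul]
      refine le_trans ?_ hUY
      rw [sq]
      gcongr

theorem exists_dvd_of_le_prod_primes {n : ℕ} {U Y : ℝ} (hU : 1 ≤ U) (hUY : U ^ 2 ≤ Y)
    (h : U ≤ (∏ p ∈ n.primeFactors with p ≤ ⌊Y⌋₊, p : ℕ)) :
    ∃ d, d ∣ n ∧ U ≤ d ∧ (d : ℝ) ≤ Y := by
  obtain ⟨Q, hQ, h1, h2⟩ := exists_subset_prod_mem_Icc hU hUY
    (fun p hp => (Nat.le_floor_iff (by nlinarith)).1 (mem_filter.1 hp).2) h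
  refine ⟨_, (prod_dvd_prod_of_subset _ _ _ ?_).trans (Nat.prod_primeFactors_dvd n), h1, h2⟩
  exact hQ.trans (filter_subset _ _)

end

section

open Finset

/-- Mertens' sum `∑_{p ≤ N} log p / p`. -/
noncomputable def primeLogSum (N : ℕ) : ℝ := ∑ p ∈ Icc 1 N with p.Prime, Real.log p / p

theorem log_factorial_eq_sum (N : ℕ) :
    Real.log (N.factorial : ℕ) =
      ∑ p ∈ Icc 1 N with p.Prime, (padicValNat p N.factorial : ℝ) * Real.log p := by
  rw [Real.log_nat_eq_sum_factorization, Finsupp.sum, Nat.support_factorization]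
  have h : N.factorial.primeFactors = {p ∈ Icc 1 N | p.Prime} := by
    ext p
    simp only [Nat.mem_primeFactors, mem_filter, mem_Icc]
    constructor
    · exact fun h => ⟨⟨h.1.one_lt.le, h.1.dvd_factorial.1 h.2.1⟩, h.1⟩
    · exact fun h => ⟨h.2, h.2.dvd_factorial.2 h.1.2, Nat.factorial_ne_zero _⟩
  rw [h]
  refine sum_congr rfl fun p hp => ?_
  rw [Nat.factorization_def _ (mem_filter.1 hp).2]

theorem Nat.Prime.div_le_padicValNat_factorial {p : ℕ} (hp : p.Prime) (N : ℕ) :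
    N / p ≤ padicValNat p N.factorial := by
  have := Fact.mk hp
  conv_rhs => rw [← Nat.div_add_mod N p]
  rw [padicValNat_factorial_mul_add _ (Nat.mod_lt _ hp.pos), padicValNat_factorial_mul]
  omega

theorem Nat.Prime.padicValNat_factorial_le {p : ℕ} (hp : p.Prime) (N : ℕ) :
    (padicValNat p N.factorial : ℝ) ≤ N / (p - 1) := by
  have := Fact.mk hp
  have h1 : (1 : ℝ) < p := by exact_mod_cast hp.one_lt
  rw [le_div_iff₀ (by linarith)]
  have h2 := sub_one_mul_padicValNat_factorial (p := p) N
  have h3 : (p - 1) * padicValNat p N.factorial ≤ N := by omega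
  have h4 : (((p - 1) * padicValNat p N.factorial : ℕ) : ℝ) ≤ N := by exact_mod_cast h3
  rw [Nat.cast_mul, Nat.cast_sub hp.one_lt.le, Nat.cast_one] at h4
  linarith

theorem primeLogSum_nonneg (N : ℕ) : 0 ≤ primeLogSum N :=
  sum_nonneg fun p _ => div_nonneg (Real.log_natCast_nonneg p) (Nat.cast_nonneg p)

theorem primeLogSum_le {N : ℕ} (hN : 1 ≤ N) : primeLogSum N ≤ Real.log N + Real.log 4 := by
  have hN0 : (0 : ℝ) < N := by exact_mod_cast hN
  have h1 : Real.log (N.factorial : ℕ) ≤ N * Real.log N := by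
    rw [← Real.log_pow]
    refine Real.log_le_log (by exact_mod_cast Nat.factorial_pos N) ?_
    exact_mod_cast Nat.factorial_le_pow N
  have h2 : N * primeLogSum N - ∑ p ∈ Icc 1 N with p.Prime, Real.log p ≤
      Real.log (N.factorial : ℕ) := by
    rw [log_factorial_eq_sum, primeLogSum, mul_sum, ← sum_sub_distrib]
    refine sum_le_sum fun p hp => ?_
    have hp' := (mem_filter.1 hp).2
    have hp0 : (0 : ℝ) < p := by exact_mod_cast hp'.pos
    have h3 : (N : ℝ) / p - 1 ≤ padicValNat p N.factorial := by
      have h4 : ((N / p : ℕ) : ℝ) ≤ padicValNat p N.factorial := by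
        exact_mod_cast hp'.div_le_padicValNat_factorial N
      have h5 := Nat.lt_floor_add_one ((N : ℝ) / p)
      rw [Nat.floor_div_eq_div (K := ℝ)] at h5
      linarith
    calc (N : ℝ) * (Real.log p / p) - Real.log p = (N / p - 1) * Real.log p := by ring
      _ ≤ _ := by gcongr
  have h3 : ∑ p ∈ Icc 1 N with p.Prime, Real.log p ≤ Real.log 4 * N := by
    have := Chebyshev.theta_le_log4_mul_x hN0.le
    rw [Chebyshev.theta_eq_sum_Icc, Nat.floor_natCast] at this
    refine le_trans (sum_le_sum_of_subset_of_nonneg (fun p hp => ?_)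
      fun p _ _ => Real.log_natCast_nonneg p) this
    simp only [mem_filter, mem_Icc] at hp ⊢
    exact ⟨⟨by omega, hp.1.2⟩, hp.2⟩
  have h4 : N * primeLogSum N ≤ N * (Real.log N + Real.log 4) := by linarith
  exact le_of_mul_le_mul_left h4 hN0

theorem exists_log_sub_le_primeLogSum :
    ∃ C : ℝ, 0 ≤ C ∧ ∀ N : ℕ, 1 ≤ N → Real.log N - C ≤ primeLogSum N := by
  have hs : Summable fun n : ℕ => 4 * (1 / (n : ℝ) ^ (3 / 2 : ℝ)) :=
    (Real.summable_one_div_nat_rpow.2 (by norm_num)).mul_left 4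
  refine ⟨1 + ∑' n : ℕ, 4 * (1 / (n : ℝ) ^ (3 / 2 : ℝ)),
    add_nonneg zero_le_one (tsum_nonneg fun n => by positivity), fun N hN => ?_⟩
  have hN0 : (0 : ℝ) < N := by exact_mod_cast hN
  have h1 : N * Real.log N - N ≤ Real.log (N.factorial : ℕ) := by
    have h := Real.pow_div_factorial_le_exp _ hN0.le N
    have hf : (0 : ℝ) < N.factorial := by exact_mod_cast Nat.factorial_pos N
    have h2 := Real.log_le_log (by positivity) h
    rw [Real.log_exp, Real.log_div (by positivity) hf.ne', Real.log_pow] at h2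
    linarith
  have h2 : Real.log (N.factorial : ℕ) ≤ N * primeLogSum N +
      N * ∑ p ∈ Icc 1 N with p.Prime, 4 * (1 / (p : ℝ) ^ (3 / 2 : ℝ)) := by
    rw [log_factorial_eq_sum, primeLogSum, mul_sum, mul_sum, ← sum_add_distrib]
    refine sum_le_sum fun p hp => ?_
    have hp' := (mem_filter.1 hp).2
    have hp2 : (2 : ℝ) ≤ p := by exact_mod_cast hp'.two_le
    have hp0 : (0 : ℝ) < p := by linarith
    have hl0 := Real.log_natCast_nonneg p
    have h3 : Real.log p ≤ 2 * (p : ℝ) ^ (1 / 2 : ℝ) := by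
      have := Real.log_le_rpow_div hp0.le (show (0 : ℝ) < 1 / 2 by norm_num)
      linarith
    have h4 : (p : ℝ) ^ 2 = (p : ℝ) ^ (1 / 2 : ℝ) * (p : ℝ) ^ (3 / 2 : ℝ) := by
      rw [← Real.rpow_add hp0, ← Real.rpow_natCast]; norm_num
    have h5 : Real.log p / (p - 1) - Real.log p / p ≤ 4 * (1 / (p : ℝ) ^ (3 / 2 : ℝ)) := by
      rw [div_sub_div _ _ (by linarith) hp0.ne', mul_one_div, div_le_div_iff₀ (by nlinarith)
        (by positivity)]
      calc (Real.log p * p - (p - 1) * Real.log p) * (p : ℝ) ^ (3 / 2 : ℝ)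
          = Real.log p * (p : ℝ) ^ (3 / 2 : ℝ) := by ring
        _ ≤ 2 * (p : ℝ) ^ (1 / 2 : ℝ) * (p : ℝ) ^ (3 / 2 : ℝ) := by gcongr
        _ = 2 * (p : ℝ) ^ 2 := by rw [h4]; ring
        _ ≤ 4 * ((p - 1) * p) := by nlinarith
    calc _ ≤ N / (p - 1) * Real.log p := by
          gcongr; exact hp'.padicValNat_factorial_le N
      _ = N * (Real.log p / p) + N * (Real.log p / (p - 1) - Real.log p / p) := by ring
      _ ≤ _ := by gcongr
  have h3 : ∑ p ∈ Icc 1 N with p.Prime, 4 * (1 / (p : ℝ) ^ (3 / 2 : ℝ)) ≤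
      ∑' n : ℕ, 4 * (1 / (n : ℝ) ^ (3 / 2 : ℝ)) :=
    hs.sum_le_tsum _ fun n _ => by positivity
  have h4 : N * (Real.log N - (1 + ∑' n : ℕ, 4 * (1 / (n : ℝ) ^ (3 / 2 : ℝ)))) ≤
      N * primeLogSum N := by
    have := mul_le_mul_of_nonneg_left h3 hN0.le
    linarith
  exact le_of_mul_le_mul_left h4 hN0

theorem sum_mul_partial_sum (a : ℕ → ℝ) (n : ℕ) :
    2 * ∑ i ∈ Icc 1 n, a i * ∑ k ∈ Icc 1 i, a k =
      (∑ i ∈ Icc 1 n, a i) ^ 2 + ∑ i ∈ Icc 1 n, a i ^ 2 := by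
  induction n with
  | zero => simp
  | succ n ih => simp only [sum_Icc_succ_top (show 1 ≤ n + 1 by omega), mul_add, ih]; ring

theorem exists_sum_log_sq_div_le :
    ∃ C : ℝ, 0 ≤ C ∧ ∀ N : ℕ, 1 ≤ N → ∑ p ∈ Icc 1 N with p.Prime, Real.log p ^ 2 / p ≤
      primeLogSum N ^ 2 / 2 + C * primeLogSum N := by
  obtain ⟨C, hC, h⟩ := exists_log_sub_le_primeLogSum
  refine ⟨C + 1 / 2, by positivity, fun N hN => ?_⟩
  set a : ℕ → ℝ := fun p => if p.Prime then Real.log p / p else 0 with ha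
  have hA : ∀ n, ∑ i ∈ Icc 1 n, a i = primeLogSum n := fun n => by
    rw [primeLogSum, sum_filter]
  have h1 := sum_mul_partial_sum a N
  have h0 : ∀ i, 0 ≤ a i ∧ a i ≤ 1 := fun i => by
    simp only [ha]
    split_ifs with hi
    · have hi0 : (0 : ℝ) < i := by exact_mod_cast hi.pos
      refine ⟨div_nonneg (Real.log_natCast_nonneg i) hi0.le, ?_⟩
      rw [div_le_one hi0]
      exact (Real.log_le_sub_one_of_pos hi0).trans (by linarith)
    · simp
  have h2 : ∑ i ∈ Icc 1 N, a i ^ 2 ≤ primeLogSum N := by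
    rw [← hA]
    refine sum_le_sum fun i _ => ?_
    have := h0 i
    nlinarith
  have h3 : ∑ p ∈ Icc 1 N with p.Prime, Real.log p ^ 2 / p ≤
      ∑ i ∈ Icc 1 N, (a i * ∑ k ∈ Icc 1 i, a k) + C * primeLogSum N := by
    rw [sum_filter, ← hA N, mul_sum, ← sum_add_distrib]
    refine sum_le_sum fun i hi => ?_
    have hi1 := (mem_Icc.1 hi).1
    split_ifs with hp
    · have h4 := h i hi1
      rw [← hA] at h4
      have h5 : a i = Real.log i / i := by simp [ha, hp]
      calc Real.log i ^ 2 / i = a i * Real.log i := by rw [h5]; ring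
        _ ≤ a i * (∑ k ∈ Icc 1 i, a k + C) := by
            have := (h0 i).1
            gcongr
            linarith
        _ = _ := by ring
    · have h5 : a i = 0 := by simp [ha, hp]
      simp [h5]
  rw [hA] at h1
  linarith

theorem sum_primeFactors_log_div_le {m z : ℕ} (hm : m ≠ 0) (hz : 1 ≤ z) :
    ∑ p ∈ m.primeFactors, Real.log p / p ≤ Real.log z + Real.log 4 + Real.log m / z := by
  have hz0 : (0 : ℝ) < z := by exact_mod_cast hz
  rw [← sum_filter_add_sum_filter_not _ (fun p => p ≤ z)]
  refine add_le_add (le_trans ?_ (primeLogSum_le hz)) ?_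
  · refine sum_le_sum_of_subset_of_nonneg (fun p hp => ?_) fun p _ _ =>
      div_nonneg (Real.log_natCast_nonneg p) (Nat.cast_nonneg p)
    have := mem_filter.1 hp
    have h1 := Nat.prime_of_mem_primeFactors this.1
    exact mem_filter.2 ⟨mem_Icc.2 ⟨h1.one_lt.le, this.2⟩, h1⟩
  · have h1 : ∑ p ∈ m.primeFactors, Real.log p ≤ Real.log m := by
      rw [← Real.log_prod (fun p hp => by
        exact_mod_cast (Nat.prime_of_mem_primeFactors hp).ne_zero)]
      refine Real.log_le_log (prod_pos fun p hp => by
        exact_mod_cast (Nat.prime_of_mem_primeFactors hp).pos) ?_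
      rw [← Nat.cast_prod]
      exact_mod_cast Nat.le_of_dvd (Nat.pos_of_ne_zero hm) (Nat.prod_primeFactors_dvd m)
    refine le_trans ?_ (div_le_div_of_nonneg_right h1 hz0.le)
    rw [sum_div]
    refine (sum_le_sum fun p hp => ?_).trans
      (sum_le_sum_of_subset_of_nonneg (filter_subset _ _) fun p _ _ =>
        div_nonneg (Real.log_natCast_nonneg p) hz0.le)
    have := (mem_filter.1 hp).2
    have h2 : (z : ℝ) ≤ p := by exact_mod_cast (not_le.1 this).le
    have := Real.log_natCast_nonneg p
    gcongr

end

section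

open Finset

theorem card_unitsUpTo_dvd {m d : ℕ} (hd : 0 < d) (hdm : d.Coprime m) (N : ℕ) :
    #{n ∈ unitsUpTo m N | d ∣ n} = #(unitsUpTo m (N / d)) := by
  symm
  refine card_bij (fun k _ => d * k) (fun k hk => ?_)
    (fun a _ b _ h => Nat.eq_of_mul_eq_mul_left hd h)
    fun n hn => ?_
  · rw [mem_unitsUpTo] at hk
    refine mem_filter.2 ⟨mem_unitsUpTo.2 ⟨⟨Nat.mul_pos hd hk.1.1, ?_⟩, hdm.mul_left hk.2⟩,
      dvd_mul_right _ _⟩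
    exact (Nat.mul_le_mul_left d hk.1.2).trans (Nat.mul_div_le N d)
  · obtain ⟨h1, k, rfl⟩ := mem_filter.1 hn
    rw [mem_unitsUpTo] at h1
    refine ⟨k, mem_unitsUpTo.2 ⟨⟨Nat.pos_of_mul_pos_left h1.1.1, ?_⟩, h1.2.coprime_mul_left⟩, rfl⟩
    exact (Nat.le_div_iff_mul_le hd).2 (by rw [mul_comm]; exact h1.1.2)

theorem abs_card_unitsUpTo_dvd_sub_le {m d : ℕ} (hm : m ≠ 0) (hd : 0 < d) (hdm : d.Coprime m)
    (N : ℕ) :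
    |(#{n ∈ unitsUpTo m N | d ∣ n} : ℝ) - #(unitsUpTo m N) / d| ≤ 3 * #m.divisors := by
  rw [card_unitsUpTo_dvd hd hdm]
  have h1 := abs_le.1 (abs_card_coprime_sub_le hm (N / d))
  have h2 := abs_le.1 (abs_card_coprime_sub_le hm N)
  have hd1 : (1 : ℝ) ≤ d := by exact_mod_cast hd
  have hτ : (1 : ℝ) ≤ #m.divisors := by
    exact_mod_cast card_pos.2 (Nat.nonempty_divisors.2 hm)
  have hm0 : (0 : ℝ) < m := by exact_mod_cast Nat.pos_of_ne_zero hm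
  have hφ : (m.totient : ℝ) / m ≤ 1 := by
    rw [div_le_one hm0]; exact_mod_cast Nat.totient_le m
  have hφ0 : 0 ≤ (m.totient : ℝ) / m := by positivity
  set ρ := (m.totient : ℝ) / m with hρ
  have h3 : ((N / d : ℕ) : ℝ) ≤ N / d := Nat.cast_div_le
  have h4 : (N : ℝ) / d < (N / d : ℕ) + 1 := by
    have h5 := Nat.lt_floor_add_one ((N : ℝ) / d)
    rwa [Nat.floor_div_eq_div (K := ℝ)] at h5
  change |(#{n ∈ Icc 1 (N / d) | n.Coprime m} : ℝ) - #{n ∈ Icc 1 N | n.Coprime m} / d| ≤ _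
  have h6 : |(#{n ∈ Icc 1 N | n.Coprime m} : ℝ) / d - N / d * ρ| ≤ #m.divisors := by
    rw [show (#{n ∈ Icc 1 N | n.Coprime m} : ℝ) / d - N / d * ρ =
      (#{n ∈ Icc 1 N | n.Coprime m} - N * ρ) / d by ring, abs_div,
      abs_of_pos (show (0 : ℝ) < d by linarith), div_le_iff₀ (by linarith)]
    have := abs_card_coprime_sub_le hm N
    nlinarith
  have h7 := abs_le.1 h6
  have h8 : ((N / d : ℕ) : ℝ) * ρ ≤ N / d * ρ := by gcongr
  have h9 : (N : ℝ) / d * ρ ≤ (N / d : ℕ) * ρ + 1 := by nlinarith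
  rw [abs_le]
  constructor <;> linarith

/-- The sum of `log p` over the primes `p ≤ Y` dividing `n` but not `m`. -/
noncomputable def logSmallPart (m Y n : ℕ) : ℝ :=
  ∑ p ∈ Icc 1 Y with p.Prime ∧ p.Coprime m, if p ∣ n then Real.log p else 0

theorem logSmallPart_eq {m n Y : ℕ} (hn : 0 < n) (hnm : n.Coprime m) :
    logSmallPart m Y n = Real.log (∏ p ∈ n.primeFactors with p ≤ Y, p : ℕ) := by
  rw [logSmallPart, ← sum_filter, Nat.cast_prod, Real.log_prod fun p hp => by
    exact_mod_cast (Nat.prime_of_mem_primeFactors (mem_filter.1 hp).1).ne_zero]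
  refine sum_congr ?_ fun _ _ => rfl
  ext p
  simp only [mem_filter, mem_Icc, Nat.mem_primeFactors]
  constructor
  · exact fun h => ⟨⟨h.1.2.1, h.2, hn.ne'⟩, h.1.1.2⟩
  · exact fun h => ⟨⟨⟨h.1.1.one_lt.le, h.2⟩, h.1.1, hnm.coprime_dvd_left h.1.2.1⟩, h.1.2.1⟩

theorem sum_prime_log_le (s : Finset ℕ) {Y : ℕ} (hs : s ⊆ Icc 1 Y) :
    ∑ p ∈ s, Real.log p ≤ Y * Real.log Y := by
  refine (sum_le_card_nsmul _ _ (Real.log Y) fun p hp => ?_).trans ?_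
  · have := mem_Icc.1 (hs hp)
    exact Real.log_le_log (by exact_mod_cast this.1) (by exact_mod_cast this.2)
  · rw [nsmul_eq_mul]
    have h1 : (#s : ℝ) ≤ Y := by exact_mod_cast (card_le_card hs).trans_eq (by simp)
    have := Real.log_natCast_nonneg Y
    gcongr

theorem le_sum_logSmallPart {m : ℕ} (hm : m ≠ 0) (N Y : ℕ) :
    #(unitsUpTo m N) * (primeLogSum Y - ∑ p ∈ m.primeFactors, Real.log p / p) -
        3 * #m.divisors * (Y * Real.log Y) ≤
      ∑ n ∈ unitsUpTo m N, logSmallPart m Y n := by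
  have h1 : ∑ n ∈ unitsUpTo m N, logSmallPart m Y n =
      ∑ p ∈ Icc 1 Y with p.Prime ∧ p.Coprime m,
        Real.log p * #{n ∈ unitsUpTo m N | p ∣ n} := by
    simp_rw [logSmallPart]
    rw [sum_comm]
    refine sum_congr rfl fun p _ => ?_
    rw [← sum_filter, sum_const, nsmul_eq_mul, mul_comm]
  have h2 : primeLogSum Y - ∑ p ∈ m.primeFactors, Real.log p / p ≤
      ∑ p ∈ Icc 1 Y with p.Prime ∧ p.Coprime m, Real.log p / p := by
    rw [sub_le_iff_le_add, primeLogSum,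
      ← sum_filter_add_sum_filter_not {p ∈ Icc 1 Y | p.Prime} (fun p => p.Coprime m), filter_filter]
    refine add_le_add le_rfl (sum_le_sum_of_subset_of_nonneg (fun p hp => ?_) fun p _ _ =>
      div_nonneg (Real.log_natCast_nonneg p) (Nat.cast_nonneg p))
    simp only [mem_filter] at hp
    refine Nat.mem_primeFactors.2 ⟨hp.1.2, ?_, hm⟩
    by_contra h
    exact hp.2 ((Nat.Prime.coprime_iff_not_dvd hp.1.2).2 h)
  rw [h1, sub_le_iff_le_add]
  calc _ ≤ #(unitsUpTo m N) * ∑ p ∈ Icc 1 Y with p.Prime ∧ p.Coprime m, Real.log p / p := by gcongr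
    _ = ∑ p ∈ Icc 1 Y with p.Prime ∧ p.Coprime m, Real.log p * (#(unitsUpTo m N) / p) := by
        rw [mul_sum]; exact sum_congr rfl fun p _ => by ring
    _ ≤ ∑ p ∈ Icc 1 Y with p.Prime ∧ p.Coprime m, (Real.log p * #{n ∈ unitsUpTo m N | p ∣ n} +
          3 * #m.divisors * Real.log p) := by
        refine sum_le_sum fun p hp => ?_
        have hp' := (mem_filter.1 hp).2
        have := (abs_le.1 (abs_card_unitsUpTo_dvd_sub_le hm hp'.1.pos hp'.2 N)).1
        have h0 := Real.log_natCast_nonneg p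
        nlinarith
    _ ≤ _ := by
        rw [sum_add_distrib, ← mul_sum]
        gcongr
        exact sum_prime_log_le _ (filter_subset _ _)

theorem sum_logSmallPart_sq_le {m : ℕ} (hm : m ≠ 0) (N Y : ℕ) :
    ∑ n ∈ unitsUpTo m N, logSmallPart m Y n ^ 2 ≤
      #(unitsUpTo m N) * (primeLogSum Y ^ 2 + ∑ p ∈ Icc 1 Y with p.Prime, Real.log p ^ 2 / p) +
        3 * #m.divisors * (Y * Real.log Y) ^ 2 := by
  set P : Finset ℕ := {p ∈ Icc 1 Y | p.Prime ∧ p.Coprime m} with hP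
  have hPsub : P ⊆ {p ∈ Icc 1 Y | p.Prime} := fun p hp => by
    simp only [hP, mem_filter] at hp ⊢; exact ⟨hp.1, hp.2.1⟩
  have h1 : ∑ n ∈ unitsUpTo m N, logSmallPart m Y n ^ 2 =
      ∑ p ∈ P, ∑ q ∈ P, Real.log p * Real.log q * #{n ∈ unitsUpTo m N | p ∣ n ∧ q ∣ n} := by
    simp_rw [logSmallPart, sq, sum_mul_sum]
    rw [sum_comm]
    refine sum_congr rfl fun p _ => ?_
    rw [sum_comm]
    refine sum_congr rfl fun q _ => ?_
    rw [mul_comm, ← nsmul_eq_mul, ← sum_const, sum_filter]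
    refine sum_congr rfl fun n _ => ?_
    by_cases h2 : p ∣ n <;> by_cases h3 : q ∣ n <;> simp [h2, h3]
  have h2 : ∀ p ∈ P, ∀ q ∈ P, (#{n ∈ unitsUpTo m N | p ∣ n ∧ q ∣ n} : ℝ) ≤
      #(unitsUpTo m N) * (1 / (p * q) + if p = q then 1 / (p : ℝ) else 0) + 3 * #m.divisors := by
    intro p hp q hq
    have hp' := (mem_filter.1 hp).2
    have hq' := (mem_filter.1 hq).2
    split_ifs with h
    · subst h
      simp only [and_self]
      have := (abs_le.1 (abs_card_unitsUpTo_dvd_sub_le hm hp'.1.pos hp'.2 N)).2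
      have h3 : (0 : ℝ) ≤ #(unitsUpTo m N) * (1 / (p * p)) := by positivity
      rw [mul_add, mul_one_div _ (p : ℝ)]
      linarith
    · have hpq : p.Coprime q := (Nat.coprime_primes hp'.1 hq'.1).2 h
      have := (abs_le.1 (abs_card_unitsUpTo_dvd_sub_le hm (Nat.mul_pos hp'.1.pos hq'.1.pos)
        (hp'.2.mul_left hq'.2) N)).2
      rw [show ({n ∈ unitsUpTo m N | p ∣ n ∧ q ∣ n}) = {n ∈ unitsUpTo m N | p * q ∣ n} from
        filter_congr fun n _ => ⟨fun h => hpq.mul_dvd_of_dvd_of_dvd h.1 h.2,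
          fun h => ⟨(dvd_mul_right _ _).trans h, (dvd_mul_left _ _).trans h⟩⟩]
      push_cast at this
      rw [add_zero, mul_one_div]
      linarith
  rw [h1]
  calc _ ≤ ∑ p ∈ P, ∑ q ∈ P, Real.log p * Real.log q * (#(unitsUpTo m N) *
          (1 / (p * q) + if p = q then 1 / (p : ℝ) else 0) + 3 * #m.divisors) := by
        refine sum_le_sum fun p hp => sum_le_sum fun q hq => ?_
        have := Real.log_natCast_nonneg p
        have := Real.log_natCast_nonneg q
        exact mul_le_mul_of_nonneg_left (h2 p hp q hq) (by positivity)
    _ = #(unitsUpTo m N) * ((∑ p ∈ P, Real.log p / p) ^ 2 + ∑ p ∈ P, Real.log p ^ 2 / p) +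
          3 * #m.divisors * (∑ p ∈ P, Real.log p) ^ 2 := by
        have h3 : ∑ p ∈ P, Real.log p ^ 2 / p =
            ∑ p ∈ P, ∑ q ∈ P, if p = q then Real.log p * Real.log q * (1 / p) else 0 := by
          refine sum_congr rfl fun p hp => ?_
          rw [sum_ite_eq, if_pos hp]; ring
        rw [sq, sq (∑ p ∈ P, Real.log p), sum_mul_sum, sum_mul_sum, h3]
        simp_rw [mul_add, mul_sum, ← sum_add_distrib]
        refine sum_congr rfl fun p _ => sum_congr rfl fun q _ => ?_
        split_ifs <;> ring
    _ ≤ _ := by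
        have hn : ∀ p : ℕ, 0 ≤ Real.log p / p := fun p =>
          div_nonneg (Real.log_natCast_nonneg p) (Nat.cast_nonneg p)
        gcongr
        · exact sum_le_sum_of_subset_of_nonneg hPsub fun p _ _ => hn p
        · exact sum_prime_log_le _ (filter_subset _ _)

/-- Cantelli's inequality for a function with given first and second moment bounds. -/
theorem card_mul_sq_le_of_moments {ι : Type*} (I : Finset ι) (g : ι → ℝ) {M v s t κ : ℝ}
    (hM : 0 < M) (hv : 0 ≤ v) (ht : 0 ≤ t) (hst : 0 < s + t)
    (h1 : #I * (M * (v - κ)) ≤ ∑ n ∈ I, g n)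
    (h2 : ∑ n ∈ I, g n ^ 2 ≤ #I * (M ^ 2 * (3 / 2 * v ^ 2 + κ))) :
    (#{n ∈ I | g n < (v - s) * M} : ℝ) * (s + t) ^ 2 ≤
      #I * (t ^ 2 + v ^ 2 / 2 + (2 * (v + t) + 1) * κ) := by
  have h3 : (#{n ∈ I | g n < (v - s) * M} : ℝ) * ((s + t) * M) ^ 2 ≤
      ∑ n ∈ I, ((v + t) * M - g n) ^ 2 := by
    rw [← nsmul_eq_mul]
    refine (card_nsmul_le_sum _ (fun n => ((v + t) * M - g n) ^ 2) _ fun n hn => ?_).trans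
      (sum_le_sum_of_subset_of_nonneg (filter_subset _ _) fun _ _ _ => sq_nonneg _)
    have := (mem_filter.1 hn).2
    have : (s + t) * M ≤ (v + t) * M - g n := by linarith
    gcongr
  have h4 : ∑ n ∈ I, ((v + t) * M - g n) ^ 2 =
      #I * ((v + t) * M) ^ 2 - 2 * ((v + t) * M) * ∑ n ∈ I, g n + ∑ n ∈ I, g n ^ 2 := by
    simp_rw [sub_sq]
    rw [sum_add_distrib, sum_sub_distrib, sum_const, nsmul_eq_mul, mul_sum]
  have h5 := mul_le_mul_of_nonneg_left h1 (show 0 ≤ 2 * ((v + t) * M) by positivity)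
  have hM2 : 0 < M ^ 2 := by positivity
  refine le_of_mul_le_mul_right ?_ hM2
  nlinarith

end

section

open Finset Filter

theorem eventually_mul_rpow_neg_le_card_unitsUpTo {κ : ℝ} (hκ : 0 < κ) :
    ∀ᶠ m : ℕ in atTop, ∀ N : ℕ, (m : ℝ) ^ κ ≤ N → N * (m : ℝ) ^ (-κ) ≤ #(unitsUpTo m N) := by
  have hκ' : 0 < κ / 3 := by positivity
  filter_upwards [eventually_const_le_rpow 2 hκ', eventually_card_divisors_le hκ' 1,
    eventually_ge_atTop 1] with m h2 hdiv hm1 N hN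
  have hm0 : (0 : ℝ) < m := by exact_mod_cast hm1
  have hτ := hdiv m hm1 (by simp)
  have hτ0 : (0 : ℝ) < #m.divisors := by
    exact_mod_cast card_pos.2 (Nat.nonempty_divisors.2 (by omega))
  have h1 := (abs_le.1 (abs_card_coprime_sub_le (show m ≠ 0 by omega) N)).1
  change _ ≤ (#(unitsUpTo m N) : ℝ) - _ at h1
  set x := (m : ℝ) ^ (κ / 3) with hx
  have hx3 : (m : ℝ) ^ κ = x ^ 3 := by
    rw [hx, ← Real.rpow_natCast, ← Real.rpow_mul hm0.le]; congr 1; push_cast; ring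
  have h3 : 1 / x ≤ (m.totient : ℝ) / m := by
    have h4 : (m : ℝ) ≤ m.totient * #m.divisors := by
      exact_mod_cast Nat.le_totient_mul_card_divisors m
    rw [div_le_div_iff₀ (by positivity) hm0]
    calc 1 * (m : ℝ) ≤ m.totient * #m.divisors := by linarith
      _ ≤ _ := by gcongr
  have h5 : (N : ℝ) * (1 / x) ≤ N * (m.totient / m) := by gcongr
  rw [Real.rpow_neg hm0.le, hx3]
  rw [hx3] at hN
  have hx0 : 0 < x := by linarith
  have h6 : (N : ℝ) * (x ^ 3)⁻¹ ≤ N * (1 / x) - x := by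
    rw [le_sub_iff_add_le, ← div_eq_mul_inv, mul_one_div, div_add' _ _ _ (by positivity),
      div_le_div_iff₀ (by positivity) hx0]
    nlinarith [mul_nonneg (sub_nonneg.2 hN) hx0.le,
      mul_nonneg (mul_nonneg (sub_nonneg.2 hN) hx0.le) (sub_nonneg.2 h2), pow_pos hx0 3,
      mul_nonneg (sub_nonneg.2 h2) (sub_nonneg.2 h2), mul_nonneg (pow_pos hx0 3).le
        (sub_nonneg.2 h2)]
  linarith

theorem eventually_const_le_mul_log (C : ℝ) {κ : ℝ} (hκ : 0 < κ) :
    ∀ᶠ m : ℕ in atTop, C ≤ κ * Real.log m := by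
  filter_upwards [(Real.tendsto_log_atTop.comp
    tendsto_natCast_atTop_atTop).eventually_ge_atTop (C / κ)] with m hm
  rw [← div_le_iff₀' hκ]
  exact hm

theorem eventually_sum_primeFactors_log_div_le {κ : ℝ} (hκ : 0 < κ) :
    ∀ᶠ m : ℕ in atTop, ∑ p ∈ m.primeFactors, Real.log p / p ≤ κ * Real.log m := by
  obtain ⟨z, hz⟩ := exists_nat_gt (2 / κ)
  have hz0 : (0 : ℝ) < z := (by positivity : (0 : ℝ) < 2 / κ).trans hz
  filter_upwards [eventually_const_le_mul_log (Real.log z + Real.log 4) (half_pos hκ),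
    eventually_ge_atTop 1] with m h1 hm1
  have h2 := sum_primeFactors_log_div_le (show m ≠ 0 by omega) (by exact_mod_cast hz0 : 1 ≤ z)
  have h3 : Real.log m / z ≤ κ / 2 * Real.log m := by
    rw [div_le_iff₀ hz0]
    rw [div_lt_iff₀ hκ] at hz
    have := Real.log_natCast_nonneg m
    nlinarith
  linarith

set_option maxHeartbeats 400000 in
theorem eventually_moments_logSmallPart {κ : ℝ} (hκ : 0 < κ) (hκ1 : κ ≤ 1) :
    ∀ᶠ m : ℕ in atTop, ∀ N : ℕ, (m : ℝ) ^ (3 / 8 : ℝ) ≤ N → ∀ v : ℝ, 1 / 8 ≤ v → v ≤ 37 / 200 →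
      #(unitsUpTo m N) * (Real.log m * (v - κ)) ≤
          ∑ n ∈ unitsUpTo m N, logSmallPart m ⌊(m : ℝ) ^ v⌋₊ n ∧
        ∑ n ∈ unitsUpTo m N, logSmallPart m ⌊(m : ℝ) ^ v⌋₊ n ^ 2 ≤
          #(unitsUpTo m N) * (Real.log m ^ 2 * (3 / 2 * v ^ 2 + κ)) := by
  obtain ⟨c, hc⟩ : ∃ c : ℝ, c = κ / 5 := ⟨_, rfl⟩
  have hc0 : 0 < c := by rw [hc]; positivity
  obtain ⟨C₁, hC₁0, hC₁⟩ := exists_log_sub_le_primeLogSum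
  obtain ⟨C₂, hC₂0, hC₂⟩ := exists_sum_log_sq_div_le
  filter_upwards [eventually_const_le_mul_log C₁ hc0, eventually_const_le_mul_log C₂ hc0,
    eventually_const_le_mul_log (Real.log 4) hc0, eventually_const_le_rpow 2 hc0,
    eventually_sum_primeFactors_log_div_le (show 0 < c by positivity),
    eventually_card_divisors_le (show (0 : ℝ) < 1 / 1000 by norm_num) 1,
    eventually_mul_rpow_neg_le_card_unitsUpTo (show (0 : ℝ) < 1 / 1000 by norm_num),
    eventually_const_le_rpow (3 / c) (show (0 : ℝ) < 3 / 1000 by norm_num),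
    eventually_ge_atTop 1] with m hM₁ hM₂ hM4 h2 hpf hdiv hcard h3c hm1 N hN v hv hv'
  have hx : (1 : ℝ) ≤ m := by exact_mod_cast hm1
  have hx0 : (0 : ℝ) < m := by linarith
  have hM0 : 0 ≤ Real.log m := Real.log_natCast_nonneg m
  have hmono : ∀ {a b : ℝ}, a ≤ b → (m : ℝ) ^ a ≤ (m : ℝ) ^ b := fun h =>
    Real.rpow_le_rpow_of_exponent_le hx h
  have hYup : (⌊(m : ℝ) ^ v⌋₊ : ℝ) ≤ (m : ℝ) ^ v := Nat.floor_le (by positivity)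
  have hY1 : 1 ≤ ⌊(m : ℝ) ^ v⌋₊ := Nat.le_floor (by
    rw [Nat.cast_one]; exact Real.one_le_rpow hx (by linarith))
  have hYlow : (m : ℝ) ^ (v - c) ≤ ⌊(m : ℝ) ^ v⌋₊ := by
    rcases le_or_gt c v with h | h
    · exact rpow_sub_le_floor hx h h2
    · exact (Real.rpow_le_one_of_one_le_of_nonpos hx (by linarith)).trans (by exact_mod_cast hY1)
  set Y := ⌊(m : ℝ) ^ v⌋₊ with hYdef
  have hY0 : (0 : ℝ) < Y := by exact_mod_cast hY1
  set M := Real.log m with hM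
  have hlogY : Real.log Y ≤ v * M := by
    rw [hM, ← Real.log_rpow hx0]; exact Real.log_le_log hY0 hYup
  have hlogY' : (v - c) * M ≤ Real.log Y := by
    rw [hM, ← Real.log_rpow hx0]; exact Real.log_le_log (by positivity) hYlow
  have hlogY0 : 0 ≤ Real.log Y := Real.log_natCast_nonneg Y
  have hlogYM : Real.log Y ≤ M := by nlinarith
  set A := primeLogSum Y with hA
  have hA0 : 0 ≤ A := primeLogSum_nonneg Y
  have hAup : A ≤ (v + c) * M := by have := primeLogSum_le hY1; linarith
  have hAlow : (v - 2 * c) * M ≤ A := by have := hC₁ Y hY1; linarith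
  have hW := hC₂ Y hY1
  set I : ℝ := (#(unitsUpTo m N) : ℝ) with hI
  have hI0 : 0 ≤ I := Nat.cast_nonneg _
  have herr : 3 * (#m.divisors : ℝ) * Y ^ 2 ≤ c * I := by
    have h5 : (m : ℝ) ^ (374 / 1000 : ℝ) ≤ I := by
      have h6 := hcard N ((hmono (by norm_num)).trans hN)
      refine le_trans ?_ h6
      calc (m : ℝ) ^ (374 / 1000 : ℝ) = (m : ℝ) ^ (3 / 8 : ℝ) * (m : ℝ) ^ (-(1 / 1000) : ℝ) := by
            rw [← Real.rpow_add hx0]; norm_num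
        _ ≤ _ := by gcongr
    have h6 : (Y : ℝ) ^ 2 ≤ (m : ℝ) ^ (37 / 100 : ℝ) := by
      calc (Y : ℝ) ^ 2 ≤ ((m : ℝ) ^ v) ^ 2 := by gcongr
        _ = (m : ℝ) ^ (v * 2) := by rw [Real.rpow_mul hx0.le]; norm_cast
        _ ≤ _ := hmono (by linarith)
    have h7 : 3 ≤ c * (m : ℝ) ^ (3 / 1000 : ℝ) := by rwa [div_le_iff₀' hc0] at h3c
    calc 3 * (#m.divisors : ℝ) * Y ^ 2
        ≤ c * (m : ℝ) ^ (3 / 1000 : ℝ) * (m : ℝ) ^ (1 / 1000 : ℝ) * (m : ℝ) ^ (37 / 100 : ℝ) := by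
          have := hdiv m hm1 (by simp)
          gcongr
      _ = c * (m : ℝ) ^ (374 / 1000 : ℝ) := by
          rw [mul_assoc, mul_assoc, ← Real.rpow_add hx0, ← Real.rpow_add hx0]; norm_num
      _ ≤ _ := by gcongr
  have hτ0 : (0 : ℝ) ≤ #m.divisors := Nat.cast_nonneg _
  have hY1' : (1 : ℝ) ≤ Y := by exact_mod_cast hY1
  constructor
  · refine le_trans ?_ (le_sum_logSmallPart (show m ≠ 0 by omega) N Y)
    have h5 : 3 * (#m.divisors : ℝ) * (Y * Real.log Y) ≤ c * I * M := by
      calc 3 * (#m.divisors : ℝ) * (Y * Real.log Y) = 3 * (#m.divisors : ℝ) * Y * Real.log Y := by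
            ring
        _ ≤ 3 * (#m.divisors : ℝ) * Y ^ 2 * M := by
            gcongr
            nlinarith
        _ ≤ _ := by gcongr
    have h6 : I * ((v - 3 * c) * M) ≤ I * (A - ∑ p ∈ m.primeFactors, Real.log p / p) := by
      gcongr
      linarith
    have h7 : 0 ≤ I * M := by positivity
    nlinarith
  · refine (sum_logSmallPart_sq_le (show m ≠ 0 by omega) N Y).trans ?_
    have h5 : 3 * (#m.divisors : ℝ) * (Y * Real.log Y) ^ 2 ≤ c * I * M ^ 2 := by
      calc 3 * (#m.divisors : ℝ) * (Y * Real.log Y) ^ 2 =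
            3 * (#m.divisors : ℝ) * Y ^ 2 * Real.log Y ^ 2 := by ring
        _ ≤ _ := by gcongr
    have hc1 : c ≤ 1 / 5 := by linarith
    have h6 : A ^ 2 ≤ (v ^ 2 + c) * M ^ 2 := by
      calc A ^ 2 ≤ ((v + c) * M) ^ 2 := by gcongr
        _ = (v + c) ^ 2 * M ^ 2 := by ring
        _ ≤ _ := by
          have : c * (2 * v + c) ≤ c * 1 := mul_le_mul_of_nonneg_left (by linarith) hc0.le
          exact mul_le_mul_of_nonneg_right (by linarith) (sq_nonneg _)
    have h7 : C₂ * A ≤ c * M ^ 2 := by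
      have : A ≤ M := hAup.trans (by nlinarith)
      calc C₂ * A ≤ c * M * M := by gcongr
        _ = _ := by ring
    have h8 : A ^ 2 + ∑ p ∈ Icc 1 Y with p.Prime, Real.log p ^ 2 / p ≤
        M ^ 2 * (3 / 2 * v ^ 2 + 4 * c) := by
      have : 0 ≤ M ^ 2 * c := by positivity
      nlinarith
    calc _ ≤ I * (M ^ 2 * (3 / 2 * v ^ 2 + 4 * c)) + c * I * M ^ 2 := by gcongr
      _ = I * (M ^ 2 * (3 / 2 * v ^ 2 + κ)) := by rw [hc]; ring

theorem eventually_card_no_divisor_le {κ : ℝ} (hκ : 0 < κ) (hκ1 : κ ≤ 1) :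
    ∀ᶠ m : ℕ in atTop, ∀ N : ℕ, (m : ℝ) ^ (3 / 8 : ℝ) ≤ N → ∀ v s : ℝ, 1 / 8 ≤ v → v ≤ 37 / 200 →
      9 / 100 ≤ s → s ≤ v → 2 * (v - s) ≤ v →
      ∀ D : Finset ℕ, (∀ n ∈ D, n ∈ unitsUpTo m N ∧
        ¬ ∃ d, d ∣ n ∧ (m : ℝ) ^ (v - s) ≤ d ∧ (d : ℝ) ≤ (m : ℝ) ^ v) →
      (#D : ℝ) ≤ #(unitsUpTo m N) * (v ^ 2 / (v ^ 2 + 2 * s ^ 2) + κ) := by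
  obtain ⟨c, hc⟩ : ∃ c : ℝ, c = κ / 250 := ⟨_, rfl⟩
  have hc0 : 0 < c := by rw [hc]; positivity
  filter_upwards [eventually_moments_logSmallPart hc0 (by linarith), eventually_ge_atTop 2]
    with m hmom hm2 N hN v s hv hv' hs hsv hvs D hD
  have hx : (1 : ℝ) < m := by exact_mod_cast hm2
  have hx0 : (0 : ℝ) < m := by linarith
  obtain ⟨h1, h2⟩ := hmom N hN v hv hv'
  have hM0 : 0 < Real.log m := Real.log_pos hx
  set I : ℝ := (#(unitsUpTo m N) : ℝ) with hI
  have hI0 : 0 ≤ I := Nat.cast_nonneg _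
  obtain ⟨t, ht⟩ : ∃ t, t = v ^ 2 / (2 * s) := ⟨_, rfl⟩
  have hs0 : 0 < s := by linarith
  have ht0 : 0 ≤ t := by rw [ht]; positivity
  have hts : v ^ 2 = 2 * s * t := by rw [ht]; field_simp
  have ht2 : t ≤ 1 / 5 := by nlinarith
  have h3 := card_mul_sq_le_of_moments (unitsUpTo m N) _ hM0 (by linarith) ht0
    (by linarith : 0 < s + t) h1 h2
  have h4 : (#D : ℝ) ≤
      #{n ∈ unitsUpTo m N | logSmallPart m ⌊(m : ℝ) ^ v⌋₊ n < (v - s) * Real.log m} := by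
    refine Nat.cast_le.2 (card_le_card fun n hn => ?_)
    obtain ⟨hn1, hn2⟩ := hD n hn
    have hn3 := mem_unitsUpTo.1 hn1
    refine mem_filter.2 ⟨hn1, ?_⟩
    rw [logSmallPart_eq hn3.1.1 hn3.2, ← Real.log_rpow hx0]
    refine Real.log_lt_log ?_ ?_
    · exact_mod_cast prod_pos fun p hp =>
        (Nat.prime_of_mem_primeFactors (mem_filter.1 hp).1).pos
    · by_contra h
      refine hn2 (exists_dvd_of_le_prod_primes (Real.one_le_rpow hx.le (by linarith)) ?_
        (not_lt.1 h))
      calc ((m : ℝ) ^ (v - s)) ^ 2 = (m : ℝ) ^ ((v - s) * 2) := by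
            rw [Real.rpow_mul hx0.le]; norm_cast
        _ ≤ _ := Real.rpow_le_rpow_of_exponent_le hx.le (by linarith)
  have hst : 0 < (s + t) ^ 2 := by positivity
  have h5 : v ^ 2 / (v ^ 2 + 2 * s ^ 2) = t / (s + t) := by
    rw [hts, div_eq_div_iff (by positivity) (by positivity)]; ring
  have h6 : t ^ 2 + v ^ 2 / 2 + (2 * (v + t) + 1) * c ≤ (s + t) ^ 2 * (t / (s + t) + κ) := by
    have h7 : (s + t) ^ 2 * (t / (s + t) + κ) = (s + t) * t + (s + t) ^ 2 * κ := by
      field_simp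
    rw [h7, hts]
    have h8 : (2 * (v + t) + 1) * c ≤ (9 / 100) ^ 2 * κ := by
      rw [hc]; nlinarith
    have h9 : (9 / 100) ^ 2 * κ ≤ (s + t) ^ 2 * κ := by gcongr; linarith
    nlinarith
  rw [h5]
  refine le_of_mul_le_mul_right ?_ hst
  refine (mul_le_mul_of_nonneg_right h4 hst.le).trans (h3.trans ?_)
  rw [mul_assoc, mul_comm (_ + κ)]
  exact mul_le_mul_of_nonneg_left h6 hI0

end

section

open Finset Filter

theorem sum_ratio_le_of_two_mul_gt {v₁ v₂ s₁ s₂ : ℝ} (hv₁ : 1 / 8 ≤ v₁) (hv₁' : v₁ ≤ 37 / 200)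
    (hv₂ : 1 / 8 ≤ v₂) (hv₂' : v₂ ≤ 37 / 200) (hs₁ : 0 < s₁) (hs₁' : s₁ ≤ v₁)
    (hs₂ : 0 < s₂) (hs₂' : s₂ ≤ v₂) (h : 1 / 576 ≤ 2 * s₁ * s₂ - v₁ * v₂) :
    v₁ ^ 2 / (v₁ ^ 2 + 2 * s₁ ^ 2) + v₂ ^ 2 / (v₂ ^ 2 + 2 * s₂ ^ 2) ≤ 1 - 1 / 500 := by
  have hd : ∀ {v s : ℝ}, 1 / 8 ≤ v → v ≤ 37 / 200 → 0 < s → s ≤ v →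
      0 < v ^ 2 + 2 * s ^ 2 ∧ v ^ 2 + 2 * s ^ 2 ≤ 103 / 1000 := fun {v s} h1 h2 h3 h4 => by
    have h5 : v ^ 2 ≤ (37 / 200) ^ 2 := by gcongr
    have h6 : s ^ 2 ≤ v ^ 2 := by gcongr
    constructor
    · positivity
    · linarith
  obtain ⟨p₁, q₁⟩ := hd hv₁ hv₁' hs₁ hs₁'
  obtain ⟨p₂, q₂⟩ := hd hv₂ hv₂' hs₂ hs₂'
  rw [div_add_div _ _ p₁.ne' p₂.ne', div_le_iff₀ (mul_pos p₁ p₂)]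
  have h1 : (v₁ ^ 2 + 2 * s₁ ^ 2) * (v₂ ^ 2 + 2 * s₂ ^ 2) ≤ 103 / 1000 * (103 / 1000) := by gcongr
  have h2 : 1 / 64 ≤ v₁ * v₂ := by
    calc (1 / 64 : ℝ) = 1 / 8 * (1 / 8) := by norm_num
      _ ≤ _ := by gcongr
  have h3 : 1 / 576 * (1 / 32) ≤ (2 * s₁ * s₂ - v₁ * v₂) * (2 * s₁ * s₂ + v₁ * v₂) := by
    gcongr
    linarith
  nlinarith

theorem exponents_of_sum_le {u₁ u₂ : ℝ} (h₁ : 0 ≤ u₁) (h₂ : 0 ≤ u₂) (h : u₁ + u₂ ≤ 1 / 12) :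
    ∃ v₁ v₂ : ℝ, v₁ + v₂ = 1 / 4 + (u₁ + u₂) ∧
      (1 / 8 ≤ v₁ ∧ v₁ ≤ 37 / 200 ∧ 9 / 100 ≤ v₁ - u₁ ∧ v₁ - u₁ ≤ v₁ ∧ 2 * u₁ ≤ v₁) ∧
      (1 / 8 ≤ v₂ ∧ v₂ ≤ 37 / 200 ∧ 9 / 100 ≤ v₂ - u₂ ∧ v₂ - u₂ ≤ v₂ ∧ 2 * u₂ ≤ v₂) ∧
      v₁ ^ 2 / (v₁ ^ 2 + 2 * (v₁ - u₁) ^ 2) + v₂ ^ 2 / (v₂ ^ 2 + 2 * (v₂ - u₂) ^ 2) ≤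
        1 - 1 / 500 := by
  refine ⟨1 / 8 + (u₁ + u₂) / 3 + u₁ / 3, 1 / 8 + (u₁ + u₂) / 3 + u₂ / 3, by ring,
    ⟨by linarith, by linarith, by linarith, by linarith, by linarith⟩,
    ⟨by linarith, by linarith, by linarith, by linarith, by linarith⟩,
    sum_ratio_le_of_two_mul_gt (by linarith) (by linarith) (by linarith) (by linarith)
      (by linarith) (by linarith) (by linarith) (by linarith) ?_⟩
  have h3 : (1 / 8 : ℝ) * (1 / 72) ≤
      (1 / 8 + (u₁ + u₂) / 3) * (1 / 8 - 4 * (u₁ + u₂) / 3) := by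
    gcongr <;> linarith
  have h4 := mul_nonneg h₁ h₂
  nlinarith

/-- Residue classes represented by `x₁ x₂ x₃` with `1 ≤ x_j ≤ N_j`. -/
def IsBoxProduct {m : ℕ} (N₁ N₂ N₃ : ℕ) (a : ZMod m) : Prop :=
  ∃ x₁ x₂ x₃ : ℕ, x₁ ∈ Icc 1 N₁ ∧ x₂ ∈ Icc 1 N₂ ∧ x₃ ∈ Icc 1 N₃ ∧
    a = ((x₁ * x₂ * x₃ : ℕ) : ZMod m)

theorem IsBoxProduct.swap_left {m N₁ N₂ N₃ : ℕ} {a : ZMod m} (h : IsBoxProduct N₁ N₂ N₃ a) :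
    IsBoxProduct N₂ N₁ N₃ a := by
  obtain ⟨x₁, x₂, x₃, h₁, h₂, h₃, h⟩ := h
  exact ⟨x₂, x₁, x₃, h₂, h₁, h₃, by rw [h, mul_comm x₁]⟩

theorem IsBoxProduct.swap_right {m N₁ N₂ N₃ : ℕ} {a : ZMod m} (h : IsBoxProduct N₁ N₂ N₃ a) :
    IsBoxProduct N₁ N₃ N₂ a := by
  obtain ⟨x₁, x₂, x₃, h₁, h₂, h₃, h⟩ := h
  exact ⟨x₁, x₃, x₂, h₁, h₃, h₂, by rw [h, mul_right_comm]⟩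

theorem isBoxProduct_tupleProd_of_le {m y N₁ N₂ N₃ J : ℕ} {w : ℕ × ℕ × (Fin J → ℕ)}
    {e₁ e₂ e₃ : ℕ} (hw : ∀ i, w.2.2 i ∈ Icc 1 y) (h : w.1 * w.2.1 = e₁ * e₂ * e₃)
    (h₁ : e₁ ∈ Icc 1 N₁) (h₂ : e₂ ∈ Icc 1 N₂) (h₃ : e₃ ∈ Icc 1 N₃)
    (hN : w.1 * w.2.1 * y ^ (J + 2) ≤ N₁ * N₂ * N₃) :
    IsBoxProduct N₁ N₂ N₃ ((tupleProd w : ℕ) : ZMod m) := by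
  rw [h] at hN
  obtain ⟨x₁, x₂, x₃, a₁, a₂, a₃, hx⟩ := exists_mul_eq_of_mul_pow_le J w.2.2 e₁ e₂ e₃ hw h₁ h₂ h₃ hN
  exact ⟨x₁, x₂, x₃, a₁, a₂, a₃, by rw [tupleProd, h, hx]⟩

theorem card_tuple_filter_le_add {J : ℕ} {I K D₁ D₂ : Finset ℕ} (P : ℕ → Prop)
    [DecidablePred P]
    (h : ∀ w ∈ tupleSet I I K J, P (tupleProd w) → w.1 ∈ D₁ ∨ w.2.1 ∈ D₂) :
    #{w ∈ tupleSet I I K J | P (tupleProd w)} ≤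
      #{w ∈ tupleSet D₁ I K J | P (tupleProd w)} + #{w ∈ tupleSet D₂ I K J | P (tupleProd w)} := by
  have hswap : #{w ∈ tupleSet I D₂ K J | P (tupleProd w)} ≤
      #{w ∈ tupleSet D₂ I K J | P (tupleProd w)} := by
    refine card_le_card_of_injOn (fun w => (w.2.1, w.1, w.2.2)) (fun w hw => ?_) ?_
    · obtain ⟨h1, h2⟩ := mem_filter.1 (mem_coe.1 hw)
      obtain ⟨h3, h4, h5⟩ := mem_tupleSet.1 h1
      refine mem_coe.2 (mem_filter.2 ⟨mem_tupleSet.2 ⟨h4, h3, h5⟩, ?_⟩)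
      simpa [tupleProd, mul_comm w.2.1] using h2
    · rintro ⟨a, b, c⟩ - ⟨a', b', c'⟩ - h
      simp only [Prod.mk.injEq] at h ⊢
      tauto
  refine le_trans (le_trans (card_le_card fun w hw => ?_) (card_union_le _ _))
    (Nat.add_le_add_left hswap _)
  obtain ⟨h1, h2⟩ := mem_filter.1 hw
  obtain ⟨h3, h4, h5⟩ := mem_tupleSet.1 h1
  rcases h w h1 h2 with h6 | h6
  · exact mem_union_left _ (mem_filter.2 ⟨mem_tupleSet.2 ⟨h6, h4, h5⟩, h2⟩)
  · exact mem_union_right _ (mem_filter.2 ⟨mem_tupleSet.2 ⟨h3, h6, h5⟩, h2⟩)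

theorem le_of_mul_le_sqrt {α c C x κ δ : ℝ} (hα : 0 ≤ α) (hc : 0 < c) (hx : 0 < x)
    (h : c * α * x ^ (-κ) ≤ C * √α * x ^ (-δ)) : α ≤ (C / c) ^ 2 * x ^ (2 * (κ - δ)) := by
  rcases hα.eq_or_lt with rfl | hα'
  · positivity
  have hs : 0 < √α := Real.sqrt_pos.2 hα'
  have hss : √α * √α = α := Real.mul_self_sqrt hα
  have h1 : √α ≤ C / c * x ^ (κ - δ) := by
    have h2 : x ^ (κ - δ) = x ^ κ * x ^ (-δ) := by rw [← Real.rpow_add hx]; rfl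
    have h3 : x ^ κ * x ^ (-κ) = 1 := by rw [← Real.rpow_add hx]; simp
    have h4 : c * √α ≤ C * x ^ (κ - δ) := by
      refine le_of_mul_le_mul_right ?_ hs
      have hk : 0 < x ^ κ := by positivity
      calc c * √α * √α = c * α * (x ^ κ * x ^ (-κ)) := by rw [h3, mul_assoc, hss, mul_one]
        _ = x ^ κ * (c * α * x ^ (-κ)) := by ring
        _ ≤ x ^ κ * (C * √α * x ^ (-δ)) := by gcongr
        _ = _ := by rw [h2]; ring
    rw [div_mul_eq_mul_div, le_div_iff₀ hc]
    linarith
  calc α = √α ^ 2 := (Real.sq_sqrt hα).symm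
    _ ≤ (C / c * x ^ (κ - δ)) ^ 2 := by gcongr
    _ = _ := by
      rw [mul_pow, ← Real.rpow_natCast (x ^ _), ← Real.rpow_mul hx.le]
      norm_num [mul_comm]

/-- Bounds for the number of tuples in terms of the size parameters. -/
theorem eventually_floor_bounds {ε η ω : ℝ} {a j : ℕ} (hε : 0 < ε) (hη : 0 < η)
    (hω : 3 / 8 * a + ω = 1) (ha : 0 < a) (hj : ω ≤ j * η) (hj' : j * η ≤ ω + η) :
    ∀ᶠ m : ℕ in atTop,
      m ≤ ⌊(m : ℝ) ^ (3 / 8 + ε)⌋₊ ^ a * ⌊(m : ℝ) ^ η⌋₊ ^ j ∧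
      ((⌊(m : ℝ) ^ (3 / 8 + ε)⌋₊ ^ a * ⌊(m : ℝ) ^ η⌋₊ ^ (j + 3) : ℕ) : ℝ) ≤
        (m : ℝ) ^ (1 + (a * ε + 4 * η)) := by
  have ha' : (1 : ℝ) ≤ a := by exact_mod_cast ha
  obtain ⟨κ, hκ⟩ : ∃ κ, κ = min (min ε η) (ε / (a + j)) := ⟨_, rfl⟩
  have hκ0 : 0 < κ := by rw [hκ]; positivity
  have hκε : κ ≤ ε := hκ.trans_le ((min_le_left _ _).trans (min_le_left _ _))
  have hκη : κ ≤ η := hκ.trans_le ((min_le_left _ _).trans (min_le_right _ _))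
  have hκj : κ * (a + j) ≤ ε := by
    rw [← le_div_iff₀ (by positivity)]; exact hκ.trans_le (min_le_right _ _)
  filter_upwards [eventually_const_le_rpow 2 hκ0, eventually_ge_atTop 1] with m h2 hm1
  have hx : (1 : ℝ) ≤ m := by exact_mod_cast hm1
  have hx0 : (0 : ℝ) < m := by linarith
  have h3 := rpow_sub_le_floor hx (κ := κ) (θ := 3 / 8 + ε) (by linarith) h2
  have h4 := rpow_sub_le_floor hx (κ := κ) (θ := η) hκη h2
  have h5 : (⌊(m : ℝ) ^ (3 / 8 + ε)⌋₊ : ℝ) ≤ (m : ℝ) ^ (3 / 8 + ε) := Nat.floor_le (by positivity)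
  have h6 : (⌊(m : ℝ) ^ η⌋₊ : ℝ) ≤ (m : ℝ) ^ η := Nat.floor_le (by positivity)
  have hpow : ∀ (θ ρ : ℝ) (b c : ℕ), ((m : ℝ) ^ θ) ^ b * ((m : ℝ) ^ ρ) ^ c =
      (m : ℝ) ^ (θ * b + ρ * c) := fun θ ρ b c => by
    rw [Real.rpow_add hx0, Real.rpow_mul hx0.le, Real.rpow_mul hx0.le, Real.rpow_natCast,
      Real.rpow_natCast]
  have hεa : ε ≤ ε * a := le_mul_of_one_le_right hε.le ha'
  constructor
  · have : (m : ℝ) ≤ ((⌊(m : ℝ) ^ (3 / 8 + ε)⌋₊ ^ a * ⌊(m : ℝ) ^ η⌋₊ ^ j : ℕ) : ℝ) := by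
      push_cast
      calc (m : ℝ) = (m : ℝ) ^ (1 : ℝ) := (Real.rpow_one _).symm
        _ ≤ (m : ℝ) ^ ((3 / 8 + ε - κ) * a + (η - κ) * j) :=
            Real.rpow_le_rpow_of_exponent_le hx (by linarith)
        _ = _ := (hpow _ _ _ _).symm
        _ ≤ _ := by gcongr
    exact_mod_cast this
  · push_cast
    calc _ ≤ ((m : ℝ) ^ (3 / 8 + ε)) ^ a * ((m : ℝ) ^ η) ^ (j + 3) := by gcongr
      _ = _ := hpow _ _ _ _
      _ ≤ _ := Real.rpow_le_rpow_of_exponent_le hx (by push_cast; linarith)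

theorem exists_nat_mul_mem {ω η : ℝ} (hω : 0 ≤ ω) (hη : 0 < η) :
    ∃ j : ℕ, ω ≤ j * η ∧ j * η ≤ ω + η := by
  refine ⟨⌈ω / η⌉₊, (div_le_iff₀ hη).1 (Nat.le_ceil _), ?_⟩
  have := (Nat.ceil_lt_add_one (div_nonneg hω hη.le)).le
  calc _ ≤ (ω / η + 1) * η := by gcongr
    _ = _ := by field_simp

end

section

open Finset Filter

theorem density_le_of_count_le {α c C x κ δ A B I K : ℝ} {a k : ℕ} (hα : 0 ≤ α) (hc : 0 < c)
    (hx : 1 ≤ x) (hA : 0 < A) (hB : 0 < B) (hI : A * x ^ (-κ) ≤ I) (hK : B * x ^ (-κ) ≤ K)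
    (hκ : (a + k) * κ ≤ δ / 2)
    (h : c * (I ^ a * K ^ k) * α ≤ C * (A ^ a * B ^ k) * √α * x ^ (-δ)) :
    α ≤ (C / c) ^ 2 * x ^ (-δ) := by
  have hx0 : 0 < x := by linarith
  have hI0 : 0 ≤ I := le_trans (by positivity) hI
  have hp : x ^ (-((a + k) * κ)) = (x ^ (-κ)) ^ a * (x ^ (-κ)) ^ k := by
    rw [← pow_add, ← Real.rpow_mul_natCast hx0.le]
    push_cast
    congr 1
    ring
  have hIK : A ^ a * B ^ k * x ^ (-((a + k) * κ)) ≤ I ^ a * K ^ k := by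
    calc A ^ a * B ^ k * x ^ (-((a + k) * κ)) = (A * x ^ (-κ)) ^ a * (B * x ^ (-κ)) ^ k := by
          rw [hp, mul_pow, mul_pow]; ring
      _ ≤ I ^ a * K ^ k := by gcongr
  have hAB : 0 < A ^ a * B ^ k := by positivity
  have h1 : c * α * x ^ (-((a + k) * κ)) ≤ C * √α * x ^ (-δ) := by
    refine le_of_mul_le_mul_left ?_ hAB
    calc A ^ a * B ^ k * (c * α * x ^ (-((a + k) * κ)))
        = c * α * (A ^ a * B ^ k * x ^ (-((a + k) * κ))) := by ring
      _ ≤ c * α * (I ^ a * K ^ k) := mul_le_mul_of_nonneg_left hIK (by positivity)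
      _ = c * (I ^ a * K ^ k) * α := by ring
      _ ≤ _ := h
      _ = _ := by ring
  refine (le_of_mul_le_sqrt hα hc hx0 h1).trans ?_
  exact mul_le_mul_of_nonneg_left (Real.rpow_le_rpow_of_exponent_le hx (by linarith))
    (by positivity)

theorem exists_eq_mul_of_div_le {n N₀ N d : ℕ} (hn : 1 ≤ n) (hnN : n ≤ N₀) (hN : 0 < N)
    (hd : d ∣ n) (h : (N₀ / N : ℝ) ≤ d) : 1 ≤ d ∧ ∃ e ∈ Icc 1 N, n = e * d := by
  obtain ⟨e, rfl⟩ := hd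
  have hd0 : 0 < d := Nat.pos_of_ne_zero fun h => by simp [h] at hn
  have he0 : 0 < e := Nat.pos_of_ne_zero fun h => by simp [h] at hn
  refine ⟨hd0, e, mem_Icc.2 ⟨he0, ?_⟩, mul_comm _ _⟩
  rw [div_le_iff₀ (by exact_mod_cast hN)] at h
  have h' : N₀ ≤ d * N := by exact_mod_cast h
  exact Nat.le_of_mul_le_mul_left (hnN.trans h') hd0

theorem exists_exponents_of_rpow_lt {x N₀ N₁ N₂ N₃ ε : ℝ} (hx : 1 < x) (hε : 0 < ε)
    (h₃ : 0 < N₃) (h₃₂ : N₃ ≤ N₂) (h₂₁ : N₂ ≤ N₁) (h₁₀ : N₁ ≤ N₀)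
    (hN₀ : N₀ ≤ x ^ (3 / 8 + ε / 3)) (h : x ^ (1 + ε) < N₁ * N₂ * N₃) :
    ∃ u₁ u₂ : ℝ, 0 ≤ u₁ ∧ 0 ≤ u₂ ∧ u₁ + u₂ ≤ 1 / 12 ∧ x ^ u₁ = N₀ / N₁ ∧ x ^ u₂ = N₀ / N₂ ∧
      x ^ (1 / 4 + (u₁ + u₂)) ≤ N₃ := by
  have hx0 : 0 < x := by linarith
  have h₂ : 0 < N₂ := h₃.trans_le h₃₂
  have h₁ : 0 < N₁ := h₂.trans_le h₂₁
  have h₀ : 0 < N₀ := h₁.trans_le h₁₀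
  have e₁ : x ^ Real.logb x (N₀ / N₁) = N₀ / N₁ :=
    Real.rpow_logb hx0 hx.ne' (by positivity)
  have e₂ : x ^ Real.logb x (N₀ / N₂) = N₀ / N₂ :=
    Real.rpow_logb hx0 hx.ne' (by positivity)
  have hsq : N₀ * N₀ ≤ x ^ (3 / 4 + 2 * ε / 3) := by
    calc N₀ * N₀ ≤ x ^ (3 / 8 + ε / 3) * x ^ (3 / 8 + ε / 3) := by gcongr
      _ = _ := by rw [← Real.rpow_add hx0]; congr 1; ring
  have e₃ : x ^ (Real.logb x (N₀ / N₁) + Real.logb x (N₀ / N₂)) = N₀ * N₀ / (N₁ * N₂) := by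
    rw [Real.rpow_add hx0, e₁, e₂]; field_simp
  have h12 : x ^ (2 * (1 + ε) / 3) ≤ N₁ * N₂ := by
    refine le_of_pow_le_pow_left₀ (n := 3) (by norm_num) (by positivity) ?_
    calc (x ^ (2 * (1 + ε) / 3)) ^ 3 = (x ^ (1 + ε)) ^ 2 := by
          rw [← Real.rpow_mul_natCast hx0.le, ← Real.rpow_mul_natCast hx0.le]
          congr 1; push_cast; ring
      _ ≤ (N₁ * N₂ * N₃) ^ 2 := by gcongr
      _ = (N₁ * N₂) ^ 2 * (N₃ * N₃) := by ring
      _ ≤ (N₁ * N₂) ^ 2 * (N₁ * N₂) := by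
          have : N₃ ≤ N₁ := h₃₂.trans h₂₁
          gcongr
      _ = _ := by ring
  refine ⟨_, _, Real.logb_nonneg hx ?_, Real.logb_nonneg hx ?_, ?_, e₁, e₂, ?_⟩
  · rwa [le_div_iff₀ h₁, one_mul]
  · rw [le_div_iff₀ h₂, one_mul]; exact h₂₁.trans h₁₀
  · rw [← Real.rpow_le_rpow_left_iff hx, e₃, div_le_iff₀ (by positivity)]
    calc N₀ * N₀ ≤ x ^ (3 / 4 + 2 * ε / 3) := hsq
      _ = x ^ (1 / 12 : ℝ) * x ^ (2 * (1 + ε) / 3) := by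
          rw [← Real.rpow_add hx0]; congr 1; ring
      _ ≤ _ := by gcongr
  · rw [Real.rpow_add hx0, e₃, mul_div_assoc', div_le_iff₀ (by positivity)]
    calc x ^ (1 / 4 : ℝ) * (N₀ * N₀) ≤ x ^ (1 / 4 : ℝ) * x ^ (3 / 4 + 2 * ε / 3) := by gcongr
      _ = x ^ (1 + 2 * ε / 3) := by rw [← Real.rpow_add hx0]; congr 1; ring
      _ ≤ x ^ (1 + ε) := Real.rpow_le_rpow_of_exponent_le hx.le (by linarith)
      _ ≤ N₁ * N₂ * N₃ := h.le
      _ = _ := by ring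

end

section

open Finset Filter

theorem exists_density_le_of_floor_le {ε : ℝ} (hε : 0 < ε) (hε8 : ε ≤ 1 / 8) :
    ∃ δ : ℝ, 0 < δ ∧ ∀ᶠ m : ℕ in atTop, ∀ _ : NeZero m, ∀ N₁ N₂ N₃ : ℕ, 0 < N₂ → 0 < N₃ →
      (m : ℝ) ^ (1 + ε) < ((N₁ * N₂ * N₃ : ℕ) : ℝ) → ⌊(m : ℝ) ^ (3 / 8 + ε / 3)⌋₊ ≤ N₁ →
      ∀ E : Finset (ZMod m)ˣ, (∀ e ∈ E, ¬ IsBoxProduct N₁ N₂ N₃ (e : ZMod m)) →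
      (#E / m.totient : ℝ) ≤ (m : ℝ) ^ (-δ) := by
  classical
  have hη : 0 < ε / 16 := by positivity
  obtain ⟨j, hj, hj'⟩ := exists_nat_mul_mem (ω := 5 / 8) (by norm_num) hη
  obtain ⟨δ, hδ, hmain⟩ := exists_abs_card_tuple_sub_le (ε := ε / 3) (η := ε / 16)
    (by positivity) (by linarith) hη (by linarith) j
  obtain ⟨κ, hκ⟩ : ∃ κ, κ = min (ε / 32) (δ / (2 * (j + 2))) := ⟨_, rfl⟩
  have hκ0 : 0 < κ := by rw [hκ]; positivity
  have hκη : κ ≤ ε / 32 := hκ.trans_le (min_le_left _ _)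
  have hκδ : (j + 2) * κ ≤ δ / 2 := by
    have h1 : κ ≤ δ / (2 * (j + 2)) := hκ.trans_le (min_le_right _ _)
    rw [le_div_iff₀ (by positivity)] at h1
    linarith
  refine ⟨δ, hδ, ?_⟩
  filter_upwards [hmain, eventually_mul_rpow_neg_le_card_unitsUpTo hκ0,
    eventually_floor_bounds (ε := ε / 3) (η := ε / 16) (ω := 5 / 8) (a := 1) (j := j)
      (by positivity) hη (by norm_num) one_pos hj hj',
    eventually_const_le_rpow 2 (κ := ε / 32) (by positivity), eventually_ge_atTop 1]
    with m hm hu hfl h2 hm1 _ N₁ N₂ N₃ h₂ h₃ hN hN₁ E hE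
  have hx : (1 : ℝ) ≤ m := by exact_mod_cast hm1
  have hx0 : (0 : ℝ) < m := by linarith
  obtain ⟨N₀, hN₀⟩ : ∃ N₀, N₀ = ⌊(m : ℝ) ^ (3 / 8 + ε / 3)⌋₊ := ⟨_, rfl⟩
  obtain ⟨y, hy⟩ : ∃ y, y = ⌊(m : ℝ) ^ (ε / 16)⌋₊ := ⟨_, rfl⟩
  rw [← hN₀] at hN₁
  rw [← hN₀, ← hy] at hfl
  specialize hm inferInstance E 1 {1} (fun s hs => by rw [mem_singleton.1 hs]; simp) hm1
    (by rw [← hN₀, ← hy]; simpa using hfl.1)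
  rw [← hN₀, ← hy] at hm
  have hyκ : (m : ℝ) ^ κ ≤ y := by
    rw [hy]
    refine le_trans ?_ (rpow_sub_le_floor hx (κ := ε / 32) (by linarith) h2)
    exact Real.rpow_le_rpow_of_exponent_le hx (by linarith)
  have hNκ : (m : ℝ) ^ κ ≤ N₀ := by
    rw [hN₀]
    refine le_trans ?_ (rpow_sub_le_floor hx (κ := ε / 32) (by linarith) h2)
    exact Real.rpow_le_rpow_of_exponent_le hx (by linarith)
  have hbox : #{w ∈ tupleSet {1} (unitsUpTo m N₀) (unitsUpTo m y) (j + 1) |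
      ∃ e ∈ E, (e : ZMod m) = (tupleProd w : ℕ)} = 0 := by
    rw [card_eq_zero, filter_eq_empty_iff]
    rintro w hw ⟨e, he, hew⟩
    obtain ⟨hw₁, hw₂, hw₃⟩ := mem_tupleSet.1 hw
    have hn := (mem_unitsUpTo.1 hw₂).1
    rw [mem_singleton] at hw₁
    refine hE e he ?_
    rw [hew]
    refine isBoxProduct_tupleProd_of_le (y := y) (e₁ := w.2.1) (e₂ := 1) (e₃ := 1)
      (fun i => mem_Icc.2 (mem_unitsUpTo.1 (hw₃ i)).1) (by rw [hw₁]; ring)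
      (mem_Icc.2 ⟨hn.1, hn.2.trans hN₁⟩) (mem_Icc.2 ⟨le_rfl, h₂⟩) (mem_Icc.2 ⟨le_rfl, h₃⟩) ?_
    have h4 : N₀ ^ 1 * y ^ (j + 3) ≤ N₁ * N₂ * N₃ := by
      have h5 := hfl.2.trans ((Real.rpow_le_rpow_of_exponent_le hx (by
        push_cast; linarith)).trans hN.le)
      exact_mod_cast h5
    refine le_trans ?_ h4
    rw [hw₁, one_mul, pow_one]
    exact Nat.mul_le_mul_right _ hn.2
  rw [hbox, card_singleton] at hm
  have hpos : ∀ {N : ℕ}, (m : ℝ) ^ κ ≤ N → (0 : ℝ) < N := fun h =>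
    lt_of_lt_of_le (by positivity) h
  have key := density_le_of_count_le (α := #E / m.totient) (c := 1) (C := 1) (a := 1)
    (k := j + 1) (δ := δ) (by positivity) one_pos hx (hpos hNκ) (hpos hyκ)
    (hu N₀ hNκ) (hu y hyκ) (by push_cast; linarith) (by
      have h6 := neg_le.1 (abs_le.1 hm).1
      push_cast at h6 ⊢
      linarith)
  simpa using key

end

section

open Finset Filter

theorem mul_le_of_abs_sub_le {c₀ c₁ c₂ s t₁ t₂ R T α : ℝ} (h : c₀ ≤ c₁ + c₂)
    (hc₀ : |c₀ - s * T * α| ≤ R) (hc₁ : |c₁ - t₁ * T * α| ≤ R) (hc₂ : |c₂ - t₂ * T * α| ≤ R)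
    (hT : 0 ≤ T) (hα : 0 ≤ α) (ht : t₁ + t₂ ≤ (1 - 1 / 1000) * s) :
    1 / 1000 * (s * T) * α ≤ 3 * R := by
  have h0 := (abs_le.1 hc₀).1
  have h1 := (abs_le.1 hc₁).2
  have h2 := (abs_le.1 hc₂).2
  have h3 : (t₁ + t₂) * (T * α) ≤ (1 - 1 / 1000) * s * (T * α) :=
    mul_le_mul_of_nonneg_right ht (by positivity)
  linarith

theorem isBoxProduct_tupleProd_of_dvd {m y N₀ N₁ N₂ N₃ J d₁ d₂ : ℕ} {w : ℕ × ℕ × (Fin J → ℕ)}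
    (hw : ∀ i, w.2.2 i ∈ Icc 1 y) (hw₁ : 1 ≤ w.1 ∧ w.1 ≤ N₀) (hw₂ : 1 ≤ w.2.1 ∧ w.2.1 ≤ N₀)
    (h₁ : 0 < N₁) (h₂ : 0 < N₂) (hd₁ : d₁ ∣ w.1) (hd₂ : d₂ ∣ w.2.1)
    (hdN₁ : (N₀ / N₁ : ℝ) ≤ d₁) (hdN₂ : (N₀ / N₂ : ℝ) ≤ d₂) (hd : d₁ * d₂ ≤ N₃)
    (hN : N₀ ^ 2 * y ^ (J + 2) ≤ N₁ * N₂ * N₃) :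
    IsBoxProduct N₁ N₂ N₃ ((tupleProd w : ℕ) : ZMod m) := by
  obtain ⟨hd₁0, e₁, he₁, hwe₁⟩ := exists_eq_mul_of_div_le hw₁.1 hw₁.2 h₁ hd₁ hdN₁
  obtain ⟨hd₂0, e₂, he₂, hwe₂⟩ := exists_eq_mul_of_div_le hw₂.1 hw₂.2 h₂ hd₂ hdN₂
  refine isBoxProduct_tupleProd_of_le (y := y) (e₁ := e₁) (e₂ := e₂) (e₃ := d₁ * d₂) hw
    (by rw [hwe₁, hwe₂]; ring) he₁ he₂ (mem_Icc.2 ⟨Nat.mul_pos hd₁0 hd₂0, hd⟩)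
    (le_trans ?_ hN)
  rw [pow_two]
  exact Nat.mul_le_mul_right _ (Nat.mul_le_mul hw₁.2 hw₂.2)

set_option maxHeartbeats 800000 in
theorem exists_density_le_of_lt_floor {ε : ℝ} (hε : 0 < ε) (hε8 : ε ≤ 1 / 8) :
    ∃ δ : ℝ, 0 < δ ∧ ∀ᶠ m : ℕ in atTop, ∀ _ : NeZero m, ∀ N₁ N₂ N₃ : ℕ, 0 < N₃ → N₃ ≤ N₂ →
      N₂ ≤ N₁ → (m : ℝ) ^ (1 + ε) < ((N₁ * N₂ * N₃ : ℕ) : ℝ) →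
      N₁ ≤ ⌊(m : ℝ) ^ (3 / 8 + ε / 3)⌋₊ →
      ∀ E : Finset (ZMod m)ˣ, (∀ e ∈ E, ¬ IsBoxProduct N₁ N₂ N₃ (e : ZMod m)) →
      (#E / m.totient : ℝ) ≤ 3000 ^ 2 * (m : ℝ) ^ (-δ) := by
  classical
  have hη : 0 < ε / 16 := by positivity
  obtain ⟨j, hj, hj'⟩ := exists_nat_mul_mem (ω := 1 / 4) (by norm_num) hη
  obtain ⟨δ, hδ, hmain⟩ := exists_abs_card_tuple_sub_le (ε := ε / 3) (η := ε / 16)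
    (by positivity) (by linarith) hη (by linarith) j
  obtain ⟨κ, hκ⟩ : ∃ κ, κ = min (ε / 32) (δ / (2 * (j + 3))) := ⟨_, rfl⟩
  have hκ0 : 0 < κ := by rw [hκ]; positivity
  have hκη : κ ≤ ε / 32 := hκ.trans_le (min_le_left _ _)
  have hκδ : (j + 3) * κ ≤ δ / 2 := by
    have h1 : κ ≤ δ / (2 * (j + 3)) := hκ.trans_le (min_le_right _ _)
    rw [le_div_iff₀ (by positivity)] at h1
    linarith
  refine ⟨δ, hδ, ?_⟩
  filter_upwards [hmain, eventually_mul_rpow_neg_le_card_unitsUpTo hκ0,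
    eventually_floor_bounds (ε := ε / 3) (η := ε / 16) (ω := 1 / 4) (a := 2) (j := j)
      (by positivity) hη (by norm_num) two_pos hj hj',
    eventually_const_le_rpow 2 (κ := ε / 32) (by positivity),
    eventually_card_no_divisor_le (κ := 1 / 2000) (by norm_num) (by norm_num),
    eventually_gt_atTop 1]
    with m hm hu hfl h2 hdiv hm1 _ N₁ N₂ N₃ h₃ h₃₂ h₂₁ hN hN₁ E hE
  have hx1 : (1 : ℝ) < m := by exact_mod_cast hm1
  have hx : (1 : ℝ) ≤ m := hx1.le
  have hx0 : (0 : ℝ) < m := by linarith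
  obtain ⟨N₀, hN₀⟩ : ∃ N₀, N₀ = ⌊(m : ℝ) ^ (3 / 8 + ε / 3)⌋₊ := ⟨_, rfl⟩
  obtain ⟨y, hy⟩ : ∃ y, y = ⌊(m : ℝ) ^ (ε / 16)⌋₊ := ⟨_, rfl⟩
  have hN₀le : (N₀ : ℝ) ≤ (m : ℝ) ^ (3 / 8 + ε / 3) := by
    rw [hN₀]; exact Nat.floor_le (by positivity)
  rw [← hN₀] at hN₁
  rw [← hN₀, ← hy] at hfl
  have h₂ : 0 < N₂ := h₃.trans_le h₃₂
  have h₁ : 0 < N₁ := h₂.trans_le h₂₁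
  have hyκ : (m : ℝ) ^ κ ≤ y := by
    rw [hy]
    refine le_trans ?_ (rpow_sub_le_floor hx (κ := ε / 32) (by linarith) h2)
    exact Real.rpow_le_rpow_of_exponent_le hx (by linarith)
  have hN₀ge : (m : ℝ) ^ (3 / 8 : ℝ) ≤ N₀ := by
    rw [hN₀]
    refine le_trans ?_ (rpow_sub_le_floor hx (κ := ε / 32) (by linarith) h2)
    exact Real.rpow_le_rpow_of_exponent_le hx (by linarith)
  have hNκ : (m : ℝ) ^ κ ≤ N₀ :=
    (Real.rpow_le_rpow_of_exponent_le hx (by linarith)).trans hN₀ge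
  have hN₀m : N₀ ≤ m := by
    have h4 := hN₀le.trans (Real.rpow_le_rpow_of_exponent_le (z := 1) hx (by linarith))
    rw [Real.rpow_one] at h4
    exact_mod_cast h4
  obtain ⟨u₁, u₂, hu₁, hu₂, hu₁₂, hxu₁, hxu₂, hxN₃⟩ := exists_exponents_of_rpow_lt
    (N₀ := N₀) (N₁ := N₁) (N₂ := N₂) (N₃ := N₃) hx1 hε (by exact_mod_cast h₃)
    (by exact_mod_cast h₃₂) (by exact_mod_cast h₂₁) (by exact_mod_cast hN₁) hN₀le
    (by exact_mod_cast hN)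
  obtain ⟨v₁, v₂, hv, ⟨a₁, a₂, a₃, a₄, a₅⟩, ⟨b₁, b₂, b₃, b₄, b₅⟩, hratio⟩ :=
    exponents_of_sum_le hu₁ hu₂ hu₁₂
  obtain ⟨I, hI⟩ : ∃ I, I = unitsUpTo m N₀ := ⟨_, rfl⟩
  obtain ⟨K, hK⟩ : ∃ K, K = unitsUpTo m y := ⟨_, rfl⟩
  obtain ⟨D, hD⟩ : ∃ D : ℝ → ℝ → Finset ℕ, ∀ u v, D u v =
      {n ∈ I | ¬ ∃ d : ℕ, d ∣ n ∧ (m : ℝ) ^ u ≤ d ∧ (d : ℝ) ≤ (m : ℝ) ^ v} :=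
    ⟨_, fun _ _ => rfl⟩
  have hDI : ∀ u v, ∀ n ∈ D u v, n ∈ I := fun u v n hn => by
    rw [hD] at hn
    exact (mem_filter.1 hn).1
  have hDd : ∀ u v, ∀ n ∈ I, n ∉ D u v →
      ∃ d : ℕ, d ∣ n ∧ (m : ℝ) ^ u ≤ d ∧ (d : ℝ) ≤ (m : ℝ) ^ v := fun u v n hn hnD => by
    by_contra hcon
    exact hnD (by rw [hD]; exact mem_filter.2 ⟨hn, hcon⟩)
  have hDcard : ∀ u v : ℝ, 0 ≤ u → 1 / 8 ≤ v → v ≤ 37 / 200 → 9 / 100 ≤ v - u → v - u ≤ v →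
      2 * u ≤ v → (#(D u v) : ℝ) ≤ #I * (v ^ 2 / (v ^ 2 + 2 * (v - u) ^ 2) + 1 / 2000) := by
    intro u v _ c₁ c₂ c₃ c₄ c₅
    rw [hI]
    refine hdiv N₀ hN₀ge v (v - u) c₁ c₂ c₃ c₄ (by rwa [sub_sub_cancel]) _ fun n hn => ?_
    rw [sub_sub_cancel]
    rw [hD, hI] at hn
    exact mem_filter.1 hn
  have hDsum : (#(D u₁ v₁) : ℝ) + #(D u₂ v₂) ≤ (1 - 1 / 1000) * #I := by
    have hI0 : (0 : ℝ) ≤ #I := by positivity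
    have h5 := mul_le_mul_of_nonneg_left hratio hI0
    have h6 := hDcard u₁ v₁ hu₁ a₁ a₂ a₃ a₄ a₅
    have h7 := hDcard u₂ v₂ hu₂ b₁ b₂ b₃ b₄ b₅
    linarith
  have hcover : ∀ w ∈ tupleSet I I K (j + 1),
      (∃ e ∈ E, (e : ZMod m) = (tupleProd w : ℕ)) → w.1 ∈ D u₁ v₁ ∨ w.2.1 ∈ D u₂ v₂ := by
    rintro w hw ⟨e, he, hew⟩
    by_contra! hcon
    obtain ⟨hw₁, hw₂, hw₃⟩ := mem_tupleSet.1 hw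
    obtain ⟨d₁, hd₁, hd₁u, hd₁v⟩ := hDd u₁ v₁ _ hw₁ hcon.1
    obtain ⟨d₂, hd₂, hd₂u, hd₂v⟩ := hDd u₂ v₂ _ hw₂ hcon.2
    rw [hI] at hw₁ hw₂
    have hn₁ := (mem_unitsUpTo.1 hw₁).1
    have hn₂ := (mem_unitsUpTo.1 hw₂).1
    rw [hxu₁] at hd₁u
    rw [hxu₂] at hd₂u
    have hd₃ : d₁ * d₂ ≤ N₃ := by
      have h8 : ((d₁ * d₂ : ℕ) : ℝ) ≤ N₃ := by
        push_cast
        calc (d₁ * d₂ : ℝ) ≤ (m : ℝ) ^ v₁ * (m : ℝ) ^ v₂ := by gcongr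
          _ = (m : ℝ) ^ (1 / 4 + (u₁ + u₂)) := by rw [← Real.rpow_add hx0, hv]
          _ ≤ N₃ := hxN₃
      exact_mod_cast h8
    refine hE e he ?_
    rw [hew]
    refine isBoxProduct_tupleProd_of_dvd
      (fun i => mem_Icc.2 (mem_unitsUpTo.1 (hK ▸ hw₃ i)).1) hn₁ hn₂ h₁ h₂ hd₁ hd₂ hd₁u hd₂u hd₃ ?_
    have h5 := hfl.2.trans ((Real.rpow_le_rpow_of_exponent_le hx (by
      push_cast; linarith)).trans hN.le)
    exact_mod_cast h5
  have hcount : ∀ S : Finset ℕ, (∀ n ∈ S, n ∈ I) →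
      |(#{w ∈ tupleSet S I K (j + 1) | ∃ e ∈ E, (e : ZMod m) = (tupleProd w : ℕ)} : ℝ) -
        #S * (#I * (#K : ℝ) ^ (j + 1)) * (#E / m.totient)| ≤
      N₀ ^ 2 * y ^ (j + 1) * √(#E / m.totient) * (m : ℝ) ^ (-δ) := by
    intro S hS
    have h9 := hm inferInstance E N₀ S (fun s hs => by
      have h10 := mem_unitsUpTo.1 (hI ▸ hS s hs)
      exact ⟨mem_Icc.2 h10.1, h10.2⟩) hN₀m (by rw [← hN₀, ← hy, ← pow_two]; exact hfl.1)
    rw [← hN₀, ← hy, ← hI, ← hK] at h9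
    rwa [pow_two, ← mul_assoc (#S : ℝ)]
  have hadd : (#{w ∈ tupleSet I I K (j + 1) | ∃ e ∈ E, (e : ZMod m) = (tupleProd w : ℕ)} : ℝ) ≤
      #{w ∈ tupleSet (D u₁ v₁) I K (j + 1) | ∃ e ∈ E, (e : ZMod m) = (tupleProd w : ℕ)} +
      #{w ∈ tupleSet (D u₂ v₂) I K (j + 1) | ∃ e ∈ E, (e : ZMod m) = (tupleProd w : ℕ)} := by
    exact_mod_cast card_tuple_filter_le_add
      (fun v : ℕ => ∃ e ∈ E, (e : ZMod m) = (v : ℕ)) hcover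
  have hbound := mul_le_of_abs_sub_le hadd (hcount I fun _ h => h) (hcount _ (hDI u₁ v₁))
    (hcount _ (hDI u₂ v₂)) (by positivity) (by positivity) hDsum
  have hpos : ∀ {N : ℕ}, (m : ℝ) ^ κ ≤ N → (0 : ℝ) < N := fun h =>
    lt_of_lt_of_le (by positivity) h
  have key := density_le_of_count_le (α := #E / m.totient) (c := 1 / 1000) (C := 3) (a := 2)
    (k := j + 1) (δ := δ) (by positivity) (by norm_num) hx (hpos hNκ) (hpos hyκ)
    (hu N₀ hNκ) (hu y hyκ) (by push_cast; linarith) (by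
      rw [← hI, ← hK]
      linarith)
  norm_num at key ⊢
  exact key

end

section

open Finset Filter

theorem exists_density_le_of_sorted {ε : ℝ} (hε : 0 < ε) (hε8 : ε ≤ 1 / 8) :
    ∃ δ : ℝ, 0 < δ ∧ ∀ᶠ m : ℕ in atTop, ∀ _ : NeZero m, ∀ N₁ N₂ N₃ : ℕ, 0 < N₃ → N₃ ≤ N₂ →
      N₂ ≤ N₁ → (m : ℝ) ^ (1 + ε) < ((N₁ * N₂ * N₃ : ℕ) : ℝ) →
      ∀ E : Finset (ZMod m)ˣ, (∀ e ∈ E, ¬ IsBoxProduct N₁ N₂ N₃ (e : ZMod m)) →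
      (#E / m.totient : ℝ) ≤ 3000 ^ 2 * (m : ℝ) ^ (-δ) := by
  obtain ⟨δ₁, hδ₁, h₁⟩ := exists_density_le_of_floor_le hε hε8
  obtain ⟨δ₂, hδ₂, h₂⟩ := exists_density_le_of_lt_floor hε hε8
  refine ⟨min δ₁ δ₂, lt_min hδ₁ hδ₂, ?_⟩
  filter_upwards [h₁, h₂, eventually_ge_atTop 1]
    with m h₁ h₂ hm _ N₁ N₂ N₃ hN₃ hN₃₂ hN₂₁ hN E hE
  have hx : (1 : ℝ) ≤ m := by exact_mod_cast hm
  rcases le_total ⌊(m : ℝ) ^ (3 / 8 + ε / 3)⌋₊ N₁ with h | h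
  · refine (h₁ inferInstance N₁ N₂ N₃ (hN₃.trans_le hN₃₂) hN₃ hN h E hE).trans ?_
    have h3 : (m : ℝ) ^ (-δ₁) ≤ (m : ℝ) ^ (-min δ₁ δ₂) :=
      Real.rpow_le_rpow_of_exponent_le hx (neg_le_neg (min_le_left _ _))
    have h4 : 0 ≤ (m : ℝ) ^ (-min δ₁ δ₂) := by positivity
    linarith
  · refine (h₂ inferInstance N₁ N₂ N₃ hN₃ hN₃₂ hN₂₁ hN h E hE).trans ?_
    exact mul_le_mul_of_nonneg_left
      (Real.rpow_le_rpow_of_exponent_le hx (neg_le_neg (min_le_right _ _))) (by norm_num)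

theorem exists_card_le {ε : ℝ} (hε : 0 < ε) (hε8 : ε ≤ 1 / 8) :
    ∃ δ : ℝ, 0 < δ ∧ ∀ᶠ m : ℕ in atTop, ∀ N₁ N₂ N₃ : ℕ, 0 < N₁ → 0 < N₂ → 0 < N₃ →
      (m : ℝ) ^ (1 + ε) < ((N₁ * N₂ * N₃ : ℕ) : ℝ) →
      ∀ E : Finset (ZMod m)ˣ, (∀ e ∈ E, ¬ IsBoxProduct N₁ N₂ N₃ (e : ZMod m)) →
      (#E : ℝ) ≤ 3000 ^ 2 * (m : ℝ) ^ (1 - δ) := by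
  obtain ⟨δ, hδ, h⟩ := exists_density_le_of_sorted hε hε8
  refine ⟨δ, hδ, ?_⟩
  filter_upwards [h, eventually_ge_atTop 1] with m h hm N₁ N₂ N₃ h₁ h₂ h₃ hN E hE
  have _ : NeZero m := ⟨by lia⟩
  have hx0 : (0 : ℝ) < m := by exact_mod_cast hm
  have hφ : (0 : ℝ) < m.totient := by exact_mod_cast Nat.totient_pos.2 hm
  suffices hdens : (#E / m.totient : ℝ) ≤ 3000 ^ 2 * (m : ℝ) ^ (-δ) by
    rw [div_le_iff₀ hφ] at hdens
    calc (#E : ℝ) ≤ 3000 ^ 2 * (m : ℝ) ^ (-δ) * m.totient := hdens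
      _ ≤ 3000 ^ 2 * (m : ℝ) ^ (-δ) * m := by
          have : (m.totient : ℝ) ≤ m := by exact_mod_cast Nat.totient_le m
          gcongr
      _ = _ := by rw [sub_eq_neg_add, Real.rpow_add hx0, Real.rpow_one, mul_assoc]
  have hN' : ∀ {A B C : ℕ}, N₁ * N₂ * N₃ = A * B * C →
      (m : ℝ) ^ (1 + ε) < ((A * B * C : ℕ) : ℝ) := fun e => e ▸ hN
  rcases le_total N₁ N₂ with h12 | h12 <;> rcases le_total N₂ N₃ with h23 | h23 <;>
    rcases le_total N₁ N₃ with h13 | h13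
  · exact h inferInstance N₃ N₂ N₁ h₁ h12 h23 (hN' (by ring)) E
      fun e he hb => hE e he hb.swap_left.swap_right.swap_left
  · exact h inferInstance N₃ N₂ N₁ h₁ h12 h23 (hN' (by ring)) E
      fun e he hb => hE e he hb.swap_left.swap_right.swap_left
  · exact h inferInstance N₂ N₃ N₁ h₁ h13 h23 (hN' (by ring)) E
      fun e he hb => hE e he hb.swap_right.swap_left
  · exact h inferInstance N₂ N₁ N₃ h₃ h13 h12 (hN' (by ring)) E
      fun e he hb => hE e he hb.swap_left
  · exact h inferInstance N₃ N₁ N₂ h₂ h12 h13 (hN' (by ring)) E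
      fun e he hb => hE e he hb.swap_left.swap_right
  · exact h inferInstance N₁ N₃ N₂ h₂ h23 h13 (hN' (by ring)) E
      fun e he hb => hE e he hb.swap_right
  · exact h inferInstance N₁ N₂ N₃ h₃ h23 h12 hN E hE
  · exact h inferInstance N₁ N₂ N₃ h₃ h23 h12 hN E hE

end

/-- For every ε > 0 there is ε₁ > 0 such that for all large m and positive N₁, N₂, N₃ with
N₁N₂N₃ > m^(1+ε), the number of units λ mod m not of the form x₁x₂x₃ with xⱼ ∈ [1,Nⱼ]
is O(m^(1-ε₁)). -/
theorem stmt2 :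
    ∀ ε : ℝ, 0 < ε → ∃ ε₁ : ℝ, 0 < ε₁ ∧ ∃ C : ℝ, 0 < C ∧ ∃ M : ℕ, ∀ m : ℕ, M ≤ m →
      ∀ N₁ N₂ N₃ : ℕ, 0 < N₁ → 0 < N₂ → 0 < N₃ →
      (m : ℝ) ^ ((1 : ℝ) + ε) < ((N₁ * N₂ * N₃ : ℕ) : ℝ) →
      ({lam : (ZMod m)ˣ | ¬ ∃ x₁ x₂ x₃ : ℕ,
          x₁ ∈ Finset.Icc 1 N₁ ∧ x₂ ∈ Finset.Icc 1 N₂ ∧ x₃ ∈ Finset.Icc 1 N₃ ∧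
          (lam : ZMod m) = ((x₁ * x₂ * x₃ : ℕ) : ZMod m)}.ncard : ℝ)
        ≤ C * (m : ℝ) ^ ((1 : ℝ) - ε₁) := by
  intro ε hε
  obtain ⟨δ, hδ, h⟩ := exists_card_le (ε := min ε (1 / 8)) (by positivity) (min_le_right _ _)
  obtain ⟨M, hM⟩ := Filter.eventually_atTop.1 (h.and (Filter.eventually_ge_atTop 1))
  refine ⟨δ, hδ, 3000 ^ 2, by norm_num, M, fun m hm N₁ N₂ N₃ h₁ h₂ h₃ hN => ?_⟩
  obtain ⟨hcard, hm1⟩ := hM m hm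
  have _ : NeZero m := ⟨by lia⟩
  have hx : (1 : ℝ) ≤ m := by exact_mod_cast hm1
  rw [Set.ncard_eq_toFinset_card _ (Set.toFinite _)]
  refine hcard N₁ N₂ N₃ h₁ h₂ h₃ (lt_of_le_of_lt (Real.rpow_le_rpow_of_exponent_le hx ?_) hN) _
    fun e he => ?_
  · linarith [min_le_left ε (1 / 8)]
  · exact (Set.Finite.mem_toFinset _).1 he
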